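/- Let A be a commutative Noetherian ring of dimension d containing an infinite field k, and let P be a finitely generated projective A[T]-module of rank n with 2n ≥ d + 3. Assume the singular locus of Spec(A) is a closed set V(𝒥) with ht(𝒥) ≥ d − n + 2. If P_f has a unimodular element for some monic polynomial f ∈ A[T], then P has a unimodular element. -/

import Mathlib

/-- The height of an ideal: the infimum of the dimensions of localizations at primes
containing it. -/
noncomputable def idealHt {A : Type*} [CommRing A] (I : Ideal A) : WithBot (WithTop ℕ) :=
  ⨅ p ∈ {p : PrimeSpectrum A | I ≤ p.asIdeal}, ringKrullDim (Localization.AtPrime p.asIdeal)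

/-- A module has a unimodular element if some element is mapped to `1` by a linear functional. -/
def HasUnimodular (R M : Type*) [CommRing R] [AddCommGroup M] [Module R M] : Prop :=
  ∃ (m : M) (φ : M →ₗ[R] R), φ m = 1

/-- The local rank of a module at every prime, as a constant-rank condition. -/
def HasRank (R M : Type*) [CommRing R] [AddCommGroup M] [Module R M] (n : ℕ) : Prop :=
  ∀ p : PrimeSpectrum R,
    Module.rank (Localization.AtPrime p.asIdeal) (LocalizedModule p.asIdeal.primeCompl M) = n

/-- `Spec A` is regular at the prime `p` if the maximal ideal of the (Noetherian) local ring
`A_p` is generated by `dim A_p` elements. -/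
def RegularAt (A : Type*) [CommRing A] (p : PrimeSpectrum A) : Prop :=
  ∃ s : Finset (Localization.AtPrime p.asIdeal),
    Ideal.span (s : Set (Localization.AtPrime p.asIdeal)) = IsLocalRing.maximalIdeal _ ∧
    (s.card : WithBot (WithTop ℕ)) = ringKrullDim (Localization.AtPrime p.asIdeal)

section Elimination

variable {K V : Type*} [Field K] [AddCommGroup V] [Module K V]

open Module Submodule in
lemma finrank_span_le_elim [FiniteDimensional K V] {t : ℕ} (y : Fin (t + 1) → V) (r : Fin t → K) :
    finrank K (span K (Set.range y)) ≤
      finrank K (span K (Set.range fun i : Fin t => y i.castSucc + r i • y (Fin.last t))) + 1 := by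
  set S := span K (Set.range fun i : Fin t => y i.castSucc + r i • y (Fin.last t))
  have h : span K (Set.range y) ≤ S ⊔ span K {y (Fin.last t)} := by
    rw [span_le]
    rintro _ ⟨i, rfl⟩
    have hz : y (Fin.last t) ∈ S ⊔ span K {y (Fin.last t)} :=
      mem_sup_right (mem_span_singleton_self _)
    refine Fin.lastCases hz (fun i => ?_) i
    have : y i.castSucc = (y i.castSucc + r i • y (Fin.last t)) - r i • y (Fin.last t) := by simp
    rw [this]
    exact sub_mem (mem_sup_left (subset_span ⟨i, rfl⟩)) (smul_mem _ _ hz)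
  calc _ ≤ _ := finrank_mono h
    _ ≤ finrank K S + finrank K (span K {y (Fin.last t)}) := finrank_add_le_finrank_add_finrank _ _
    _ ≤ _ := by gcongr; exact (finrank_span_le_card _).trans (by simp)

open Module Submodule in
lemma exists_elim_adjust {t : ℕ} (y : Fin (t + 1) → V) (r : Fin t → K)
    (h : finrank K (span K (Set.range fun i : Fin t => y i.castSucc + r i • y (Fin.last t))) < t) :
    ∃ i₀, ∀ b : K, b ≠ 0 →
      finrank K (span K (Set.range fun i : Fin t =>
        y i.castSucc + (r i + if i = i₀ then b else 0) • y (Fin.last t))) =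
      finrank K (span K (Set.range y)) := by
  set z := y (Fin.last t)
  have hdep : ¬ LinearIndependent K (fun i : Fin t => y i.castSucc + r i • z) := by
    intro hi
    rw [finrank_span_eq_card hi] at h
    simp at h
  obtain ⟨c, hc, i₀, hi₀⟩ := Fintype.not_linearIndependent_iff.1 hdep
  refine ⟨i₀, fun b hb => ?_⟩
  set x : Fin t → V := fun i : Fin t => y i.castSucc + (r i + if i = i₀ then b else 0) • z
  have hx : ∀ i, x i ∈ span K (Set.range x) := fun i => subset_span ⟨i, rfl⟩
  have hz : z ∈ span K (Set.range x) := by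
    have : ∑ i, c i • x i = (c i₀ * b) • z := by
      have : ∀ i, c i • x i = c i • (y i.castSucc + r i • z) + 
          if i = i₀ then (c i₀ * b) • z else 0 := by
        intro i
        simp only [x, add_smul, smul_add]
        split_ifs with hii
        · subst hii; rw [mul_smul]; abel
        · simp
      simp_rw [this, Finset.sum_add_distrib, hc]
      simp
    have h2 : (c i₀ * b) • z ∈ span K (Set.range x) := by
      rw [← this]; exact sum_mem fun i _ => smul_mem _ _ (hx i)
    exact (smul_mem_iff _ (mul_ne_zero hi₀ hb)).1 h2
  suffices span K (Set.range x) = span K (Set.range y) by rw [this]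
  apply le_antisymm
  · rw [span_le]
    rintro _ ⟨i, rfl⟩
    exact add_mem (subset_span ⟨_, rfl⟩) (smul_mem _ _ (subset_span ⟨_, rfl⟩))
  · rw [span_le]
    rintro _ ⟨i, rfl⟩
    refine Fin.lastCases hz (fun i => ?_) i
    have : y i.castSucc = x i - (r i + if i = i₀ then b else 0) • z := by simp [x]
    rw [this]
    exact sub_mem (hx i) (smul_mem _ _ hz)

end Elimination

section RankAt

variable {R : Type*} [CommRing R]

/-- The rank of a matrix over the residue field of a prime. -/
noncomputable def rkAt {m n : Type*} [Fintype n] (p : PrimeSpectrum R) (X : Matrix m n R) : ℕ :=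
  (X.map (algebraMap R p.asIdeal.ResidueField)).rank

lemma exists_clear_denom {m n : Type*} [Finite m] [Finite n] (p : PrimeSpectrum R)
    (X : Matrix m n p.asIdeal.ResidueField) :
    ∃ (c : R) (Y : Matrix m n R), c ∉ p.asIdeal ∧
      Y.map (algebraMap R p.asIdeal.ResidueField) = algebraMap R p.asIdeal.ResidueField c • X := by
  cases nonempty_fintype m
  cases nonempty_fintype n
  let A := R ⧸ p.asIdeal
  obtain ⟨b, hb⟩ := IsLocalization.exist_integer_multiples_of_finite (nonZeroDivisors A)
    (fun ij : m × n => X ij.1 ij.2)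
  obtain ⟨c, hc⟩ := Ideal.Quotient.mk_surjective b.1
  choose a ha using hb
  choose a' ha' using fun ij => Ideal.Quotient.mk_surjective (a ij)
  have key : ∀ x : R, algebraMap R p.asIdeal.ResidueField x =
    algebraMap A p.asIdeal.ResidueField (Ideal.Quotient.mk _ x) := fun x => rfl
  refine ⟨c, Matrix.of fun i j => a' (i, j), ?_, ?_⟩
  · rw [← Ideal.Quotient.eq_zero_iff_mem, hc]
    exact nonZeroDivisors.ne_zero b.2
  · ext i j
    have := ha (i, j)
    simp only [Matrix.map_apply, Matrix.smul_apply, smul_eq_mul, Matrix.of_apply]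
    rw [key, key, ha', hc, this, Algebra.smul_def]

lemma lt_rank_iff {K : Type*} [Field K] {m n : Type*} [Fintype m] [Fintype n] (X : Matrix m n K)
    (s : ℕ) : s ≤ X.rank ↔
      ∃ (Y : Matrix (Fin s) m K) (Z : Matrix n (Fin s) K), Y * X * Z = 1 := by
  classical
  constructor
  · intro h
    obtain ⟨f, hf⟩ := X.mulVecLin.rangeRestrict.exists_rightInverse_of_surjective
      (LinearMap.range_rangeRestrict _)
    have hs : s ≤ Module.finrank K (LinearMap.range X.mulVecLin) := h
    obtain ⟨v, hv⟩ := exists_linearIndependent_of_le_finrank hs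
    have hv' : LinearIndependent K (fun i => (v i : m → K)) :=
      hv.map' (Submodule.subtype _) (Submodule.ker_subtype _)
    obtain ⟨g, hg⟩ := (Fintype.linearCombination K (fun i => (v i : m → K))).exists_leftInverse_of_injective
      (LinearMap.ker_eq_bot.2 (linearIndependent_iff_injective_fintypeLinearCombination.1 hv'))
    refine ⟨LinearMap.toMatrix' g, Matrix.of fun j i => f (v i) j, ?_⟩
    rw [Matrix.mul_assoc]
    ext i j
    have h1 : X.mulVec (f (v j)) = v j := by
      have := congrArg Subtype.val (LinearMap.congr_fun hf (v j))
      simpa using this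
    have h2 : (X * Matrix.of fun j i => f (v i) j) = Matrix.of fun a b => (v b : m → K) a := by
      ext a b
      have h1 : X.mulVec (f (v b)) = v b := by
        have := congrArg Subtype.val (LinearMap.congr_fun hf (v b))
        simpa using this
      rw [Matrix.of_apply, ← h1]; rfl
    rw [h2]
    have h3 : (LinearMap.toMatrix' g).mulVec (v j) = Pi.single j 1 := by
      rw [← Matrix.toLin'_apply, Matrix.toLin'_toMatrix']
      have := LinearMap.congr_fun hg (Pi.single j 1)
      simpa using this
    calc _ = (LinearMap.toMatrix' g).mulVec (v j) i := rfl
      _ = _ := by rw [h3, Matrix.one_apply, Pi.single_apply]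
  · rintro ⟨Y, Z, h⟩
    have h1 : (Y * X * Z).rank = s := by rw [h, Matrix.rank_one]; simp
    rw [← h1]
    exact (Matrix.rank_mul_le_left _ _).trans (Matrix.rank_mul_le_right _ _)

/-- Locus where the rank is small is closed. -/
lemma exists_ideal_rkAt_le {m n : Type*} [Fintype m] [Fintype n] (X : Matrix m n R) (s : ℕ) :
    ∃ I : Ideal R, ∀ p : PrimeSpectrum R, rkAt p X ≤ s ↔ I ≤ p.asIdeal := by
  classical
  refine ⟨Ideal.span {d | ∃ (Y : Matrix (Fin (s + 1)) m R) (Z : Matrix n (Fin (s + 1)) R),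
    d = (Y * X * Z).det}, fun p => ?_⟩
  rw [← not_lt, ← Nat.succ_le_iff, Nat.succ_eq_add_one, rkAt, lt_rank_iff, ← not_iff_not, not_not,
    Ideal.span_le, Set.not_subset]
  have key : ∀ x : R, x ∉ p.asIdeal ↔ algebraMap R p.asIdeal.ResidueField x ≠ 0 := fun x => by
    rw [Ne, Ideal.algebraMap_residueField_eq_zero]
  constructor
  · rintro ⟨Y, Z, h⟩
    obtain ⟨c, Y', hc, hY⟩ := exists_clear_denom p Y
    obtain ⟨d, Z', hd, hZ⟩ := exists_clear_denom p Z
    refine ⟨_, ⟨Y', Z', rfl⟩, ?_⟩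
    rw [SetLike.mem_coe, key, RingHom.map_det, RingHom.mapMatrix_apply, Matrix.map_mul, Matrix.map_mul, hY, hZ]
    simp only [Matrix.smul_mul, Matrix.mul_smul, h, smul_smul, Matrix.det_smul, Matrix.det_one]
    have := (key _).1 hc
    have := (key _).1 hd
    simp_all
  · rintro ⟨_, ⟨Y, Z, rfl⟩, h⟩
    rw [SetLike.mem_coe, key, RingHom.map_det, RingHom.mapMatrix_apply, Matrix.map_mul, Matrix.map_mul] at h
    refine ⟨Y.map (algebraMap R p.asIdeal.ResidueField),
      Z.map (algebraMap R p.asIdeal.ResidueField) * (Y.map (algebraMap R p.asIdeal.ResidueField) * X.map (algebraMap R p.asIdeal.ResidueField) *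
      Z.map (algebraMap R p.asIdeal.ResidueField))⁻¹, ?_⟩
    rw [← Matrix.mul_assoc, Matrix.mul_nonsing_inv _ (Ne.isUnit h)]

end RankAt

section GeneralPosition

variable {R : Type*} [CommRing R]

lemma rkAt_eq_finrank {m n : Type*} [Finite m] [Fintype n] (p : PrimeSpectrum R)
    (X : Matrix m n R) : rkAt p X = Module.finrank p.asIdeal.ResidueField
      (Submodule.span p.asIdeal.ResidueField
        (Set.range fun i j => algebraMap R p.asIdeal.ResidueField (X i j))) :=
  Matrix.rank_eq_finrank_span_row _

/-- Eliminate the last row of a matrix by adding multiples of it to the other rows. -/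
def elimLast {t : ℕ} {m : Type*} (X : Matrix (Fin (t + 1)) m R) (r : Fin t → R) :
    Matrix (Fin t) m R :=
  Matrix.of fun i => X i.castSucc + r i • X (Fin.last t)

lemma elimLast_algebraMap {t : ℕ} {m K : Type*} [CommRing K] [Algebra R K]
    (X : Matrix (Fin (t + 1)) m R) (r : Fin t → R) :
    (fun i j => algebraMap R K (elimLast X r i j)) = fun i =>
      (fun i j => algebraMap R K (X i j)) i.castSucc + algebraMap R K (r i) •
        (fun i j => algebraMap R K (X i j)) (Fin.last t) := by
  ext i j; simp [elimLast, Algebra.smul_def]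

lemma rkAt_le_elimLast {t : ℕ} {m : Type*} [Fintype m] (p : PrimeSpectrum R)
    (X : Matrix (Fin (t + 1)) m R) (r : Fin t → R) : rkAt p X ≤ rkAt p (elimLast X r) + 1 := by
  rw [rkAt_eq_finrank, rkAt_eq_finrank]
  rw [elimLast_algebraMap X r]
  exact finrank_span_le_elim _ (fun i => algebraMap R p.asIdeal.ResidueField (r i))

lemma exists_elimLast_adjust {t : ℕ} {m : Type*} [Fintype m] (p : PrimeSpectrum R)
    (X : Matrix (Fin (t + 1)) m R) (r : Fin t → R) (h : rkAt p (elimLast X r) < t) :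
    ∃ i₀, ∀ b ∉ p.asIdeal,
      rkAt p (elimLast X (fun i => r i + if i = i₀ then b else 0)) = rkAt p X := by
  have := exists_elim_adjust (fun i j => algebraMap R p.asIdeal.ResidueField (X i j))
    (fun i => algebraMap R p.asIdeal.ResidueField (r i)) (by
      rwa [rkAt_eq_finrank, elimLast_algebraMap X r] at h)
  obtain ⟨i₀, hi⟩ := this
  refine ⟨i₀, fun b hb => ?_⟩
  rw [rkAt_eq_finrank, rkAt_eq_finrank, ← hi (algebraMap R p.asIdeal.ResidueField b)
    (by rwa [Ne, Ideal.algebraMap_residueField_eq_zero])]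
  rw [elimLast_algebraMap]
  have key : ∀ i, algebraMap R p.asIdeal.ResidueField (r i + if i = i₀ then b else 0) =
      algebraMap R p.asIdeal.ResidueField (r i) +
        if i = i₀ then algebraMap R p.asIdeal.ResidueField b else 0 := by
    intro i; split_ifs <;> simp
  exact congrArg (fun g : Fin t → p.asIdeal.ResidueField =>
    Module.finrank p.asIdeal.ResidueField (Submodule.span p.asIdeal.ResidueField
      (Set.range fun i => (fun i j => algebraMap R p.asIdeal.ResidueField (X i j)) i.castSucc +
        g i • (fun i j => algebraMap R p.asIdeal.ResidueField (X i j)) (Fin.last t)))) (funext key)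

lemma exists_elimLast_finset {t : ℕ} {m : Type*} [Fintype m]
    (X : Matrix (Fin (t + 1)) m R) (F : Finset (PrimeSpectrum R)) :
    ∃ 𝒜 : Finset R, ∀ r₀ : Fin t → R, ∃ a : Fin t → R, (∀ i, a i ∈ 𝒜) ∧
      ∀ p ∈ F, min t (rkAt p X) ≤ rkAt p (elimLast X (r₀ + a)) := by
  classical
  induction F using Finset.strongInduction with
  | H F ih =>
  rcases F.eq_empty_or_nonempty with rfl | hF
  · exact ⟨{0}, fun r₀ => ⟨0, by simp⟩⟩
  obtain ⟨p, hp⟩ := F.exists_minimal hF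
  obtain ⟨𝒜, h𝒜⟩ := ih (F.erase p) (Finset.erase_ssubset hp.prop)
  obtain ⟨b, hb, hbp⟩ : ∃ b, (∀ q ∈ F.erase p, b ∈ q.asIdeal) ∧ b ∉ p.asIdeal := by
    have : ¬ (F.erase p).inf PrimeSpectrum.asIdeal ≤ p.asIdeal := by
      rw [Ideal.IsPrime.inf_le' p.2]
      rintro ⟨q, hq, hqp⟩
      rw [Finset.mem_erase] at hq
      exact hq.1 (le_antisymm hqp (hp.le_of_le hq.2 hqp))
    obtain ⟨b, hb, hbp⟩ := SetLike.not_le_iff_exists.1 this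
    exact ⟨b, fun q hq => Finset.inf_le (f := PrimeSpectrum.asIdeal) hq hb, hbp⟩
  refine ⟨𝒜 ∪ 𝒜.image (· + b), fun r₀ => ?_⟩
  obtain ⟨a, ha, h⟩ := h𝒜 r₀
  by_cases hgood : min t (rkAt p X) ≤ rkAt p (elimLast X (r₀ + a))
  · refine ⟨a, fun i => Finset.mem_union_left _ (ha i), fun q hq => ?_⟩
    by_cases hqp : q = p
    · rwa [hqp]
    · exact h q (Finset.mem_erase.2 ⟨hqp, hq⟩)
  obtain ⟨i₀, hi₀⟩ := exists_elimLast_adjust p X (r₀ + a) (by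
    push Not at hgood
    exact hgood.trans_le (min_le_left _ _))
  refine ⟨fun i => a i + if i = i₀ then b else 0, fun i => ?_, fun q hq => ?_⟩
  · beta_reduce
    split_ifs
    · exact Finset.mem_union_right _ (Finset.mem_image_of_mem _ (ha i))
    · simpa using Or.inl (ha i)
  · have hr : r₀ + (fun i => a i + if i = i₀ then b else 0) =
      fun i => (r₀ + a) i + if i = i₀ then b else 0 := by
      ext i; simp [add_assoc]
    rw [hr]
    by_cases hqp : q = p
    · rw [hqp, hi₀ b hbp]; exact min_le_right _ _
    · have hq' := Finset.mem_erase.2 ⟨hqp, hq⟩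
      refine (h q hq').trans_eq ?_
      unfold rkAt
      congr 1
      ext i j
      have := (Ideal.algebraMap_residueField_eq_zero (I := q.asIdeal)).2 (hb q hq')
      simp only [elimLast, Matrix.map_apply, Matrix.of_apply, Pi.add_apply, Pi.smul_apply,
        smul_eq_mul, map_add, map_mul]
      split_ifs <;> simp [this]

/-- A family of primes, closed under generization inside `V(a)`, with a strictly antitone weight
(a shifted codimension-like function). -/
structure PrimeFamily (R : Type*) [CommRing R] where
  ideal : Ideal R
  primes : Set (PrimeSpectrum R)
  weight : PrimeSpectrum R → ℤ
  le_of_mem : ∀ p ∈ primes, ideal ≤ p.asIdeal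
  mem_of_le : ∀ p ∈ primes, ∀ q ≤ p, ideal ≤ q.asIdeal → q ∈ primes
  weight_lt : ∀ p ∈ primes, ∀ q ∈ primes, q < p → weight p < weight q

/-- The rows of `X` are in general position with respect to the family. -/
def InGenPos {ι : Type*} (F : ι → PrimeFamily R) {t : ℕ} {m : Type*} [Fintype m]
    (X : Matrix (Fin t) m R) : Prop :=
  ∀ i, ∀ p ∈ (F i).primes, t ≤ rkAt p X ∨ (F i).weight p ≤ rkAt p X

lemma exists_elimLast_inGenPos [IsNoetherianRing R] {ι : Type*} [Finite ι] (F : ι → PrimeFamily R)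
    {t : ℕ} {m : Type*} [Fintype m] (X : Matrix (Fin (t + 1)) m R) (hX : InGenPos F X) :
    ∃ 𝒜 : Finset R, ∀ r₀ : Fin t → R, ∃ a : Fin t → R, (∀ i, a i ∈ 𝒜) ∧
      InGenPos F (elimLast X (r₀ + a)) := by
  classical
  choose Δ hΔ using exists_ideal_rkAt_le X
  have hfin : {p : PrimeSpectrum R | ∃ i, ∃ s : Fin (t + 1),
      p.asIdeal ∈ (Δ s ⊔ (F i).ideal).minimalPrimes}.Finite := by
    rw [Set.ofPred_exists]
    refine Set.finite_iUnion fun i => ?_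
    rw [Set.ofPred_exists]
    refine Set.finite_iUnion fun s => ?_
    exact (Ideal.finite_minimalPrimes_of_isNoetherianRing R _).preimage
      (fun p _ q _ h => PrimeSpectrum.ext h)
  obtain ⟨𝒜, h𝒜⟩ := exists_elimLast_finset X hfin.toFinset
  refine ⟨𝒜, fun r₀ => ?_⟩
  obtain ⟨a, ha, h⟩ := h𝒜 r₀
  refine ⟨a, ha, fun i p hp => ?_⟩
  by_contra! hcon
  obtain ⟨h1, h2⟩ := hcon
  set s := rkAt p (elimLast X (r₀ + a))
  have h3 := rkAt_le_elimLast p X (r₀ + a)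
  rcases hX i p hp with h4 | h4
  · omega
  have h5 : rkAt p X ≤ s + 1 := h3
  have h6 := (hΔ (s + 1) p).1 h5
  obtain ⟨q, hq, hqp⟩ := Ideal.exists_minimalPrimes_le (I := Δ (s + 1) ⊔ (F i).ideal)
    (J := p.asIdeal) (sup_le h6 ((F i).le_of_mem p hp))
  let q' : PrimeSpectrum R := ⟨q, hq.1.1⟩
  have hqF : q' ∈ hfin.toFinset := by
    rw [Set.Finite.mem_toFinset]
    exact ⟨i, ⟨s + 1, by omega⟩, hq⟩
  have h7 := h q' hqF
  have hq1 : rkAt q' X ≤ s + 1 := (hΔ (s + 1) q').2 (le_sup_left.trans hq.1.2)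
  have hqm : q' ∈ (F i).primes := (F i).mem_of_le p hp q' hqp (le_sup_right.trans hq.1.2)
  by_cases hpq : q' = p
  · rw [hpq] at h7
    omega
  · have h8 := (F i).weight_lt p hp q' hqm (lt_of_le_of_ne hqp hpq)
    rcases hX i q' hqm with h9 | h9 <;> omega

/-- Repeated elimination down to a single row, keeping prescribed properties of rows. -/
lemma exists_row_inGenPos [IsNoetherianRing R] {ι : Type*} [Finite ι] (F : ι → PrimeFamily R)
    {m : Type*} [Fintype m] (Q₀ Q₁ : (m → R) → Prop)
    (h₀ : ∀ x z, Q₀ x → Q₁ z → ∀ 𝒜 : Finset R, ∃ r, ∀ a ∈ 𝒜, Q₀ (x + (r + a) • z))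
    (h₁ : ∀ x z, Q₁ x → Q₁ z → ∀ 𝒜 : Finset R, ∃ r, ∀ a ∈ 𝒜, Q₁ (x + (r + a) • z))
    {t : ℕ} (X : Matrix (Fin (t + 1)) m R) (hX : InGenPos F X) (hX₀ : Q₀ (X 0))
    (hX₁ : ∀ i : Fin t, Q₁ (X i.succ)) :
    ∃ y, Q₀ y ∧ ∀ i, ∀ p ∈ (F i).primes, (∀ j, y j ∈ p.asIdeal) → (F i).weight p ≤ 0 := by
  induction t with
  | zero =>
    refine ⟨X 0, hX₀, fun i p hp hy => ?_⟩
    have h0 : rkAt p X = 0 := by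
      unfold rkAt
      have : X.map (algebraMap R p.asIdeal.ResidueField) = 0 := by
        ext k j
        rw [show k = 0 from Subsingleton.elim (α := Fin 1) k 0]
        exact (Ideal.algebraMap_residueField_eq_zero (I := p.asIdeal)).2 (hy j)
      rw [this, Matrix.rank_zero]
    have := hX i p hp
    rw [h0] at this
    simpa using this
  | succ t ih =>
    obtain ⟨𝒜, h𝒜⟩ := exists_elimLast_inGenPos F X hX
    have hl : Q₁ (X (Fin.last (t + 1))) := hX₁ (Fin.last t)
    obtain ⟨r, hr⟩ := h₀ (X 0) _ hX₀ hl 𝒜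
    choose r' hr' using fun i : Fin t => h₁ (X i.castSucc.succ) _ (hX₁ _) hl 𝒜
    obtain ⟨a, ha, h⟩ := h𝒜 (Fin.cons r r')
    refine ih _ h ?_ fun i => ?_
    · exact hr (a 0) (ha 0)
    · exact hr' i (a i.succ) (ha i.succ)

end GeneralPosition

section Applications

variable {R : Type*} [CommRing R]

open Order in
/-- The family of primes attached to a set of primes of dimension at most `D`. -/
noncomputable def PrimeFamily.ofKrullDim (I : Ideal R) (P : Set (PrimeSpectrum R)) (n D : ℕ)
    (hI : ∀ p ∈ P, I ≤ p.asIdeal) (hP : ∀ p ∈ P, ∀ q ≤ p, I ≤ q.asIdeal → q ∈ P)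
    (hD : krullDim P ≤ D) : PrimeFamily R where
  ideal := I
  primes := P
  weight p := open Classical in
    if h : p ∈ P then (n : ℤ) - D + (coheight (⟨p, h⟩ : P)).toNat else 0
  le_of_mem := hI
  mem_of_le := hP
  weight_lt p hp q hq hqp := by
    have hfin : ∀ x : P, coheight x < ⊤ := fun x => by
      have := (coheight_le_krullDim x).trans hD
      refine lt_of_le_of_lt (b := (D : ℕ∞)) (by exact_mod_cast this) (ENat.natCast_lt_top D)
    have h : coheight (⟨p, hp⟩ : P) < coheight (⟨q, hq⟩ : P) :=
      coheight_strictAnti (by exact hqp) (hfin _)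
    simp only [hp, hq, dite_true]
    have h1 : (coheight (⟨p, hp⟩ : P)).toNat < (coheight (⟨q, hq⟩ : P)).toNat := by
      rwa [← ENat.natCast_toNat (hfin _).ne, ← ENat.natCast_toNat (hfin ⟨q, hq⟩).ne,
        Nat.cast_lt] at h
    omega

section

open Order

variable {I : Ideal R} {P : Set (PrimeSpectrum R)} {n D : ℕ}
    {hI : ∀ p ∈ P, I ≤ p.asIdeal} {hP : ∀ p ∈ P, ∀ q ≤ p, I ≤ q.asIdeal → q ∈ P}
    {hD : krullDim P ≤ D}

lemma PrimeFamily.ofKrullDim_weight_le {p : PrimeSpectrum R} (hp : p ∈ P) :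
    (PrimeFamily.ofKrullDim I P n D hI hP hD).weight p ≤ n := by
  have h1 := (coheight_le_krullDim (⟨p, hp⟩ : P)).trans hD
  have h2 : coheight (⟨p, hp⟩ : P) ≤ (D : ℕ∞) := by exact_mod_cast h1
  have h3 := ENat.toNat_le_of_le_natCast h2
  simp only [PrimeFamily.ofKrullDim, hp, dite_true]
  omega

lemma PrimeFamily.coheight_le_of_weight_le {p : PrimeSpectrum R} (hp : p ∈ P)
    (hw : (PrimeFamily.ofKrullDim I P n D hI hP hD).weight p ≤ 0) :
    n ≤ D ∧ coheight (⟨p, hp⟩ : P) ≤ ((D - n : ℕ) : ℕ∞) := by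
  have h1 := (coheight_le_krullDim (⟨p, hp⟩ : P)).trans hD
  have h2 : coheight (⟨p, hp⟩ : P) ≤ (D : ℕ∞) := by exact_mod_cast h1
  simp only [PrimeFamily.ofKrullDim, hp, dite_true] at hw
  have hne : coheight (⟨p, hp⟩ : P) ≠ ⊤ := (lt_of_le_of_lt h2 (ENat.natCast_lt_top D)).ne
  rw [← ENat.natCast_toNat hne]
  refine ⟨by omega, ?_⟩
  norm_cast
  omega

end

lemma rkAt_transpose {m n : Type*} [Fintype m] [Fintype n] (p : PrimeSpectrum R)
    (X : Matrix m n R) : rkAt p X.transpose = rkAt p X := by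
  unfold rkAt
  rw [← Matrix.rank_transpose (X.map _)]
  rfl

lemma rkAt_le_of_submatrix {m l n : Type*} [Fintype n] [Finite m] [Finite l] (p : PrimeSpectrum R)
    (X : Matrix m n R) (f : l → m) : rkAt p (X.submatrix f id) ≤ rkAt p X := by
  unfold rkAt
  rw [Matrix.rank_eq_finrank_span_row, Matrix.rank_eq_finrank_span_row]
  refine Submodule.finrank_mono (Submodule.span_mono ?_)
  rintro _ ⟨i, rfl⟩
  exact ⟨f i, rfl⟩

lemma rkAt_smul {m n : Type*} [Fintype n] (p : PrimeSpectrum R) (X : Matrix m n R) {a : R}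
    (ha : a ∉ p.asIdeal) : rkAt p (a • X) = rkAt p X := by
  unfold rkAt
  rw [← Matrix.rank_smul_of_mem_nonZeroDivisors (X.map _)
    (c := algebraMap R p.asIdeal.ResidueField a)]
  · congr 1
    ext i j
    simp
  · rw [mem_nonZeroDivisors_iff_ne_zero, Ne, Ideal.algebraMap_residueField_eq_zero]
    exact ha

open Matrix in
/-- Avoidance of a family of primes of small dimension by an element of the image of an
idempotent matrix. -/
lemma exists_avoid [IsNoetherianRing R] (I : Ideal R) (P : Set (PrimeSpectrum R)) {N D m : ℕ}
    (hI : ∀ p ∈ P, I ≤ p.asIdeal) (hP : ∀ p ∈ P, ∀ q ≤ p, I ≤ q.asIdeal → q ∈ P)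
    (hD : Order.krullDim P ≤ D) (hDN : D < N) (E : Matrix (Fin m) (Fin m) R) (hE : E * E = E)
    (hrk : ∀ p ∈ P, N ≤ rkAt p E) (a : R) (ha : ∀ p ∈ P, a ∉ p.asIdeal) (θ : Fin m → R) :
    ∃ y, E *ᵥ y = y ∧ ∀ p ∈ P, ¬ ∀ j, (θ + a • y) j ∈ p.asIdeal := by
  let F : Unit → PrimeFamily R := fun _ => PrimeFamily.ofKrullDim I P N D hI hP hD
  let X : Matrix (Fin (m + 1)) (Fin m) R := Matrix.of (Fin.cons θ fun i j => (a • Eᵀ) i j)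
  have hX : InGenPos F X := by
    rintro ⟨⟩ p hp
    right
    refine (PrimeFamily.ofKrullDim_weight_le (p := p) hp).trans ?_
    have h1 : rkAt p (X.submatrix Fin.succ id) = rkAt p E := by
      rw [← rkAt_transpose p E, ← rkAt_smul p Eᵀ (ha p hp)]
      rfl
    have h2 := hrk p hp
    have h3 := rkAt_le_of_submatrix p X Fin.succ
    exact_mod_cast h2.trans (h1 ▸ h3)
  obtain ⟨_, ⟨y, hy, rfl⟩, h⟩ := exists_row_inGenPos F (fun x => ∃ y, E *ᵥ y = y ∧ x = θ + a • y)
    (fun x => ∃ y, E *ᵥ y = y ∧ x = a • y)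
    (by
      rintro _ _ ⟨y, hy, rfl⟩ ⟨z, hz, rfl⟩ 𝒜
      refine ⟨0, fun b _ => ⟨y + b • z, ?_, ?_⟩⟩
      · rw [mulVec_add, mulVec_smul, hy, hz]
      · rw [smul_add, zero_add, smul_comm b a, add_assoc])
    (by
      rintro _ _ ⟨y, hy, rfl⟩ ⟨z, hz, rfl⟩ 𝒜
      refine ⟨0, fun b _ => ⟨y + b • z, ?_, ?_⟩⟩
      · rw [mulVec_add, mulVec_smul, hy, hz]
      · rw [smul_add, zero_add, smul_comm b a])
    X hX ⟨0, by simp, by ext j; simp [X]⟩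
    (fun i => ⟨fun j => E j i, by ext j; exact congrFun (congrFun hE j) i, by ext j; simp [X]⟩)
  refine ⟨y, hy, fun p hp hcon => ?_⟩
  have := (PrimeFamily.coheight_le_of_weight_le (p := p) hp (h () p hp hcon)).1
  omega

open Polynomial in
lemma exists_forall_monic_add {A : Type*} [CommRing A] {f : A[X]} (hf : f.Monic) (g : A[X])
    (𝒜 : Finset A[X]) : ∃ r : A[X], ∀ a ∈ 𝒜, (g + (r + a) * f).Monic := by
  nontriviality A
  refine ⟨X ^ ((𝒜.sup fun a => (g + a * f).natDegree) + 1), fun a ha => ?_⟩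
  rw [add_mul, ← add_assoc, add_right_comm]
  refine Monic.add_of_right ((monic_X_pow _).mul hf) ?_
  refine lt_of_le_of_lt degree_le_natDegree ?_
  rw [hf.degree_mul, degree_X_pow, degree_eq_natDegree hf.ne_zero]
  have : (g + a * f).natDegree ≤ 𝒜.sup fun a => (g + a * f).natDegree :=
    Finset.le_sup (f := fun a => (g + a * f).natDegree) ha
  norm_cast
  omega

open Matrix Polynomial in
/-- A vector in general position with a monic pairing. -/
lemma exists_monic_inGenPos {A : Type*} [CommRing A] [IsNoetherianRing A] {m n D₁ D₂ : ℕ}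
    (e : Matrix (Fin (m + 1)) (Fin (m + 1)) A[X]) (he : e * e = e) (hrk : ∀ p, n ≤ rkAt p e)
    (I : Ideal A[X]) (hD₁ : ringKrullDim A[X] ≤ D₁) (hD₂ : ringKrullDim (A[X] ⧸ I) ≤ D₂)
    (hn : D₂ < n) (v φ : Fin (m + 1) → A[X]) (hv : e *ᵥ v = v) (hφ : (φ ⬝ᵥ v).Monic) :
    ∃ q, e *ᵥ q = q ∧ (φ ⬝ᵥ q).Monic ∧ I ⊔ Ideal.span (Set.range q) = ⊤ ∧
      ringKrullDim (A[X] ⧸ Ideal.span (Set.range q)) ≤ (D₁ - n : ℕ) := by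
  have huniv : Order.krullDim (Set.univ : Set (PrimeSpectrum A[X])) ≤ D₁ :=
    (Order.krullDim_eq_of_orderIso OrderIso.Set.univ).trans_le hD₁
  let F : Bool → PrimeFamily A[X] := fun b => bif b
    then PrimeFamily.ofKrullDim ⊥ Set.univ n D₁ (by simp) (by simp) huniv
    else PrimeFamily.ofKrullDim I (PrimeSpectrum.zeroLocus I) n D₂ (fun p hp => hp)
      (fun p _ q _ h => h) ((ringKrullDim_quotient I).symm.trans_le hD₂)
  let Y : Matrix (Fin (m + 2)) (Fin (m + 1)) A[X] := Matrix.of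
    (Fin.snoc (α := fun _ => Fin (m + 1) → A[X]) (fun i j => eᵀ i j) v)
  have hY : InGenPos F Y := by
    intro b p hp
    right
    have h1 : rkAt p (Y.submatrix Fin.castSucc id) = rkAt p e := by
      rw [← rkAt_transpose p e]
      congr 1
      ext i j
      simp [Y]
    have h2 : (n : ℤ) ≤ rkAt p Y := by
      have h2 := hrk p
      have h3 := rkAt_le_of_submatrix p Y Fin.castSucc
      exact_mod_cast h2.trans (h1 ▸ h3)
    refine le_trans ?_ h2
    cases b
    · exact PrimeFamily.ofKrullDim_weight_le (hD := (ringKrullDim_quotient I).symm.trans_le hD₂) hp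
    · exact PrimeFamily.ofKrullDim_weight_le (hD := huniv) (Set.mem_univ p)
  have hcol : ∀ i, e *ᵥ (fun j => eᵀ i j) = fun j => eᵀ i j := fun i => by
    funext j; exact congrFun (congrFun he j) i
  let Q : (Fin (m + 1) → A[X]) → Prop := fun x => e *ᵥ x = x ∧ (φ ⬝ᵥ x).Monic
  have hQ : ∀ x z, e *ᵥ x = x → Q z → ∀ 𝒜 : Finset A[X], ∃ r, ∀ a ∈ 𝒜, Q (x + (r + a) • z) := by
    rintro x z hx ⟨hz, hz'⟩ 𝒜
    obtain ⟨r, hr⟩ := exists_forall_monic_add hz' (φ ⬝ᵥ x) 𝒜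
    refine ⟨r, fun a ha => ⟨?_, ?_⟩⟩
    · rw [mulVec_add, mulVec_smul, hz, hx]
    · rw [dotProduct_add, dotProduct_smul, smul_eq_mul]
      exact hr a ha
  obtain ⟨𝒜, h𝒜⟩ := exists_elimLast_inGenPos F Y hY
  choose r hr using fun i => hQ (fun j => eᵀ i j) v (hcol i) ⟨hv, hφ⟩ 𝒜
  obtain ⟨a, ha, hX⟩ := h𝒜 r
  have hQX : ∀ i, Q (elimLast Y (r + a) i) := fun i => by
    convert hr i (a i) (ha i) using 1
    ext j
    simp [elimLast, Y]
  obtain ⟨q, hq, h⟩ := exists_row_inGenPos F Q Q (fun x z hx => hQ x z hx.1)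
    (fun x z hx => hQ x z hx.1) _ hX (hQX 0) (fun i => hQX _)
  refine ⟨q, hq.1, hq.2, ?_, ?_⟩
  · by_contra hne
    obtain ⟨M, hM, hle⟩ := Ideal.exists_le_maximal _ hne
    let p : PrimeSpectrum A[X] := ⟨M, hM.isPrime⟩
    have hp : p ∈ PrimeSpectrum.zeroLocus (I : Set A[X]) := le_sup_left.trans hle
    have := (PrimeFamily.coheight_le_of_weight_le (hD := (ringKrullDim_quotient I).symm.trans_le hD₂) hp (h false p hp
      fun j => hle (Ideal.mem_sup_right (Ideal.subset_span ⟨j, rfl⟩)))).1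
    omega
  · rw [ringKrullDim_quotient, Order.krullDim_eq_iSup_coheight]
    refine iSup_le fun p => ?_
    have h1 := (PrimeFamily.coheight_le_of_weight_le (hD := huniv) (Set.mem_univ _)
      (h true p.1 (Set.mem_univ _) fun j => p.2 (Ideal.subset_span ⟨j, rfl⟩))).2
    have h2 := Order.coheight_le_coheight_apply_of_strictMono
      (fun x : PrimeSpectrum.zeroLocus (Ideal.span (Set.range q) : Set A[X]) =>
        (⟨x.1, Set.mem_univ _⟩ : (Set.univ : Set (PrimeSpectrum A[X])))) (fun _ _ h => h) p
    exact (WithBot.coe_le_coe.2 (h2.trans h1)).trans_eq rfl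

end Applications

section Patching

open Matrix Polynomial

variable {N : Type*} [Fintype N] [DecidableEq N]

/-- Two pairs (matrix, vector) are related by an invertible matrix acting by conjugation on the
matrix and by multiplication on the vector. -/
def PairRel {A : Type*} [CommRing A] (γ : (Matrix N N A)ˣ) (x y : Matrix N N A × (N → A)) : Prop :=
  (γ : Matrix N N A) * x.1 = y.1 * γ ∧ (γ : Matrix N N A) *ᵥ x.2 = y.2

/-- Apply a ring homomorphism to a pair (matrix, vector). -/
def mapPair {A B : Type*} [CommRing A] [CommRing B] (f : A →+* B) (x : Matrix N N A × (N → A)) :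
    Matrix N N B × (N → B) := (x.1.map f, f ∘ x.2)

section

variable {A B D : Type*} [CommRing A] [CommRing B] [CommRing D]

lemma mapPair_comp {N : Type*} (f : A →+* B) (g : B →+* D) (x : Matrix N N A × (N → A)) :
    mapPair g (mapPair f x) = mapPair (g.comp f) x := rfl

lemma PairRel.map (f : A →+* B) {γ : (Matrix N N A)ˣ} {x y} (h : PairRel γ x y) :
    PairRel (Units.map (f.mapMatrix : Matrix N N A →+* Matrix N N B).toMonoidHom γ)
      (mapPair f x) (mapPair f y) := by
  refine ⟨?_, ?_⟩
  · have := congrArg (fun X : Matrix N N A => X.map f) h.1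
    simpa [mapPair, Matrix.map_mul] using this
  · have := congrArg (fun v : N → A => f ∘ v) h.2
    ext i
    have := congrFun this i
    simpa [mapPair, RingHom.map_mulVec] using this

lemma PairRel.trans {γ δ : (Matrix N N A)ˣ} {x y z} (h : PairRel γ x y) (h' : PairRel δ y z) :
    PairRel (δ * γ) x z := by
  refine ⟨?_, ?_⟩
  · rw [Units.val_mul, mul_assoc, h.1, ← mul_assoc, h'.1, mul_assoc]
  · rw [Units.val_mul, ← mulVec_mulVec, h.2, h'.2]

lemma PairRel.symm {γ : (Matrix N N A)ˣ} {x y} (h : PairRel γ x y) : PairRel γ⁻¹ y x := by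
  refine ⟨?_, ?_⟩
  · rw [Units.inv_mul_eq_iff_eq_mul, ← mul_assoc, h.1, Units.mul_inv_cancel_right]
  · rw [← h.2, mulVec_mulVec, Units.inv_mul, one_mulVec]

end

section Lift

variable {H H' : Type*} [CommRing H] [CommRing H'] [Algebra H H'] (S : Submonoid H)
  [IsLocalization S H']

lemma exists_lift_scaled {ι : Type*} [Finite ι] (p : ι → H'[X]) (c : ι → H)
    (hc : ∀ i, (p i).coeff 0 = algebraMap H H' (c i)) :
    ∃ s ∈ S, ∃ q : ι → H[X], (∀ i, (q i).coeff 0 = c i) ∧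
      ∀ i, (q i).map (algebraMap H H') = (p i).comp (C (algebraMap H H' s) * X) := by
  classical
  cases nonempty_fintype ι
  obtain ⟨s, hs⟩ := IsLocalization.exist_integer_multiples (M := S) (S := H')
    (Finset.univ.sigma fun i : ι => (p i).support) (fun ij => (p ij.1).coeff ij.2)
  have hs' : ∀ i j, ∃ h : H, algebraMap H H' h = algebraMap H H' s * (p i).coeff j := by
    intro i j
    by_cases hj : j ∈ (p i).support
    · obtain ⟨h, hh⟩ := hs ⟨i, j⟩ (by simpa using hj)
      exact ⟨h, by rw [hh, Algebra.smul_def]⟩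
    · exact ⟨0, by rw [notMem_support_iff.1 hj]; simp⟩
  choose h hh using hs'
  refine ⟨s, s.2, fun i => C (c i) + ∑ j ∈ Finset.range (p i).natDegree,
    monomial (j + 1) (s.1 ^ j * h i (j + 1)), fun i => ?_, fun i => ?_⟩
  · simp [coeff_monomial]
  · ext k
    rw [coeff_map, comp_C_mul_X_coeff]
    rcases k with _ | k
    · simp [coeff_monomial, hc]
    · simp only [coeff_add, coeff_C_succ, zero_add, finsetSum_coeff, coeff_monomial,
        Nat.add_right_cancel_iff, Finset.sum_ite_eq', Finset.mem_range]
      split_ifs with hk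
      · rw [map_mul, map_pow, hh]; ring
      · rw [map_zero, coeff_eq_zero_of_natDegree_lt (by omega), zero_mul]

lemma exists_scaled_eq {ι : Type*} [Finite ι] (p q : ι → H[X])
    (h0 : ∀ i, (p i).coeff 0 = (q i).coeff 0)
    (h : ∀ i, (p i).map (algebraMap H H') = (q i).map (algebraMap H H')) :
    ∃ s ∈ S, ∀ i, (p i).comp (C s * X) = (q i).comp (C s * X) := by
  classical
  cases nonempty_fintype ι
  have h1 : ∀ i k, ∃ s : S, s * (p i).coeff k = s * (q i).coeff k := fun i k =>
    (IsLocalization.eq_iff_exists S H').1 (by rw [← coeff_map, ← coeff_map, h])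
  choose s hs using h1
  let T : ι → Finset ℕ := fun i => (p i).support ∪ (q i).support
  refine ⟨∏ i, ∏ k ∈ T i, s i k, by
    exact Submonoid.prod_mem _ fun i _ => Submonoid.prod_mem _ fun k _ => (s i k).2, fun i => ?_⟩
  ext k
  rw [comp_C_mul_X_coeff, comp_C_mul_X_coeff]
  by_cases hk : k ∈ T i
  · rcases k with _ | k
    · simp [h0]
    have hd : (s i (k + 1) : H) ∣ ∏ i, ∏ k ∈ T i, (s i k : H) :=
      (Finset.dvd_prod_of_mem (fun k => (s i k : H)) hk).trans
        (Finset.dvd_prod_of_mem (fun i => ∏ k ∈ T i, (s i k : H)) (Finset.mem_univ i))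
    obtain ⟨c, hc⟩ := hd
    rw [hc, pow_succ]
    have := hs i (k + 1)
    linear_combination (s i (k + 1) * c) ^ k * c * this
  · simp only [T, Finset.mem_union, not_or, notMem_support_iff] at hk
    rw [hk.1, hk.2]

end Lift

end Patching

section Patching

open Matrix Polynomial

variable {N : Type*} [Fintype N] [DecidableEq N]

/-- The substitution `W ↦ W + b Z` from `G[W]` to `G[W][Z]`. -/
noncomputable def translateHom {G : Type*} [CommRing G] (b : G) : G[X] →+* G[X][X] :=
  eval₂RingHom (C.comp C) (C X + C (C b) * X)

/-- The substitution `Z ↦ s Z`. -/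
noncomputable def scaleHom {H : Type*} [CommRing H] (s : H) : H[X] →+* H[X] :=
  compRingHom (C s * X)

section

variable {G : Type*} [CommRing G]

lemma translateHom_zero : translateHom (0 : G) = C := by
  ext <;> simp [translateHom]

lemma scaleHom_comp_C {H : Type*} [CommRing H] (s : H) : (scaleHom s).comp C = C := by
  ext; simp [scaleHom]

lemma scaleHom_comp_translateHom (b c : G) :
    (scaleHom (C c)).comp (translateHom b) = translateHom (b * c) := by
  ext : 1
  · ext : 1; simp [translateHom, scaleHom]
  · simp [translateHom, scaleHom]; ring

lemma constantCoeff_comp_translateHom (b : G) :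
    constantCoeff.comp (translateHom b) = RingHom.id _ := by
  ext <;> simp [translateHom]

lemma translateHom_add (b c : G) :
    (eval₂RingHom (translateHom c) X).comp (translateHom b) = translateHom (b + c) := by
  ext : 1
  · ext : 1; simp [translateHom]
  · simp [translateHom]; ring

lemma mapRingHom_comp_translateHom {G' : Type*} [CommRing G'] (f : G →+* G') (b : G) :
    (mapRingHom (mapRingHom f)).comp (translateHom b) =
      (translateHom (f b)).comp (mapRingHom f) := by
  ext : 1
  · ext : 1; simp [translateHom]
  · simp [translateHom]

end

/-- Substituting `0` for the variable, viewed as an endomorphism of `G[W]`. -/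
noncomputable def evalZeroHom (G : Type*) [CommRing G] : G[X] →+* G[X] := C.comp (evalRingHom 0)

attribute [local instance] Polynomial.algebra Polynomial.isLocalization in
/-- A relation over the localization, trivial at `Z = 0`, descends after rescaling `Z`. -/
lemma exists_pairRel_of_localization {H H' : Type*} [CommRing H] [CommRing H'] [Algebra H H']
    (S : Submonoid H) [IsLocalization S H'] (x y : Matrix N N H[X] × (N → H[X]))
    (hxy : mapPair constantCoeff x = mapPair constantCoeff y)
    (δ : (Matrix N N H'[X])ˣ)
    (hδ : (δ : Matrix N N H'[X]).map constantCoeff = 1)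
    (h : PairRel δ (mapPair (mapRingHom (algebraMap H H')) x)
      (mapPair (mapRingHom (algebraMap H H')) y)) :
    ∃ s ∈ S, ∃ δ' : (Matrix N N H[X])ˣ, PairRel δ' (mapPair (scaleHom s) x)
      (mapPair (scaleHom s) y) ∧ (δ' : Matrix N N H[X]).map (mapRingHom (algebraMap H H')) =
        (δ : Matrix N N H'[X]).map (scaleHom (algebraMap H H' s)) := by
  have hδ' : ((δ⁻¹ : (Matrix N N H'[X])ˣ) : Matrix N N H'[X]).map constantCoeff = 1 := by
    have : ((δ * δ⁻¹ : (Matrix N N H'[X])ˣ) : Matrix N N H'[X]).map constantCoeff = 1 := by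
      simp
    rw [Units.val_mul, Matrix.map_mul, hδ, one_mul] at this
    exact this
  obtain ⟨s, hs, q, hq0, hq⟩ := exists_lift_scaled (H' := H') S
    (Sum.elim (fun ij : N × N => (δ : Matrix N N H'[X]) ij.1 ij.2)
      (fun ij : N × N => ((δ⁻¹ : (Matrix N N H'[X])ˣ) : Matrix N N H'[X]) ij.1 ij.2))
    (Sum.elim (fun ij => (1 : Matrix N N H) ij.1 ij.2) (fun ij => (1 : Matrix N N H) ij.1 ij.2)) (by
      rintro (⟨i, j⟩ | ⟨i, j⟩)
      · have := congrFun (congrFun hδ i) j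
        simpa [Matrix.one_apply, apply_ite (algebraMap H H')] using this
      · have := congrFun (congrFun hδ' i) j
        simpa [Matrix.one_apply, apply_ite (algebraMap H H')] using this)
  set D : Matrix N N H[X] := Matrix.of fun i j => q (Sum.inl (i, j)) with hD
  set D' : Matrix N N H[X] := Matrix.of fun i j => q (Sum.inr (i, j)) with hD'
  set f := mapRingHom (algebraMap H H') with hf
  have hfs : f.comp (scaleHom s) = (scaleHom (algebraMap H H' s)).comp f := by
    ext <;> simp [f, scaleHom]
  have e1 : D.map f = (δ : Matrix N N H'[X]).map (scaleHom (algebraMap H H' s)) := by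
    ext1 i j; exact hq (Sum.inl (i, j))
  have e2 : D'.map f = ((δ⁻¹ : (Matrix N N H'[X])ˣ) : Matrix N N H'[X]).map
      (scaleHom (algebraMap H H' s)) := by
    ext1 i j; exact hq (Sum.inr (i, j))
  have c1 : D.map constantCoeff = 1 := by ext1 i j; exact hq0 (Sum.inl (i, j))
  have c2 : D'.map constantCoeff = 1 := by ext1 i j; exact hq0 (Sum.inr (i, j))
  have h' := h.map (scaleHom (algebraMap H H' s))
  rw [mapPair_comp, mapPair_comp, ← hfs, ← mapPair_comp, ← mapPair_comp] at h'
  set x' := mapPair (scaleHom s) x with hx'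
  set y' := mapPair (scaleHom s) y with hy'
  have hcs : (constantCoeff : H[X] →+* H).comp (scaleHom s) = constantCoeff := by
    ext <;> simp [scaleHom]
  have hxy' : mapPair constantCoeff x' = mapPair constantCoeff y' := by
    rw [hx', hy', mapPair_comp, mapPair_comp, hcs, hxy]
  obtain ⟨t, ht, hE⟩ := exists_scaled_eq (H' := H') S
    (Sum.elim (fun ij : N × N => (D * D') ij.1 ij.2)
      (Sum.elim (fun ij : N × N => (D' * D) ij.1 ij.2)
        (Sum.elim (fun ij : N × N => (D * x'.1) ij.1 ij.2) (fun i : N => (D *ᵥ x'.2) i))))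
    (Sum.elim (fun ij : N × N => (1 : Matrix N N H[X]) ij.1 ij.2)
      (Sum.elim (fun ij : N × N => (1 : Matrix N N H[X]) ij.1 ij.2)
        (Sum.elim (fun ij : N × N => (y'.1 * D) ij.1 ij.2) (fun i : N => y'.2 i))))
    (by
      have k1 := congrArg Prod.fst hxy'
      have k2 := congrArg Prod.snd hxy'
      simp only [mapPair] at k1 k2
      rintro (⟨i, j⟩ | ⟨i, j⟩ | ⟨i, j⟩ | i)
      · have : (D * D').map constantCoeff = (1 : Matrix N N H[X]).map constantCoeff := by
          rw [Matrix.map_mul, c1, c2]; simp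
        exact congrFun (congrFun this i) j
      · have : (D' * D).map constantCoeff = (1 : Matrix N N H[X]).map constantCoeff := by
          rw [Matrix.map_mul, c1, c2]; simp
        exact congrFun (congrFun this i) j
      · have : (D * x'.1).map constantCoeff = (y'.1 * D).map constantCoeff := by
          rw [Matrix.map_mul, Matrix.map_mul, c1, k1]; simp
        exact congrFun (congrFun this i) j
      · have : constantCoeff ((D *ᵥ x'.2) i) = constantCoeff (y'.2 i) := by
          rw [RingHom.map_mulVec, c1, k2, one_mulVec]; rfl
        exact this)
    (by
      rintro (⟨i, j⟩ | ⟨i, j⟩ | ⟨i, j⟩ | i)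
      · have : (D * D').map f = (1 : Matrix N N H[X]).map f := by
          rw [Matrix.map_mul, e1, e2, ← Matrix.map_mul, ← Units.val_mul, mul_inv_cancel]; simp
        exact congrFun (congrFun this i) j
      · have : (D' * D).map f = (1 : Matrix N N H[X]).map f := by
          rw [Matrix.map_mul, e1, e2, ← Matrix.map_mul, ← Units.val_mul, inv_mul_cancel]; simp
        exact congrFun (congrFun this i) j
      · have : (D * x'.1).map f = (y'.1 * D).map f := by
          rw [Matrix.map_mul, Matrix.map_mul, e1]; exact h'.1
        exact congrFun (congrFun this i) j
      · have : f ((D *ᵥ x'.2) i) = f (y'.2 i) := by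
          rw [RingHom.map_mulVec, e1]; exact congrFun h'.2 i
        exact this)
  have E1 : D.map (scaleHom t) * D'.map (scaleHom t) = 1 := by
    rw [← Matrix.map_mul]; ext1 i j
    have := hE (Sum.inl (i, j))
    simp only [Sum.elim_inl] at this
    rw [Matrix.map_apply]; refine this.trans ?_
    by_cases hij : i = j <;> simp [hij, Matrix.one_apply]
  have E2 : D'.map (scaleHom t) * D.map (scaleHom t) = 1 := by
    rw [← Matrix.map_mul]; ext1 i j
    have := hE (Sum.inr (Sum.inl (i, j)))
    simp only [Sum.elim_inl, Sum.elim_inr] at this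
    rw [Matrix.map_apply]; refine this.trans ?_
    by_cases hij : i = j <;> simp [hij, Matrix.one_apply]
  have hst : (scaleHom t).comp (scaleHom s) = scaleHom (s * t) := by
    ext <;> simp [scaleHom, mul_assoc]
  refine ⟨s * t, mul_mem hs ht, ⟨_, _, E1, E2⟩, ⟨?_, ?_⟩, ?_⟩
  · rw [← hst, ← mapPair_comp, ← mapPair_comp]
    change D.map (scaleHom t) * (x'.1).map (scaleHom t) = (y'.1).map (scaleHom t) * D.map (scaleHom t)
    rw [← Matrix.map_mul, ← Matrix.map_mul]; ext1 i j
    exact hE (Sum.inr (Sum.inr (Sum.inl (i, j))))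
  · rw [← hst, ← mapPair_comp, ← mapPair_comp]
    ext1 i
    change (D.map (scaleHom t) *ᵥ (scaleHom t ∘ x'.2)) i = scaleHom t (y'.2 i)
    rw [← RingHom.map_mulVec]
    exact hE (Sum.inr (Sum.inr (Sum.inr i)))
  · have h3 : f.comp (scaleHom t) = (scaleHom (algebraMap H H' t)).comp f := by
      ext <;> simp [f, scaleHom]
    have h4 : (scaleHom (algebraMap H H' t)).comp (scaleHom (algebraMap H H' s)) =
        scaleHom (algebraMap H H' (s * t)) := by
      ext <;> simp [scaleHom, mul_assoc]
    ext1 i j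
    rw [← h4]
    refine (congrArg (fun g : H[X] →+* H'[X] => g (D i j)) h3).trans ?_
    exact congrArg (scaleHom (algebraMap H H' t)) (congrFun (congrFun e1 i) j)

attribute [local instance] Polynomial.algebra Polynomial.isLocalization in
/-- Quillen patching for pairs (matrix, vector) over a polynomial ring. -/
theorem exists_pairRel_of_forall_maximal {G : Type*} [CommRing G]
    (x : Matrix N N G[X] × (N → G[X]))
    (h : ∀ (𝔪 : Ideal G) [𝔪.IsMaximal], ∃ γ : (Matrix N N (Localization.AtPrime 𝔪)[X])ˣ,
      PairRel γ (mapPair (mapRingHom (algebraMap G (Localization.AtPrime 𝔪)))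
        (mapPair (evalZeroHom G) x))
        (mapPair (mapRingHom (algebraMap G (Localization.AtPrime 𝔪))) x)) :
    ∃ γ : (Matrix N N G[X])ˣ, PairRel γ (mapPair (evalZeroHom G) x) x := by
  let I : Ideal G :=
    { carrier := {b | ∃ δ, PairRel δ (mapPair C x) (mapPair (translateHom b) x)}
      zero_mem' := ⟨1, by simp [PairRel, translateHom_zero]⟩
      add_mem' := by
        rintro b c ⟨δ, hδ⟩ ⟨δ', hδ'⟩
        have := hδ.map (eval₂RingHom (translateHom c) X)
        rw [mapPair_comp, mapPair_comp, translateHom_add] at this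
        have hC : (eval₂RingHom (translateHom c) X).comp C = translateHom c := by
          ext <;> simp
        rw [hC] at this
        exact ⟨_, hδ'.trans this⟩
      smul_mem' := by
        rintro c b ⟨δ, hδ⟩
        have := hδ.map (scaleHom (C c))
        rw [mapPair_comp, mapPair_comp, scaleHom_comp_translateHom, scaleHom_comp_C,
          mul_comm] at this
        exact ⟨_, this⟩ }
  suffices hI : I = ⊤ by
    obtain ⟨δ, hδ⟩ : (1 : G) ∈ I := hI ▸ Submodule.mem_top
    have := hδ.map (eval₂RingHom (evalZeroHom G) X)
    rw [mapPair_comp, mapPair_comp] at this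
    have h1 : (eval₂RingHom (evalZeroHom G) X).comp C = evalZeroHom G := by
      ext <;> simp
    have h2 : (eval₂RingHom (evalZeroHom G) X).comp (translateHom 1) = RingHom.id _ := by
      ext <;> simp [translateHom, evalZeroHom]
    rw [h1, h2] at this
    exact ⟨_, this⟩
  by_contra hI
  obtain ⟨𝔪, h𝔪, hle⟩ := Ideal.exists_le_maximal I hI
  obtain ⟨γ, hγ⟩ := h 𝔪
  set L := Localization.AtPrime 𝔪
  set f := mapRingHom (algebraMap G L) with hf
  have a1 := (hγ.map C).symm
  have a2 := hγ.map (translateHom (1 : L))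
  have hz : (translateHom (1 : L)).comp (f.comp (evalZeroHom G)) =
      C.comp (f.comp (evalZeroHom G)) := by
    ext <;> simp [translateHom, evalZeroHom, f]
  rw [mapPair_comp _ f, mapPair_comp, hz, ← mapPair_comp] at a2
  rw [mapPair_comp _ f] at a1
  have a3 := a1.trans a2
  have hfC : (C : L[X] →+* L[X][X]).comp f = (mapRingHom f).comp C := by
    ext <;> simp
  have hfT : (translateHom (1 : L)).comp f = (mapRingHom f).comp (translateHom 1) := by
    rw [mapRingHom_comp_translateHom, map_one]
  rw [mapPair_comp, mapPair_comp, hfT, hfC, ← mapPair_comp, ← mapPair_comp] at a3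
  obtain ⟨s, hs, δ, hδ, -⟩ := exists_pairRel_of_localization (H := G[X]) (H' := L[X])
    (𝔪.primeCompl.map C) (mapPair C x) (mapPair (translateHom 1) x) (by
      rw [mapPair_comp, mapPair_comp, constantCoeff_comp_translateHom]
      congr 1; ext <;> simp) _ (by
      rw [Units.val_mul, Matrix.map_mul]
      have : ∀ g : Matrix N N L[X], (g.map (translateHom (1 : L))).map constantCoeff = g := by
        intro g; ext1 i j
        exact congrArg (fun f : L[X] →+* L[X] => f (g i j)) (constantCoeff_comp_translateHom (1 : L))
      have h2 : ∀ g : Matrix N N L[X], (g.map (C : L[X] →+* L[X][X])).map constantCoeff = g := by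
        intro g; ext1 i j; simp
      rw [← map_inv]
      change ((γ : Matrix N N L[X]).map (translateHom (1 : L))).map constantCoeff *
        (((γ⁻¹ : (Matrix N N L[X])ˣ) : Matrix N N L[X]).map
          (C : L[X] →+* L[X][X])).map constantCoeff = 1
      rw [this, h2, Units.mul_inv]) a3
  obtain ⟨s, hs', rfl⟩ := Submonoid.mem_map.1 hs
  rw [mapPair_comp, mapPair_comp] at hδ
  erw [scaleHom_comp_C, scaleHom_comp_translateHom, one_mul] at hδ
  exact hs' (hle ⟨δ, hδ⟩)

end Patching

section Horrocks

open Matrix Polynomial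

/-- Two columns in the same orbit of the general linear group. -/
def GLEquiv {R ι : Type*} [CommRing R] [Fintype ι] [DecidableEq ι] (y z : ι → R) : Prop :=
  ∃ γ : (Matrix ι ι R)ˣ, (γ : Matrix ι ι R) *ᵥ y = z

/-- A column whose entries generate the unit ideal. -/
def Unimod {R ι : Type*} [CommRing R] [Fintype ι] (y : ι → R) : Prop := ∃ r, r ⬝ᵥ y = 1

section

variable {R ι : Type*} [CommRing R] [Fintype ι] [DecidableEq ι]

lemma GLEquiv.trans {x y z : ι → R} (h : GLEquiv x y) (h' : GLEquiv y z) : GLEquiv x z := by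
  obtain ⟨γ, rfl⟩ := h
  obtain ⟨δ, rfl⟩ := h'
  exact ⟨δ * γ, by rw [Units.val_mul, mulVec_mulVec]⟩

lemma GLEquiv.unimod {y z : ι → R} (h : GLEquiv y z) (hy : Unimod y) : Unimod z := by
  obtain ⟨γ, rfl⟩ := h
  obtain ⟨r, hr⟩ := hy
  refine ⟨r ᵥ* ((γ⁻¹ : (Matrix ι ι R)ˣ) : Matrix ι ι R), ?_⟩
  rw [← dotProduct_mulVec, mulVec_mulVec, Units.inv_mul, one_mulVec, hr]

lemma vecMulVec_mulVec' {ι : Type*} [Fintype ι] (u v w : ι → R) : vecMulVec u v *ᵥ w = (v ⬝ᵥ w) • u := by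
  rw [Matrix.vecMulVec_mulVec]; ext; simp [mul_comm]

/-- A matrix `1 + u vᵀ` with `v ⬝ u = 0`, as a unit. -/
def transvectionUnit (u v : ι → R) (h : v ⬝ᵥ u = 0) : (Matrix ι ι R)ˣ where
  val := 1 + vecMulVec u v
  inv := 1 - vecMulVec u v
  val_inv := by
    have : vecMulVec u v * vecMulVec u v = 0 := by
      rw [vecMulVec_mul_vecMulVec, h]; ext; simp [vecMulVec]
    rw [mul_sub, add_mul, add_mul, this]; simp
  inv_val := by
    have : vecMulVec u v * vecMulVec u v = 0 := by
      rw [vecMulVec_mul_vecMulVec, h]; ext; simp [vecMulVec]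
    rw [sub_mul, mul_add, mul_add, this]; simp

lemma GLEquiv.add_smul (y u : ι → R) (i : ι) (hu : u i = 0) : GLEquiv y (y + y i • u) := by
  refine ⟨transvectionUnit u (Pi.single i 1) (by simp [hu]), ?_⟩
  change (1 + vecMulVec u _) *ᵥ y = _
  rw [add_mulVec, one_mulVec, vecMulVec_mulVec']
  simp

lemma GLEquiv.add_smul_single (y : ι → R) {i j : ι} (hij : i ≠ j) (a : R) :
    GLEquiv y (Function.update y j (y j + a * y i)) := by
  have := GLEquiv.add_smul y (Pi.single j a) i (by simp [hij])
  convert this using 1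
  ext k
  by_cases hk : k = j
  · subst hk; simp [mul_comm]
  · simp [hk]

lemma GLEquiv.of_eq_one (y : ι → R) (i : ι) (h : y i = 1) : GLEquiv y (Pi.single i 1) := by
  have := GLEquiv.add_smul y (fun j => if j = i then 0 else - y j) i (by simp)
  convert this using 1
  ext k
  by_cases hk : k = i
  · subst hk; simp [h]
  · simp [hk, h]

lemma GLEquiv.fin_two (y : Fin 2 → R) (hy : Unimod y) : GLEquiv y (Pi.single 0 1) := by
  obtain ⟨r, hr⟩ := hy
  rw [dotProduct, Fin.sum_univ_two] at hr
  refine ⟨⟨!![r 0, r 1; -y 1, y 0], !![y 0, - r 1; y 1, r 0], ?_, ?_⟩, ?_⟩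
  · ext i j; fin_cases i <;> fin_cases j <;> simp [Matrix.mul_apply, mul_comm] <;> linear_combination hr
  · ext i j; fin_cases i <;> fin_cases j <;> simp [Matrix.mul_apply, mul_comm] <;> linear_combination hr
  · ext i; fin_cases i
    · simpa [mulVec, dotProduct] using hr
    · simp [mulVec, dotProduct]; ring

end

variable {G : Type*} [CommRing G]

lemma exists_coeff_pred_eq {d : ℕ} {f : G[X]} (hf : f.Monic) (hd : f.natDegree = d + 1)
    (I : Ideal G[X]) (hfI : f ∈ I) (j : ℕ) : ∀ k, k + j = d → ∀ g ∈ I, g.natDegree ≤ d →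
      ∃ g' ∈ I, g'.natDegree ≤ d ∧ g'.coeff d = g.coeff k := by
  induction j with
  | zero => rintro k rfl g hg hgd; exact ⟨g, hg, hgd, rfl⟩
  | succ j ih =>
    intro k hk g hg hgd
    obtain ⟨g', h1, h2, h3⟩ := ih (k + 1) (by omega) (X * g - C (g.coeff d) * f)
      (I.sub_mem (I.mul_mem_left _ hg) (I.mul_mem_left _ hfI)) (by
        rw [natDegree_le_iff_coeff_eq_zero]
        intro m hm
        rcases m with _ | m
        · omega
        rw [coeff_sub, coeff_X_mul, coeff_C_mul]
        rcases (show d ≤ m by omega).eq_or_lt with rfl | h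
        · have : f.coeff (d + 1) = 1 := by rw [← hd]; exact hf
          rw [this, mul_one, sub_self]
        · rw [coeff_eq_zero_of_natDegree_lt (show g.natDegree < m by omega),
            coeff_eq_zero_of_natDegree_lt (show f.natDegree < m + 1 by omega)]
          simp)
    refine ⟨g' + C (f.coeff (k + 1)) * g, I.add_mem h1 (I.mul_mem_left _ hg), ?_, ?_⟩
    · exact (natDegree_add_le _ _).trans (max_le h2 ((natDegree_C_mul_le _ _).trans hgd))
    · rw [coeff_add, h3, coeff_sub, coeff_X_mul, coeff_C_mul, coeff_C_mul]; ring

/-- Horrocks' theorem for unimodular columns over a local ring. -/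
theorem horrocks_local [IsLocalRing G] {n : ℕ} (hn : 2 ≤ n) (d : ℕ) : ∀ (y : Fin n → G[X]) (i₀ : Fin n),
    (y i₀).Monic → (y i₀).natDegree ≤ d → Unimod y → ∃ i, GLEquiv y (Pi.single i 1) := by
  rcases hn.eq_or_lt with rfl | hn
  · intro y _ _ _ hy
    exact ⟨0, GLEquiv.fin_two y hy⟩
  induction d with
  | zero =>
    intro y i₀ hm hd _
    exact ⟨i₀, GLEquiv.of_eq_one y i₀ (hm.natDegree_eq_zero.1 (by omega))⟩
  | succ d ih =>
    intro y i₀ hm hd hy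
    rcases hd.lt_or_eq with hd | hd
    · exact ih y i₀ hm (by omega) hy
    have E1 := GLEquiv.add_smul y (fun j => if j = i₀ then 0 else - (y j /ₘ y i₀)) i₀ (by simp)
    set z := y + y i₀ • (fun j => if j = i₀ then 0 else - (y j /ₘ y i₀)) with hz
    have hz0 : z i₀ = y i₀ := by simp [hz]
    have hzj : ∀ j, j ≠ i₀ → (z j).natDegree ≤ d := by
      intro j hj
      have : z j = y j %ₘ y i₀ := by
        rw [modByMonic_eq_sub_mul_div]; simp [hz, hj, sub_eq_add_neg]
      rw [this]
      have := natDegree_modByMonic_lt (y j) hm (by intro h; rw [h] at hd; simp at hd)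
      omega
    have hzu := E1.unimod hy
    rw [← hz0] at hm hd
    obtain ⟨i₁, hi₁, k, hk⟩ : ∃ i, i ≠ i₀ ∧ ∃ k, IsUnit ((z i).coeff k) := by
      by_contra! hcon
      obtain ⟨r, hr⟩ := hzu
      have h2 := congrArg (mapRingHom (IsLocalRing.residue G)) hr
      rw [dotProduct, map_sum, Finset.sum_eq_single i₀, map_mul, map_one] at h2
      · have h3 : IsUnit (mapRingHom (IsLocalRing.residue G) (z i₀)) := IsUnit.of_mul_eq_one_right _ h2
        have h4 := (hm.map (IsLocalRing.residue G)).isUnit_iff.1 h3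
        have h5 := hm.natDegree_map (IsLocalRing.residue G)
        rw [h4] at h5; simp at h5; omega
      · intro j _ hj
        have : mapRingHom (IsLocalRing.residue G) (z j) = 0 := by
          ext k
          have := hcon j hj k
          simpa [IsLocalRing.residue_eq_zero_iff] using this
        rw [map_mul, this, mul_zero]
      · simp
    have hkd : k ≤ d := by
      by_contra hlt
      have := hzj i₁ hi₁
      rw [coeff_eq_zero_of_natDegree_lt (by omega)] at hk
      exact not_isUnit_zero hk
    obtain ⟨i₂, hi₂⟩ : ∃ i₂, i₂ ∉ ({i₀, i₁} : Finset (Fin n)) := by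
      by_contra! hcon
      have h1 := Finset.card_le_card (fun i _ => hcon i : Finset.univ ⊆ {i₀, i₁})
      have h2 := Finset.card_le_two (a := i₀) (b := i₁)
      simp at h1; omega
    simp only [Finset.mem_insert, Finset.mem_singleton, not_or] at hi₂
    obtain ⟨g, hg, hgd, hgk⟩ := exists_coeff_pred_eq hm hd (Ideal.span {z i₀, z i₁})
      (Ideal.subset_span (by simp)) (d - k) k (by omega) (z i₁) (Ideal.subset_span (by simp))
      (hzj i₁ hi₁)
    obtain ⟨u, hu⟩ := hk.exists_left_inv
    obtain ⟨a, b, hab⟩ := Ideal.mem_span_pair.1 hg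
    set t : G[X] := C ((1 - (z i₂).coeff d) * u) with ht
    have E2 := GLEquiv.add_smul_single z (Ne.symm hi₂.1) (t * a)
    set w := Function.update z i₂ (z i₂ + t * a * z i₀) with hw
    have E3 := GLEquiv.add_smul_single w (Ne.symm hi₂.2) (t * b)
    set v := Function.update w i₂ (w i₂ + t * b * w i₁) with hv
    have hv2 : v i₂ = z i₂ + t * g := by
      simp only [hv, hw, Function.update_self, Function.update_of_ne (Ne.symm hi₂.2), ← hab]; ring
    have hvd : (v i₂).natDegree ≤ d := by
      rw [hv2]
      exact (natDegree_add_le _ _).trans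
        (max_le (hzj _ hi₂.1) ((natDegree_C_mul_le _ _).trans hgd))
    have hvm : (v i₂).Monic := by
      refine monic_of_natDegree_le_of_coeff_eq_one d hvd ?_
      rw [hv2, coeff_add, ht, coeff_C_mul, hgk]
      linear_combination (1 - (z i₂).coeff d) * hu
    have E := (E1.trans E2).trans E3
    obtain ⟨i, hi⟩ := ih v i₂ hvm hvd (E.unimod hy)
    exact ⟨i, E.trans hi⟩

end Horrocks

section LocalRank

open Matrix Polynomial

variable {R : Type*} [CommRing R]

/-- An idempotent matrix whose image is free of finite rank factors. -/
lemma exists_factor_of_free [Nontrivial R] {m : Type*} [Fintype m] [DecidableEq m] (e : Matrix m m R)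
    (he : e * e = e)
    [Module.Free R (LinearMap.range e.mulVecLin)] :
    ∃ (r : ℕ) (X : Matrix m (Fin r) R) (Y : Matrix (Fin r) m R), X * Y = e ∧ Y * X = 1 := by
  have : Module.Finite R (LinearMap.range e.mulVecLin) :=
    Module.Finite.range _
  let M := LinearMap.range e.mulVecLin
  let b := Module.finBasis R M
  have hM : ∀ x : M, e *ᵥ (x : m → R) = x := by
    rintro ⟨_, v, rfl⟩
    simp [he]
  let X : Matrix m (Fin (Module.finrank R M)) R := Matrix.of fun i j => (b j : m → R) i
  let Y : Matrix (Fin (Module.finrank R M)) m R :=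
    LinearMap.toMatrix' (b.equivFun.toLinearMap ∘ₗ e.mulVecLin.rangeRestrict)
  have hX : ∀ c, X *ᵥ c = ((b.equivFun.symm c : M) : m → R) := by
    intro c
    ext i
    simp [X, mulVec, dotProduct, Module.Basis.equivFun_symm_apply, mul_comm, Finset.sum_apply]
  have hY : ∀ v, Y *ᵥ v = b.equivFun (e.mulVecLin.rangeRestrict v) := by
    intro v
    simp [Y, LinearMap.toMatrix'_mulVec]
  refine ⟨_, X, Y, ?_, ?_⟩
  · refine Matrix.ext_iff_mulVec.2 fun v => ?_ 
    rw [← mulVec_mulVec, hY, hX, LinearEquiv.symm_apply_apply]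
    simp
  · refine Matrix.ext_iff_mulVec.2 fun v => ?_ 
    rw [← mulVec_mulVec, hX, hY, one_mulVec]
    have : e.mulVecLin.rangeRestrict (b.equivFun.symm v : M) = b.equivFun.symm v := by
      ext1; exact hM _
    rw [this, LinearEquiv.apply_symm_apply]

lemma projective_range {m : Type*} [Fintype m] [DecidableEq m] (e : Matrix m m R)
    (he : e * e = e) : Module.Projective R (LinearMap.range e.mulVecLin) := by
  refine Module.Projective.of_split (Submodule.subtype _) e.mulVecLin.rangeRestrict ?_
  ext1 ⟨_, v, rfl⟩
  ext1
  simp [he]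

lemma exists_factor_of_isLocalRing [IsLocalRing R] {m : Type*} [Fintype m] [DecidableEq m]
    (e : Matrix m m R) (he : e * e = e) :
    ∃ (r : ℕ) (X : Matrix m (Fin r) R) (Y : Matrix (Fin r) m R), X * Y = e ∧ Y * X = 1 := by
  have := projective_range e he
  have : Module.Finite R (LinearMap.range e.mulVecLin) :=
    Module.Finite.range _
  have : Module.Free R (LinearMap.range e.mulVecLin) := Module.free_of_flat_of_isLocalRing
  exact exists_factor_of_free e he

lemma rank_eq_of_factor {K : Type*} [Field K] {m : Type*} [Fintype m] [DecidableEq m] {r : ℕ}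
    {e : Matrix m m K} {X : Matrix m (Fin r) K} {Y : Matrix (Fin r) m K} (h1 : X * Y = e)
    (h2 : Y * X = 1) : e.rank = r := by
  refine le_antisymm ?_ ?_
  · rw [← h1]
    exact (rank_mul_le_left _ _).trans ((rank_le_card_width _).trans (by simp))
  · rw [lt_rank_iff]
    refine ⟨Y, X, ?_⟩
    rw [← h1, Matrix.mul_assoc, Matrix.mul_assoc, h2, Matrix.mul_one, h2]

lemma rkAt_eq_of_factor (p : PrimeSpectrum R) {m : Type*} [Fintype m] [DecidableEq m] {r : ℕ}
    {e : Matrix m m R} {X : Matrix m (Fin r) R} {Y : Matrix (Fin r) m R} (h1 : X * Y = e)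
    (h2 : Y * X = 1) : rkAt p e = r := by
  refine rank_eq_of_factor (X := X.map (algebraMap R p.asIdeal.ResidueField))
    (Y := Y.map (algebraMap R p.asIdeal.ResidueField)) ?_ ?_
  · rw [← Matrix.map_mul, h1]
  · rw [← Matrix.map_mul, h2]; simp

lemma rkAt_map {S : Type*} [CommRing S] (f : R →+* S) (q : PrimeSpectrum S) {m : Type*} [Fintype m]
    [DecidableEq m] (e : Matrix m m R) (he : e * e = e) :
    rkAt q (e.map f) = rkAt (PrimeSpectrum.comap f q) e := by
  obtain ⟨r, X, Y, h1, h2⟩ := exists_factor_of_isLocalRing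
    (e.map (algebraMap R (PrimeSpectrum.comap f q).asIdeal.ResidueField))
    (by rw [← Matrix.map_mul, he])
  let g := Ideal.ResidueField.map (PrimeSpectrum.comap f q).asIdeal q.asIdeal f rfl
  unfold rkAt
  rw [rank_eq_of_factor h1 h2]
  refine rank_eq_of_factor (X := X.map g) (Y := Y.map g) ?_ ?_
  · rw [← Matrix.map_mul, h1]
    ext i j
    exact Ideal.ResidueField.map_algebraMap _ _ _ _ _
  · rw [← Matrix.map_mul, h2]; exact Matrix.map_one _ (map_zero _) (map_one _)

/-- The automorphism of `R^m` induced by an automorphism of the free image of an idempotent. -/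
def conjUnit {m l : Type*} [Fintype m] [DecidableEq m] [Fintype l] [DecidableEq l]
    {e : Matrix m m R} {X : Matrix m l R} {Y : Matrix l m R} (h1 : X * Y = e)
    (h2 : Y * X = 1) (δ : (Matrix l l R)ˣ) : (Matrix m m R)ˣ :=
  have key (a b : Matrix l l R) (h : a * b = 1) :
      (X * a * Y + (1 - e)) * (X * b * Y + (1 - e)) = 1 := by
    have h3 : Y * e = Y := by rw [← h1, ← Matrix.mul_assoc, h2, Matrix.one_mul]
    have h4 : e * X = X := by rw [← h1, Matrix.mul_assoc, h2, Matrix.mul_one]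
    have h5 : e * e = e := by
      conv_lhs => rw [← h1, ← Matrix.mul_assoc, h1, h4]
      exact h1
    have h6 : X * a * Y * (X * b * Y) = e := by
      rw [← h1]
      calc X * a * Y * (X * b * Y) = X * a * (Y * X) * (b * Y) := by simp only [Matrix.mul_assoc]
        _ = X * (a * b) * Y := by rw [h2, Matrix.mul_one]; simp only [Matrix.mul_assoc]
        _ = _ := by rw [h, Matrix.mul_one]
    have h7 : X * a * Y * (1 - e) = 0 := by
      rw [Matrix.mul_assoc, Matrix.mul_sub, Matrix.mul_one, h3, sub_self, Matrix.mul_zero]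
    have h8 : (1 - e) * (X * b * Y) = 0 := by
      rw [Matrix.mul_assoc, ← Matrix.mul_assoc, Matrix.sub_mul, Matrix.one_mul, h4, sub_self,
        Matrix.zero_mul]
    rw [mul_add, add_mul, add_mul, h6, h7, h8, sub_mul, one_mul, mul_sub, mul_one, h5]
    abel
  ⟨X * δ.1 * Y + (1 - e), X * δ.2 * Y + (1 - e), key _ _ δ.3, key _ _ δ.4⟩

lemma monic_mem_imp_exists_unit [IsLocalRing R] {r : ℕ} (w : Fin r → R) (z : Fin r → R[X])
    (h : ((C ∘ w) ⬝ᵥ z).Monic) : ∃ i, IsUnit (w i) := by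
  by_contra! hcon
  have h1 : ((C ∘ w) ⬝ᵥ z).coeff ((C ∘ w) ⬝ᵥ z).natDegree = 1 := h
  rw [dotProduct, finsetSum_coeff] at h1
  simp only [Function.comp_apply, coeff_C_mul] at h1
  have : (1 : R) ∈ IsLocalRing.maximalIdeal R := by
    conv => rhs; rw [← h1]
    exact Ideal.sum_mem _ fun i _ => Ideal.mul_mem_right _ _ (hcon i)
  exact this isUnit_one

/-- The identity matrix with row `i` replaced by `w`, as a unit. -/
lemma glEquiv_update {ι : Type*} [Fintype ι] [DecidableEq ι] (w z : ι → R) (i : ι)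
    (h : IsUnit (w i)) : GLEquiv z (Function.update z i (w ⬝ᵥ z)) := by
  obtain ⟨u, hu⟩ := h
  set s : ι → R := Pi.single i 1
  set M := vecMulVec s (w - s) with hM
  have hst : M * M = (w i - 1) • M := by
    rw [hM, vecMulVec_mul_vecMulVec]; ext; simp [vecMulVec, s]; ring
  have hu1 : M + (w i - 1) • M = (u : R) • M := by rw [hu]; module
  have hu2 : (↑u⁻¹ : R) • (u : R) • M = M := by rw [smul_smul, Units.inv_mul, one_smul]
  refine ⟨⟨1 + M, 1 - (↑u⁻¹ : R) • M, ?_, ?_⟩, ?_⟩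
  · rw [mul_sub, mul_one, mul_smul_comm, add_mul, hst, one_mul, hu1, hu2, add_sub_cancel_right]
  · rw [sub_mul, one_mul, smul_mul_assoc, mul_add, hst, mul_one, hu1, hu2, add_sub_cancel_right]
  · change (1 + M) *ᵥ z = _
    rw [hM, add_mulVec, one_mulVec, vecMulVec_mulVec']
    ext j
    by_cases hj : j = i
    · subst hj; simp [s, sub_dotProduct]
    · simp [s, hj]

/-- Horrocks' theorem, globalized: a unimodular element of an extended projective module of rank
at least two, one of whose extended functionals is monic, is equivalent to its value at `0`. -/
theorem exists_pairRel_of_monic {m : ℕ} (e : Matrix (Fin m) (Fin m) R) (he : e * e = e)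
    (hrk : ∀ p, 2 ≤ rkAt p e) (y : Fin m → R[X]) (hy : e.map C *ᵥ y = y) (hu : Unimod y)
    (ψ : Fin m → R) (hψ : ((C ∘ ψ) ⬝ᵥ y).Monic) :
    ∃ γ : (Matrix (Fin m) (Fin m) R[X])ˣ,
      PairRel γ (mapPair (evalZeroHom R) (e.map C, y)) (e.map C, y) := by
  refine exists_pairRel_of_forall_maximal _ fun 𝔪 _ => ?_
  set L := Localization.AtPrime 𝔪
  set f := mapRingHom (algebraMap R L) with hf
  obtain ⟨r, X, Y, h1, h2⟩ := exists_factor_of_isLocalRing (e.map (algebraMap R L))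
    (by rw [← Matrix.map_mul, he])
  have hr : 2 ≤ r := by
    rw [← rkAt_eq_of_factor (IsLocalRing.closedPoint L) h1 h2, rkAt_map _ _ _ he]
    exact hrk _
  set X' := X.map (C : L →+* L[X])
  set Y' := Y.map (C : L →+* L[X])
  have hC : f.comp C = C.comp (algebraMap R L) := by ext; simp [f]
  have heC : (e.map C).map f = (e.map (algebraMap R L)).map C := by
    ext1 i j; exact congrArg (fun g : R →+* L[X] => g (e i j)) hC
  have h1' : X' * Y' = (e.map C).map f := by
    rw [heC, ← h1, Matrix.map_mul]
  have h2' : Y' * X' = 1 := by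
    rw [← Matrix.map_mul, h2]; exact Matrix.map_one _ (map_zero _) (map_one _)
  set yL : Fin m → L[X] := f ∘ y with hyL
  have hyL' : (e.map C).map f *ᵥ yL = yL := by
    rw [hyL]; ext1 i; rw [← RingHom.map_mulVec, hy]; rfl
  set z := Y' *ᵥ yL with hz
  have hXz : X' *ᵥ z = yL := by rw [hz, mulVec_mulVec, h1', hyL']
  have hzu : Unimod z := by
    obtain ⟨ρ, hρ⟩ := hu
    refine ⟨(f ∘ ρ) ᵥ* X', ?_⟩
    rw [← dotProduct_mulVec, hXz]
    have := congrArg f hρ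
    rwa [RingHom.map_dotProduct, map_one] at this
  set w : Fin r → L := (algebraMap R L ∘ ψ) ᵥ* X with hw
  have hwC : (C ∘ w : Fin r → L[X]) = (f ∘ C ∘ ψ) ᵥ* X' := by
    ext1 i
    rw [Function.comp_apply, hw, RingHom.map_vecMul]
    rw [show ⇑f ∘ ⇑C ∘ ψ = C ∘ algebraMap R L ∘ ψ from
      congrArg (fun g : R →+* L[X] => g ∘ ψ) hC]
  have hwz : (C ∘ w) ⬝ᵥ z = f ((C ∘ ψ) ⬝ᵥ y) := by
    rw [hwC, ← dotProduct_mulVec, hXz, RingHom.map_dotProduct]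
  have hmon : ((C ∘ w) ⬝ᵥ z).Monic := by
    rw [hwz]; exact hψ.map _
  obtain ⟨i, hi⟩ := monic_mem_imp_exists_unit w z hmon
  have E := glEquiv_update (C ∘ w) z i (hi.map C)
  obtain ⟨i', E'⟩ := horrocks_local hr _ _ i
    (by rw [Function.update_self]; exact hmon) le_rfl (E.unimod hzu)
  obtain ⟨γ, hγ⟩ := E.trans E'
  let γ0 := Units.map ((evalZeroHom L).mapMatrix : Matrix (Fin r) (Fin r) L[X] →+* _).toMonoidHom γ
  have hγ0 : (γ0 : Matrix (Fin r) (Fin r) L[X]) *ᵥ (evalZeroHom L ∘ z) = Pi.single i' 1 := by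
    have := congrArg (fun v : Fin r → L[X] => evalZeroHom L ∘ v) hγ
    ext1 j
    have hj := congrFun this j
    rw [Function.comp_apply, RingHom.map_mulVec] at hj
    refine hj.trans ?_
    by_cases h : j = i' 
    · subst h; simp
    · simp [h]
  have hδ : ((γ⁻¹ * γ0 : (Matrix (Fin r) (Fin r) L[X])ˣ) : Matrix (Fin r) (Fin r) L[X]) *ᵥ
      (evalZeroHom L ∘ z) = z := by
    rw [Units.val_mul, ← mulVec_mulVec, hγ0, ← hγ, mulVec_mulVec, Units.inv_mul, one_mulVec]
  have h0 : (evalZeroHom L).comp C = C := by ext; simp [evalZeroHom]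
  have hf0 : f.comp (evalZeroHom R) = (evalZeroHom L).comp f := by
    ext <;> simp [evalZeroHom, f]
  have hY0 : Y'.map (evalZeroHom L) = Y' := by
    ext1 i j; exact congrArg (fun g : L →+* L[X] => g (Y i j)) h0
  have he0 : mapPair f (mapPair (evalZeroHom R) (e.map C, y)) =
      ((e.map C).map f, evalZeroHom L ∘ yL) := by
    rw [mapPair_comp, hf0]
    refine Prod.ext ?_ rfl
    change (e.map C).map ((evalZeroHom L).comp f) = _
    rw [← hf0]
    ext1 i j
    simp [evalZeroHom]
  have h3 : Y' * (e.map C).map f = Y' := by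
    rw [← h1', ← Matrix.mul_assoc, h2', Matrix.one_mul]
  have h4 : (e.map C).map f * X' = X' := by
    rw [← h1', Matrix.mul_assoc, h2', Matrix.mul_one]
  refine ⟨conjUnit h1' h2' (γ⁻¹ * γ0), ?_⟩
  rw [he0]
  set E := (e.map C).map f with hE
  have h5 : E * E = E := by
    conv_lhs => rw [← h1', ← Matrix.mul_assoc, h1', h4]
    exact h1'
  have hz0 : evalZeroHom L ∘ z = Y' *ᵥ (evalZeroHom L ∘ yL) := by
    ext1 j; rw [hz, Function.comp_apply, RingHom.map_mulVec, hY0]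
  constructor
  · change (X' * _ * Y' + (1 - E)) * E = E * (X' * _ * Y' + (1 - E))
    rw [add_mul, mul_add, sub_mul, mul_sub, h5, Matrix.mul_assoc, h3, ← Matrix.mul_assoc E,
      ← Matrix.mul_assoc E, h4, one_mul, mul_one]
  · change (X' * _ * Y' + (1 - E)) *ᵥ (evalZeroHom L ∘ yL) = yL
    have h6 : E *ᵥ (evalZeroHom L ∘ yL) = evalZeroHom L ∘ yL := by
      have : E.map (evalZeroHom L) = E := by
        rw [heC]; ext1 i j
        exact congrArg (fun g : L →+* L[X] => g (algebraMap R L (e i j))) h0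
      ext1 j
      conv_lhs => rw [← this]
      rw [← RingHom.map_mulVec, hyL']; rfl
    rw [add_mulVec, sub_mulVec, h6, one_mulVec, sub_self, add_zero, ← mulVec_mulVec,
      ← mulVec_mulVec, ← hz0, hδ, hXz]

end LocalRank

section Gluing

open Matrix Polynomial

section Abstract

variable {R S₁ S₂ G : Type*} [CommRing R] [CommRing S₁] [CommRing S₂] [CommRing G]
  [Algebra R S₁] [Algebra R S₂] [Algebra R G] [Algebra S₁ G] [Algebra S₂ G]
  [IsScalarTower R S₁ G] [IsScalarTower R S₂ G] (h j : R)
  [IsLocalization.Away h S₁] [IsLocalization.Away j S₂]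

lemma exists_glue [IsLocalization.Away (algebraMap R S₁ j) G] (hc : IsCoprime h j) (a : S₁) (b : S₂)
    (hab : algebraMap S₁ G a = algebraMap S₂ G b) :
    ∃ r : R, algebraMap R S₁ r = a ∧ algebraMap R S₂ r = b := by
  obtain ⟨n₁, r₁, h₁⟩ := IsLocalization.Away.surj h a
  obtain ⟨n₂, r₂, h₂⟩ := IsLocalization.Away.surj j b
  have e : algebraMap S₁ G (algebraMap R S₁ (r₁ * j ^ n₂)) =
      algebraMap S₁ G (algebraMap R S₁ (r₂ * h ^ n₁)) := by
    have h1 := congrArg (algebraMap S₁ G) h₁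
    have h2 := congrArg (algebraMap S₂ G) h₂
    simp only [map_mul, map_pow, ← IsScalarTower.algebraMap_apply] at h1 h2 ⊢
    rw [hab] at h1
    rw [← h1, ← h2]; ring
  obtain ⟨k, hk⟩ := IsLocalization.Away.exists_of_eq (algebraMap R S₁ j) e
  rw [← map_pow, ← map_mul, ← map_mul] at hk
  obtain ⟨l, hl⟩ := IsLocalization.Away.exists_of_eq h hk
  obtain ⟨α, β, hαβ⟩ := hc.pow (m := n₁ + l) (n := n₂ + k)
  refine ⟨α * (r₁ * h ^ l) + β * (r₂ * j ^ k), ?_, ?_⟩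
  · have hu : IsUnit (algebraMap R S₁ (h ^ (n₁ + l))) := by
      rw [map_pow]; exact (IsLocalization.Away.algebraMap_isUnit h).pow _
    refine hu.mul_right_cancel ?_
    rw [← map_mul, show (α * (r₁ * h ^ l) + β * (r₂ * j ^ k)) * h ^ (n₁ + l) = r₁ * h ^ l by
      linear_combination r₁ * h ^ l * hαβ - β * hl, map_mul, ← h₁, pow_add, map_mul, map_pow,
      map_pow]
    ring
  · have hu : IsUnit (algebraMap R S₂ (j ^ (n₂ + k))) := by
      rw [map_pow]; exact (IsLocalization.Away.algebraMap_isUnit j).pow _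
    refine hu.mul_right_cancel ?_
    rw [← map_mul, show (α * (r₁ * h ^ l) + β * (r₂ * j ^ k)) * j ^ (n₂ + k) = r₂ * j ^ k by
      linear_combination r₂ * j ^ k * hαβ + α * hl, map_mul, ← h₂, pow_add, map_mul, map_pow,
      map_pow]
    ring

lemma eq_of_algebraMap_eq (hc : IsCoprime h j) (a b : R)
    (h₁ : algebraMap R S₁ a = algebraMap R S₁ b) (h₂ : algebraMap R S₂ a = algebraMap R S₂ b) :
    a = b := by
  obtain ⟨k, hk⟩ := IsLocalization.Away.exists_of_eq h h₁
  obtain ⟨l, hl⟩ := IsLocalization.Away.exists_of_eq j h₂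
  obtain ⟨α, β, hαβ⟩ := hc.pow (m := k) (n := l)
  linear_combination α * hk + β * hl - (a - b) * hαβ

lemma exists_pow_mem_of_unimod {m : ℕ} (v : Fin m → R) (hv : Unimod (algebraMap R S₁ ∘ v)) :
    ∃ (n : ℕ) (ρ : Fin m → R), ρ ⬝ᵥ v = h ^ n := by
  obtain ⟨r, hr⟩ := hv
  obtain ⟨b, hb⟩ := IsLocalization.exist_integer_multiples_of_finite (Submonoid.powers h) r
  choose a ha using hb
  obtain ⟨n, hn⟩ := b.2
  have : algebraMap R S₁ (a ⬝ᵥ v) = algebraMap R S₁ (h ^ n) := by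
    rw [RingHom.map_dotProduct]
    have : (algebraMap R S₁ ∘ a) = algebraMap R S₁ (h ^ n) • r := by
      ext i
      rw [Function.comp_apply, ha, Pi.smul_apply, smul_eq_mul, ← Algebra.smul_def]
      simp only at hn
      rw [hn]
    rw [this, smul_dotProduct, hr, smul_eq_mul, mul_one]
  obtain ⟨k, hk⟩ := IsLocalization.Away.exists_of_eq h this
  exact ⟨k + n, h ^ k • a, by rw [smul_dotProduct, smul_eq_mul, hk, pow_add]⟩

lemma unimod_of_unimod {m : ℕ} (hc : IsCoprime h j) (v : Fin m → R)
    (h₁ : Unimod (algebraMap R S₁ ∘ v)) (h₂ : Unimod (algebraMap R S₂ ∘ v)) : Unimod v := by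
  obtain ⟨k, ρ, hk⟩ := exists_pow_mem_of_unimod h v h₁
  obtain ⟨l, σ, hl⟩ := exists_pow_mem_of_unimod j v h₂
  obtain ⟨α, β, hαβ⟩ := hc.pow (m := k) (n := l)
  exact ⟨α • ρ + β • σ, by
    rw [add_dotProduct, smul_dotProduct, smul_dotProduct, hk, hl, smul_eq_mul, smul_eq_mul, hαβ]⟩

/-- Evaluate an invertible polynomial matrix at an element. -/
noncomputable def evalUnit {m : ℕ} {A : Type*} [CommRing A] (a : A) :
    (Matrix (Fin m) (Fin m) A[X])ˣ →* (Matrix (Fin m) (Fin m) A)ˣ :=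
  Units.map ((evalRingHom a).mapMatrix : Matrix (Fin m) (Fin m) A[X] →+* _).toMonoidHom

/-- Lift an isotopy to a localization after rescaling the parameter. -/
lemma exists_lift_isotopy {H H' : Type*} [CommRing H] [CommRing H'] [Algebra H H'] (s : H)
    [IsLocalization.Away s H'] {m : ℕ} (e : Matrix (Fin m) (Fin m) H)
    (α : (Matrix (Fin m) (Fin m) H'[X])ˣ) (hα0 : (evalUnit 0 α) = 1)
    (hα : (α : Matrix (Fin m) (Fin m) H'[X]) * (e.map (algebraMap H H')).map C =
      (e.map (algebraMap H H')).map C * α) :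
    ∃ N : ℕ, ∀ a : H, ∃ β : (Matrix (Fin m) (Fin m) H)ˣ,
      (β : Matrix (Fin m) (Fin m) H) * e = e * β ∧
      (β : Matrix (Fin m) (Fin m) H).map (algebraMap H H') =
        (evalUnit (algebraMap H H' (s ^ N * a)) α : (Matrix (Fin m) (Fin m) H')ˣ).val := by
  have hC : (mapRingHom (algebraMap H H')).comp C = C.comp (algebraMap H H') := by ext; simp
  have heC : (e.map C).map (mapRingHom (algebraMap H H')) = (e.map (algebraMap H H')).map C := by
    ext1 i k; exact congrArg (fun g : H →+* H'[X] => g (e i k)) hC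
  obtain ⟨t, ⟨N, rfl⟩, δ, h1, h2⟩ := exists_pairRel_of_localization (H' := H')
    (Submonoid.powers s) (e.map C, (0 : Fin m → H[X])) (e.map C, 0) rfl α (by
      have := congrArg Units.val hα0
      ext1 i k
      have := congrFun (congrFun this i) k
      rw [Matrix.map_apply, constantCoeff_apply, coeff_zero_eq_eval_zero]
      exact this) (by
      refine ⟨?_, ?_⟩
      · change _ * (e.map C).map (mapRingHom (algebraMap H H')) =
          (e.map C).map (mapRingHom (algebraMap H H')) * _
        rw [heC, hα]
      · ext; simp [mapPair, mulVec, dotProduct])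
  have h1 := h1.1
  refine ⟨N, fun a => ⟨evalUnit a δ, ?_, ?_⟩⟩
  · have h3 := congrArg (fun M : Matrix (Fin m) (Fin m) H[X] => M.map (evalRingHom a)) h1
    simp only [Matrix.map_mul, mapPair] at h3
    have h4 : (((evalRingHom a).comp (scaleHom (s ^ N))).comp C) = RingHom.id H := by
      rw [RingHom.comp_assoc, scaleHom_comp_C]; ext; simp
    have h5 : ((e.map C).map (scaleHom (s ^ N))).map (evalRingHom a) = e := by
      ext1 i k; exact congrArg (fun g : H →+* H => g (e i k)) h4
    rw [h5] at h3
    exact h3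
  · have h3 := congrArg (fun M : Matrix (Fin m) (Fin m) H'[X] =>
      M.map (evalRingHom (algebraMap H H' a))) h2
    have h4 : (evalRingHom (algebraMap H H' a)).comp (mapRingHom (algebraMap H H')) =
        (algebraMap H H').comp (evalRingHom a) := by ext <;> simp
    have h5 : (evalRingHom (algebraMap H H' a)).comp (scaleHom (algebraMap H H' (s ^ N))) =
        evalRingHom (algebraMap H H' (s ^ N * a)) := by
      ext <;> simp [scaleHom]
    ext1 i k
    have h6 := congrFun (congrFun h3 i) k
    refine (congrArg (fun g : H[X] →+* H' => g (δ.1 i k)) h4).symm.trans (h6.trans ?_)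
    exact congrArg (fun g : H'[X] →+* H' => g (α.1 i k)) h5

/-- Quillen splitting and gluing of two unimodular elements along an isotopy. -/
lemma exists_unimod_of_isotopy [IsLocalization.Away (algebraMap R S₁ j) G]
    [IsLocalization.Away (algebraMap R S₂ h) G] (hc : IsCoprime h j) {m : ℕ}
    (e : Matrix (Fin m) (Fin m) R) (c : Fin m → S₁) (q : Fin m → S₂)
    (hec : e.map (algebraMap R S₁) *ᵥ c = c) (heq : e.map (algebraMap R S₂) *ᵥ q = q)
    (hcu : Unimod c) (hqu : Unimod q)
    (α : (Matrix (Fin m) (Fin m) G[X])ˣ) (hα0 : evalUnit 0 α = 1)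
    (hα : (α : Matrix (Fin m) (Fin m) G[X]) * (e.map (algebraMap R G)).map C =
      (e.map (algebraMap R G)).map C * α)
    (hqc : (evalUnit 1 α).val *ᵥ (algebraMap S₂ G ∘ q) = algebraMap S₁ G ∘ c) :
    ∃ v, e *ᵥ v = v ∧ Unimod v := by
  have he1 : (e.map (algebraMap R S₁)).map (algebraMap S₁ G) = e.map (algebraMap R G) := by
    ext; simp [← IsScalarTower.algebraMap_apply]
  have he2 : (e.map (algebraMap R S₂)).map (algebraMap S₂ G) = e.map (algebraMap R G) := by
    ext; simp [← IsScalarTower.algebraMap_apply]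
  have heval (a : G) (α : (Matrix (Fin m) (Fin m) G[X])ˣ)
      (hα : (α : Matrix (Fin m) (Fin m) G[X]) * (e.map (algebraMap R G)).map C =
        (e.map (algebraMap R G)).map C * α) :
      (evalUnit a α).val * e.map (algebraMap R G) = e.map (algebraMap R G) * (evalUnit a α).val := by
    have h3 := congrArg (fun M : Matrix (Fin m) (Fin m) G[X] => M.map (evalRingHom a)) hα
    simp only [Matrix.map_mul] at h3
    have h5 : ((e.map (algebraMap R G)).map C).map (evalRingHom a) = e.map (algebraMap R G) := by
      ext; simp
    rw [h5] at h3; exact h3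
  obtain ⟨N₁, hN₁⟩ := exists_lift_isotopy (algebraMap R S₁ j) (e.map (algebraMap R S₁)) α hα0
    (by rw [he1, hα])
  -- the reversed isotopy
  let ρ : G[X] →+* G[X] := compRingHom (1 - X)
  let Cα : (Matrix (Fin m) (Fin m) G[X])ˣ :=
    Units.map ((C : G →+* G[X]).mapMatrix : Matrix (Fin m) (Fin m) G →+* _).toMonoidHom
      (evalUnit 1 α)
  let αr := Units.map (ρ.mapMatrix : Matrix (Fin m) (Fin m) G[X] →+* _).toMonoidHom α
  have hev (a : G) : evalUnit a (αr⁻¹ * Cα) = (evalUnit (1 - a) α)⁻¹ * evalUnit 1 α := by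
    rw [map_mul, map_inv]
    congr 1
    · congr 1
      ext1; ext1 i k
      have : (evalRingHom a).comp ρ = evalRingHom (1 - a) := by ext <;> simp [ρ]
      exact congrArg (fun g : G[X] →+* G => g (α.1 i k)) this
    · ext1; ext1 i k
      exact eval_C
  have hκ : ((αr⁻¹ * Cα : (Matrix (Fin m) (Fin m) G[X])ˣ) : Matrix (Fin m) (Fin m) G[X]) *
      (e.map (algebraMap R G)).map C = (e.map (algebraMap R G)).map C *
        (αr⁻¹ * Cα : (Matrix (Fin m) (Fin m) G[X])ˣ) := by
    have h1 : Cα.val * (e.map (algebraMap R G)).map C = (e.map (algebraMap R G)).map C * Cα.val := by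
      have := congrArg (fun M : Matrix (Fin m) (Fin m) G => M.map C) (heval 1 α hα)
      simp only [Matrix.map_mul] at this
      exact this
    have h2 : αr.val * (e.map (algebraMap R G)).map C = (e.map (algebraMap R G)).map C * αr.val := by
      have := congrArg (fun M : Matrix (Fin m) (Fin m) G[X] => M.map ρ) hα
      simp only [Matrix.map_mul] at this
      have h5 : ((e.map (algebraMap R G)).map C).map ρ = (e.map (algebraMap R G)).map C := by
        ext1 i k; simp [ρ]
      rw [h5] at this; exact this
    rw [Units.val_mul, mul_assoc, h1, ← mul_assoc, ← mul_assoc]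
    congr 1
    rw [Units.inv_mul_eq_iff_eq_mul, ← mul_assoc, h2, Units.mul_inv_cancel_right]
  obtain ⟨N₂, hN₂⟩ := exists_lift_isotopy (algebraMap R S₂ h) (e.map (algebraMap R S₂))
    (αr⁻¹ * Cα) (by rw [hev, sub_zero, inv_mul_cancel]) (by rw [he2]; exact hκ)
  obtain ⟨a', a, haa⟩ := hc.pow (m := N₂) (n := N₁)
  obtain ⟨β₁, b1, b2⟩ := hN₁ (algebraMap R S₁ a)
  obtain ⟨β₂, b3, b4⟩ := hN₂ (algebraMap R S₂ a')
  rw [← map_pow, ← map_mul, ← IsScalarTower.algebraMap_apply] at b2 b4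
  rw [hev] at b4
  have hg : 1 - algebraMap R G (h ^ N₂ * a') = algebraMap R G (j ^ N₁ * a) := by
    rw [← map_one (algebraMap R G), ← haa, ← map_sub]; congr 1; ring
  rw [hg] at b4
  set g := algebraMap R G (j ^ N₁ * a)
  set v₁ := (β₁⁻¹).val *ᵥ c with hv1
  set v₂ := β₂.val *ᵥ q with hv2
  have k1 : algebraMap S₁ G ∘ v₁ = algebraMap S₂ G ∘ v₂ := by
    have l1 : algebraMap S₂ G ∘ v₂ = ((evalUnit g α)⁻¹).val *ᵥ (algebraMap S₁ G ∘ c) := by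
      rw [← hqc, mulVec_mulVec, ← Units.val_mul, ← b4]
      ext1 i; exact RingHom.map_mulVec _ _ _ _
    have l2 : (evalUnit g α).val *ᵥ (algebraMap S₁ G ∘ v₁) = algebraMap S₁ G ∘ c := by
      rw [← b2]
      ext1 i
      rw [← RingHom.map_mulVec, hv1, mulVec_mulVec, Units.mul_inv, one_mulVec]; rfl
    rw [l1, ← l2, mulVec_mulVec, Units.inv_mul, one_mulVec]
  choose v hvv₁ hvv₂ using fun i => exists_glue h j hc (v₁ i) (v₂ i) (congrFun k1 i)
  have hvv₁ : algebraMap R S₁ ∘ v = v₁ := funext hvv₁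
  have hvv₂ : algebraMap R S₂ ∘ v = v₂ := funext hvv₂
  have e1 : e.map (algebraMap R S₁) *ᵥ v₁ = v₁ := by
    have : e.map (algebraMap R S₁) * (β₁⁻¹).val = (β₁⁻¹).val * e.map (algebraMap R S₁) := by
      rw [Units.eq_inv_mul_iff_mul_eq, ← mul_assoc, b1, Units.mul_inv_cancel_right]
    rw [hv1, mulVec_mulVec, this, ← mulVec_mulVec, hec]
  have e2 : e.map (algebraMap R S₂) *ᵥ v₂ = v₂ := by
    rw [hv2, mulVec_mulVec, ← b3, ← mulVec_mulVec, heq]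
  refine ⟨v, ?_, ?_⟩
  · ext1 i
    refine eq_of_algebraMap_eq h j (S₁ := S₁) (S₂ := S₂) hc _ _ ?_ ?_
    · rw [RingHom.map_mulVec, hvv₁, e1, ← hvv₁]; rfl
    · rw [RingHom.map_mulVec, hvv₂, e2, ← hvv₂]; rfl
  · refine unimod_of_unimod h j (S₁ := S₁) (S₂ := S₂) hc _ ?_ ?_
    · rw [hvv₁]; exact GLEquiv.unimod ⟨_, rfl⟩ hcu
    · rw [hvv₂]; exact GLEquiv.unimod ⟨_, rfl⟩ hqu

end Abstract

end Gluing

section Gluing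

open Matrix Polynomial

lemma mem_span_range_iff_dotProduct {R ι : Type*} [CommRing R] [Fintype ι] (y : ι → R) (x : R) :
    x ∈ Ideal.span (Set.range y) ↔ ∃ ρ, ρ ⬝ᵥ y = x :=
  Ideal.mem_span_range_iff_exists_fun

lemma unimod_iff_span_eq_top {R ι : Type*} [CommRing R] [Fintype ι] (y : ι → R) :
    Unimod y ↔ Ideal.span (Set.range y) = ⊤ := by
  rw [Ideal.eq_top_iff_one, mem_span_range_iff_dotProduct, Unimod]

lemma unimod_of_isUnit {R ι : Type*} [CommRing R] [Fintype ι] (ρ y : ι → R)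
    (h : IsUnit (ρ ⬝ᵥ y)) : Unimod y := by
  obtain ⟨u, hu⟩ := h.exists_left_inv
  exact ⟨u • ρ, by rw [smul_dotProduct, smul_eq_mul, hu]⟩

lemma unimod_smul {R ι : Type*} [CommRing R] [Fintype ι] (ρ y : ι → R) {a : R} (ha : IsUnit a)
    (h : IsUnit (ρ ⬝ᵥ y)) : Unimod (a • y) :=
  unimod_of_isUnit ρ _ (by rw [dotProduct_smul]; exact ha.mul h)

lemma unimod_reflect {G : Type*} [CommRing G] {m E : ℕ} (y : Fin m → G[X])
    (hE : ∀ i, (y i).natDegree ≤ E) (hy : Unimod y) (hc : Unimod fun i => (y i).coeff E) :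
    Unimod fun i => reflect E (y i) := by
  obtain ⟨ρ, hρ⟩ := hy
  obtain ⟨ψ, hψ⟩ := hc
  set N := Finset.univ.sup fun i => (ρ i).natDegree
  rw [unimod_iff_span_eq_top, Ideal.eq_top_iff_one]
  set O := Ideal.span (Set.range fun i => reflect E (y i))
  have h1 : (X : G[X]) ^ (N + E) ∈ O := by
    rw [mem_span_range_iff_dotProduct]
    refine ⟨fun i => reflect N (ρ i), ?_⟩
    have hr : ∀ (s : Finset (Fin m)) (g : Fin m → G[X]),
        reflect (N + E) (∑ i ∈ s, g i) = ∑ i ∈ s, reflect (N + E) (g i) := by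
      intro s g
      induction s using Finset.cons_induction with
      | empty => simp
      | cons a s ha ih => rw [Finset.sum_cons, Finset.sum_cons, reflect_add, ih]
    have h2 := congrArg (reflect (N + E)) hρ
    rw [dotProduct, hr, ← C_1, reflect_C, C_1, one_mul] at h2
    rw [← h2, dotProduct]
    refine Finset.sum_congr rfl fun i _ => ?_
    rw [reflect_mul _ _ (Finset.le_sup (f := fun i => (ρ i).natDegree) (Finset.mem_univ i)) (hE i)]
  obtain ⟨t, ht⟩ : (X : G[X]) ∣ ((C ∘ ψ) ⬝ᵥ fun i => reflect E (y i)) - 1 := by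
    rw [X_dvd_iff, coeff_sub, coeff_one_zero, sub_eq_zero, ← hψ, dotProduct, finsetSum_coeff]
    refine Finset.sum_congr rfl fun i _ => ?_
    simp [coeff_reflect]
  have h2 : (1 : G[X]) + X * t ∈ O := by
    rw [mem_span_range_iff_dotProduct]
    exact ⟨_, by rw [← ht]; ring⟩
  obtain ⟨a, b, hab⟩ : IsCoprime ((X : G[X]) ^ (N + E)) (1 + X * t) :=
    IsCoprime.pow_left ⟨-t, 1, by ring⟩
  rw [← hab]
  exact O.add_mem (O.mul_mem_left _ h1) (O.mul_mem_left _ h2)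

lemma evalUnit_mulVec {m : ℕ} {G : Type*} [CommRing G] (a : G) (γ : (Matrix (Fin m) (Fin m) G[X])ˣ)
    (v : Fin m → G[X]) :
    (evalUnit a γ).val *ᵥ (fun i => (v i).eval a) = fun i => ((γ.val *ᵥ v) i).eval a := by
  ext1 i; exact (RingHom.map_mulVec (evalRingHom a) _ _ _).symm

/-- A unimodular element of an extended module with a monic extended functional is
joined to its value at zero by an isotopy. -/
lemma exists_isotopy_of_monic {G : Type*} [CommRing G] {m : ℕ} (e : Matrix (Fin m) (Fin m) G)
    (he : e * e = e)
    (hrk : ∀ p, 2 ≤ rkAt p e) (y : Fin m → G[X]) (hy : e.map C *ᵥ y = y) (hu : Unimod y)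
    (ψ : Fin m → G) (hψ : ((C ∘ ψ) ⬝ᵥ y).Monic) :
    ∃ γ : (Matrix (Fin m) (Fin m) G[X])ˣ,
      γ.val * e.map C = e.map C * γ.val ∧ evalUnit 0 γ = 1 ∧
      (evalUnit 1 γ).val *ᵥ (fun i => (y i).eval 0) = fun i => (y i).eval 1 := by
  obtain ⟨γ, h1, h2⟩ := exists_pairRel_of_monic e he hrk y hy hu ψ hψ
  have heC : ∀ a : G, (e.map C).map (evalRingHom a) = e := by intro a; ext; simp
  have h1 : γ.val * e.map C = e.map C * γ.val := by
    have : (e.map C).map (evalZeroHom G) = e.map C := by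
      ext1 i j; simp [evalZeroHom]
    rw [← this]; conv_rhs => rw [this]
    exact h1
  have h2 : γ.val *ᵥ (fun i => C ((y i).eval 0)) = y := h2
  have h1' : ∀ a, (evalUnit a γ).val * e = e * (evalUnit a γ).val := by
    intro a
    have := congrArg (fun M : Matrix (Fin m) (Fin m) G[X] => M.map (evalRingHom a)) h1
    simp only [Matrix.map_mul, heC] at this
    exact this
  have h2' : ∀ a, (evalUnit a γ).val *ᵥ (fun i => (y i).eval 0) = fun i => (y i).eval a := by
    intro a
    have := evalUnit_mulVec a γ (fun i => C ((y i).eval 0))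
    simp only [eval_C] at this
    rw [this, h2]
  let γ0 : (Matrix (Fin m) (Fin m) G[X])ˣ :=
    Units.map ((C : G →+* G[X]).mapMatrix : Matrix (Fin m) (Fin m) G →+* _).toMonoidHom
      (evalUnit 0 γ)
  have hγ0 : ∀ a, evalUnit a γ0 = evalUnit 0 γ := by
    intro a
    ext1; ext1 i k
    exact eval_C
  refine ⟨γ * γ0⁻¹, ?_, ?_, ?_⟩
  · have h3 : γ0.val * e.map C = e.map C * γ0.val := by
      have := congrArg (fun M : Matrix (Fin m) (Fin m) G => M.map C) (h1' 0)
      simp only [Matrix.map_mul] at this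
      exact this
    have h4 : (γ0⁻¹).val * e.map C = e.map C * (γ0⁻¹).val := by
      rw [Units.inv_mul_eq_iff_eq_mul, ← mul_assoc, h3, Units.mul_inv_cancel_right]
    rw [Units.val_mul, mul_assoc, h4, ← mul_assoc, h1, mul_assoc]
  · rw [map_mul, map_inv, hγ0, mul_inv_cancel]
  · rw [map_mul, map_inv, hγ0, Units.val_mul, ← mulVec_mulVec]
    have : (evalUnit 0 γ)⁻¹.val *ᵥ (fun i => (y i).eval 0) = fun i => (y i).eval 0 := by
      conv_lhs => rw [← h2' 0, mulVec_mulVec, Units.inv_mul, one_mulVec]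
    rw [this, h2']

/-- The constant and the leading coefficients of a unimodular polynomial vector with unimodular
constant and leading coefficient are isotopic. -/
lemma exists_isotopy_coeff {G : Type*} [CommRing G] {m E : ℕ} (e : Matrix (Fin m) (Fin m) G)
    (he : e * e = e)
    (hrk : ∀ p, 2 ≤ rkAt p e) (y : Fin m → G[X]) (hy : e.map C *ᵥ y = y) (hu : Unimod y)
    (hE : ∀ i, (y i).natDegree ≤ E) (h0 : Unimod fun i => (y i).coeff 0)
    (hc : Unimod fun i => (y i).coeff E) :
    ∃ α : (Matrix (Fin m) (Fin m) G[X])ˣ,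
      evalUnit 0 α = 1 ∧ α.val * e.map C = e.map C * α.val ∧
      (evalUnit 1 α).val *ᵥ (fun i => (y i).coeff 0) = fun i => (y i).coeff E := by
  have hmon : ∀ (z : Fin m → G[X]), (∀ i, (z i).natDegree ≤ E) → Unimod (fun i => (z i).coeff E) →
      ∃ ψ, ((C ∘ ψ) ⬝ᵥ z).Monic := by
    rintro z hz ⟨ψ, hψ⟩
    refine ⟨ψ, monic_of_natDegree_le_of_coeff_eq_one E ?_ ?_⟩
    · exact natDegree_sum_le_of_forall_le _ _ fun i _ =>
        (natDegree_C_mul_le _ _).trans (hz i)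
    · rw [← hψ, dotProduct, finsetSum_coeff]; simp [dotProduct]
  obtain ⟨ψ, hψ⟩ := hmon y hE hc
  obtain ⟨γ, h1, h2, h3⟩ := exists_isotopy_of_monic e he hrk y hy hu ψ hψ
  set z : Fin m → G[X] := fun i => reflect E (y i) with hz
  have hzE : ∀ i, (z i).natDegree ≤ E := by
    intro i
    rw [natDegree_le_iff_coeff_eq_zero]
    intro N hN
    rw [hz, coeff_reflect, revAt_eq_self_of_lt hN]
    exact coeff_eq_zero_of_natDegree_lt ((hE i).trans_lt hN)
  have hz0 : ∀ i, (z i).coeff E = (y i).coeff 0 := by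
    intro i; rw [hz, coeff_reflect, revAt_le le_rfl, Nat.sub_self]
  have hzE' : ∀ i, (z i).coeff 0 = (y i).coeff E := by
    intro i; rw [hz, coeff_reflect, revAt_le (Nat.zero_le _), Nat.sub_zero]
  have hz1 : ∀ i, (z i).eval 1 = (y i).eval 1 := by
    intro i
    let _ : Invertible (1 : G) := invertibleOne
    have := eval₂_reflect_mul_pow (RingHom.id G) 1 E (y i) (hE i)
    simpa [hz, eval₂_id] using this
  have hez : e.map C *ᵥ z = z := by
    ext i k
    have h := congrArg (fun p : G[X] => p.coeff (revAt E k)) (congrFun hy i)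
    simp only [mulVec, dotProduct, finsetSum_coeff, Matrix.map_apply, coeff_C_mul] at h ⊢
    simpa only [hz, coeff_reflect] using h
  obtain ⟨ψ', hψ'⟩ := hmon z hzE (by simpa only [hz0] using h0)
  obtain ⟨δ, k1, k2, k3⟩ := exists_isotopy_of_monic e he hrk z hez (unimod_reflect y hE hu hc) ψ' hψ'
  refine ⟨δ⁻¹ * γ, ?_, ?_, ?_⟩
  · rw [map_mul, map_inv, h2, k2, inv_one, one_mul]
  · rw [Units.val_mul, mul_assoc, h1, ← mul_assoc, ← mul_assoc]
    congr 1
    rw [Units.inv_mul_eq_iff_eq_mul, ← mul_assoc, k1, Units.mul_inv_cancel_right]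
  · simp only [← coeff_zero_eq_eval_zero] at h3 k3
    rw [map_mul, map_inv, Units.val_mul, ← mulVec_mulVec, h3]
    simp only [← hz1, ← k3]
    rw [mulVec_mulVec, Units.inv_mul, one_mulVec]
    exact funext hzE'

/-- Gluing a vector, unimodular off `V(j)`, along an isotopy to the leading coefficient of a polynomial vector. -/
theorem exists_unimod_of_polynomial {R : Type*} [CommRing R] {m E k : ℕ}
    (e : Matrix (Fin m) (Fin m) R)
    (he : e * e = e) (hrk : ∀ p, 2 ≤ rkAt p e) (u u₃ u₄ j : R) (hj : u * u₃ * u₄ = 1 + j)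
    (q : Fin m → R) (hq : e *ᵥ q = q) (hjq : j ∈ Ideal.span (Set.range q))
    (y : Fin m → R[X]) (hy : e.map C *ᵥ y = y) (hE : ∀ i, (y i).natDegree ≤ E)
    (h0 : ∀ i, (y i).coeff 0 = u * q i)
    (ψ : Fin m → R) (hψ : (ψ ⬝ᵥ fun i => (y i).coeff E) = u₃)
    (hk : C (u₄ * j ^ k) ∈ Ideal.span (Set.range y)) :
    ∃ v, e *ᵥ v = v ∧ Unimod v := by
  set h := u * u₃ * u₄ with hh
  have hc : IsCoprime h j := ⟨1, -1, by rw [hj]; ring⟩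
  let S₁ := Localization.Away h
  let S₂ := Localization.Away j
  let G := Localization.Away (algebraMap R S₁ j)
  have hjG : IsUnit (algebraMap R G j) := by
    rw [IsScalarTower.algebraMap_apply R S₁ G]
    exact IsLocalization.Away.algebraMap_isUnit _
  have hhS : IsUnit (algebraMap R S₁ h) := IsLocalization.Away.algebraMap_isUnit _
  let φ : S₂ →+* G := IsLocalization.Away.lift j hjG
  algebraize [φ]
  have : IsScalarTower R S₂ G := IsScalarTower.of_algebraMap_eq fun x =>
    (IsLocalization.Away.lift_eq j hjG x).symm
  have : IsLocalization.Away (algebraMap R S₂ h) G := IsLocalization.Away.commutes S₂ S₁ G j h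
  have hprod : IsUnit (algebraMap R S₁ u * algebraMap R S₁ u₃ * algebraMap R S₁ u₄) := by
    rw [← map_mul, ← map_mul]; exact hhS
  have huS := isUnit_of_mul_isUnit_left (isUnit_of_mul_isUnit_left hprod)
  have hu3S := isUnit_of_mul_isUnit_right (isUnit_of_mul_isUnit_left hprod)
  have hu4S := isUnit_of_mul_isUnit_right hprod
  have hG : ∀ x, algebraMap R G x = algebraMap S₁ G (algebraMap R S₁ x) :=
    IsScalarTower.algebraMap_apply R S₁ G
  have hu4G : IsUnit (algebraMap R G u₄) := by rw [hG]; exact hu4S.map _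
  have hu3G : IsUnit (algebraMap R G u₃) := by rw [hG]; exact hu3S.map _
  have huG : IsUnit (algebraMap R G u) := by rw [hG]; exact huS.map _
  let f := mapRingHom (algebraMap R G)
  obtain ⟨σ, hσ⟩ := (mem_span_range_iff_dotProduct _ _).1 hjq
  obtain ⟨α, a1, a2, a3⟩ := exists_isotopy_coeff (E := E) (e.map (algebraMap R G))
    (by rw [← Matrix.map_mul, he]) (fun p => by rw [rkAt_map _ _ _ he]; exact hrk _) (f ∘ y)
    (by
      have hC : f.comp C = C.comp (algebraMap R G) := by ext; simp [f]
      have heC : (e.map C).map f = (e.map (algebraMap R G)).map C := by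
        ext1 i j; exact congrArg (fun g : R →+* G[X] => g (e i j)) hC
      ext1 i
      rw [← heC, ← RingHom.map_mulVec, hy]; rfl)
    (by
      obtain ⟨ρ, hρ⟩ := (mem_span_range_iff_dotProduct _ _).1 hk
      refine unimod_of_isUnit (f ∘ ρ) _ ?_
      rw [← RingHom.map_dotProduct, hρ]
      simp only [f, coe_mapRingHom, map_C, map_mul, map_pow]
      exact (hu4G.map C).mul ((hjG.map C).pow _))
    (fun i => (natDegree_map_le).trans (hE i))
    (by
      have : (fun i => ((f ∘ y) i).coeff 0) = algebraMap R G u • (algebraMap R G ∘ q) := by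
        ext1 i; simp [f, h0]
      rw [this]
      refine unimod_smul (algebraMap R G ∘ σ) _ huG ?_
      rw [← RingHom.map_dotProduct, hσ]
      exact hjG)
    (by
      refine unimod_of_isUnit (algebraMap R G ∘ ψ) _ ?_
      have : (fun i => ((f ∘ y) i).coeff E) = algebraMap R G ∘ fun i => (y i).coeff E := by
        ext1 i; simp [f]
      rw [this, ← RingHom.map_dotProduct, hψ]
      exact hu3G)
  obtain ⟨w, hw⟩ := huS.exists_right_inv
  refine exists_unimod_of_isotopy (S₁ := S₁) (S₂ := S₂) (G := G) h j hc e
    (w • (algebraMap R S₁ ∘ fun i => (y i).coeff E)) (algebraMap R S₂ ∘ q) ?_ ?_ ?_ ?_ α a1 a2 ?_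
  · rw [mulVec_smul]
    congr 1
    ext1 i
    rw [← RingHom.map_mulVec]
    have := congrArg (fun p : R[X] => p.coeff E) (congrFun hy i)
    simp only [mulVec, dotProduct, finsetSum_coeff, Matrix.map_apply, coeff_C_mul] at this
    exact congrArg _ this
  · ext1 i; rw [← RingHom.map_mulVec, hq]; rfl
  · refine unimod_smul (algebraMap R S₁ ∘ ψ) _ (IsUnit.of_mul_eq_one_right _ hw) ?_
    rw [← RingHom.map_dotProduct, hψ]
    exact hu3S
  · refine unimod_of_isUnit (algebraMap R S₂ ∘ σ) _ ?_
    rw [← RingHom.map_dotProduct, hσ]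
    exact IsLocalization.Away.algebraMap_isUnit _
  · have e1 : (fun i => ((f ∘ y) i).coeff 0) = algebraMap R G u • (algebraMap R G ∘ q) := by
      ext1 i; simp [f, h0]
    have e2 : (fun i => ((f ∘ y) i).coeff E) = algebraMap S₁ G ∘ algebraMap R S₁ ∘ fun i => (y i).coeff E := by
      ext1 i; simp [f, hG]
    have e3 : algebraMap S₂ G ∘ algebraMap R S₂ ∘ q = algebraMap R G ∘ q := by
      ext1 i; exact (IsScalarTower.algebraMap_apply R S₂ G _).symm
    rw [e1, e2, mulVec_smul] at a3
    rw [e3]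
    have hw' : algebraMap S₁ G w * algebraMap R G u = 1 := by
      rw [hG, ← map_mul, mul_comm w, hw, map_one]
    have := congrArg (fun v => algebraMap S₁ G w • v) a3
    simp only [smul_smul, hw', one_smul] at this
    rw [this]
    ext1 i
    simp

end Gluing

section MonicFree

open Matrix Polynomial

/-- The prime of `B[X]` obtained from `𝔓` by the substitution `X ↦ X⁻¹`. -/
lemma exists_reversed_prime {B : Type*} [CommRing B] (𝔓 : PrimeSpectrum B[X])
    (hX : X ∉ 𝔓.asIdeal) :
    ∃ 𝔔 : PrimeSpectrum B[X], (∀ g, g ∈ 𝔔.asIdeal ↔ g.reverse ∈ 𝔓.asIdeal) ∧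
      ∀ g, g ∈ 𝔓.asIdeal ↔ g.reverse ∈ 𝔔.asIdeal := by
  let K := FractionRing (B[X] ⧸ 𝔓.asIdeal)
  let π : B[X] →+* K := (algebraMap _ K).comp (Ideal.Quotient.mk 𝔓.asIdeal)
  have hπ : ∀ g, g ∈ 𝔓.asIdeal ↔ π g = 0 := by
    intro g
    rw [← Ideal.Quotient.eq_zero_iff_mem, RingHom.comp_apply,
      map_eq_zero_iff _ (IsFractionRing.injective (B[X] ⧸ 𝔓.asIdeal) K)]
  set t := π X with ht
  have ht0 : t ≠ 0 := fun h => hX ((hπ X).2 h)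
  let i : B →+* K := π.comp C
  have hev : ∀ g, π g = eval₂ i t g := by
    intro g
    exact congrArg (fun f : B[X] →+* K => f g) (show π = eval₂RingHom i t by ext <;> simp [i, ht])
  let _ : Invertible t := invertibleOfNonzero ht0
  let ψ := eval₂RingHom i (⅟t)
  refine ⟨⟨RingHom.ker ψ, RingHom.ker_isPrime ψ⟩, fun g => ?_, fun g => ?_⟩
  · rw [hπ, hev, RingHom.mem_ker]
    have := eval₂_reverse_eq_zero_iff i (⅟t) g
    rw [invOf_invOf] at this
    exact this.symm
  · rw [hπ, hev, RingHom.mem_ker]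
    exact (eval₂_reverse_eq_zero_iff i t g).symm

/-- Primes of `B[X]` above `J` without monic elements have dimension at most that of `B ⧸ J`. -/
lemma krullDim_monicFree_le {B : Type*} [CommRing B] [IsNoetherianRing B] (J : Ideal B) {D : ℕ}
    (hD : ringKrullDim (B ⧸ J) ≤ D) (P : Set (PrimeSpectrum B[X]))
    (hP : ∀ 𝔓 ∈ P, J.map C ≤ 𝔓.asIdeal ∧ ∀ g ∈ 𝔓.asIdeal, ¬ g.Monic) :
    Order.krullDim P ≤ D := by
  have hX : ∀ 𝔓 : P, X ∉ 𝔓.1.asIdeal := fun 𝔓 h => (hP 𝔓 𝔓.2).2 _ h monic_X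
  choose F hF1 hF2 using fun 𝔓 : P => exists_reversed_prime 𝔓.1 (hX 𝔓)
  have hFJ : ∀ 𝔓 : P, J.map C ≤ (F 𝔓).asIdeal := by
    intro 𝔓
    rw [Ideal.map_le_iff_le_comap]
    intro b hb
    rw [Ideal.mem_comap, hF1, reverse_C]
    exact (hP 𝔓 𝔓.2).1 (Ideal.mem_map_of_mem _ hb)
  have hFm : StrictMono F := by
    intro 𝔓 𝔓' h
    refine lt_of_le_not_ge (fun g hg => ?_) fun hle => h.not_ge fun g hg => ?_
    · exact (hF1 _ _).2 (h.le ((hF1 _ _).1 hg))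
    · exact (hF2 _ _).2 (hle ((hF2 _ _).1 hg))
  have hdim : ringKrullDim (B[X] ⧸ J.map C) ≤ (D + 1 : ℕ) := by
    rw [← ringKrullDim_eq_of_ringEquiv (Ideal.polynomialQuotientEquivQuotientPolynomial J),
      Polynomial.ringKrullDim_of_isNoetherianRing]
    push_cast
    gcongr
  rw [ringKrullDim_quotient] at hdim
  refine iSup_le fun p => ?_
  let 𝔓 := RelSeries.last p
  have htop : (F 𝔓).asIdeal ⊔ Ideal.span {X} ≠ ⊤ := by
    intro h
    rw [Ideal.eq_top_iff_one, Submodule.mem_sup] at h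
    obtain ⟨g, hg, x, hx, hgx⟩ := h
    obtain ⟨x, rfl⟩ := Ideal.mem_span_singleton.1 hx
    have h0 : g.coeff 0 = 1 := by
      have := congrArg (fun p => coeff p 0) hgx
      simpa using this
    refine (hP 𝔓 𝔓.2).2 g.reverse ((hF1 _ _).1 hg) ?_
    by_cases hB : Nontrivial B
    · rw [Monic, reverse_leadingCoeff, trailingCoeff, natTrailingDegree_eq_zero.2 (.inr (by rw [h0]; exact one_ne_zero)), h0]
    · rw [not_nontrivial_iff_subsingleton] at hB
      exact Subsingleton.elim _ _
  obtain ⟨𝔐, h𝔐, hle⟩ := Ideal.exists_le_maximal _ htop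
  let z : PrimeSpectrum.zeroLocus (J.map C : Set B[X]) :=
    ⟨⟨𝔐, h𝔐.isPrime⟩, fun g hg => hle (Ideal.mem_sup_left (hFJ 𝔓 hg))⟩
  let p' : LTSeries (PrimeSpectrum.zeroLocus (J.map C : Set B[X])) :=
    p.map (fun 𝔓 => ⟨F 𝔓, hFJ 𝔓⟩) hFm
  have hlt : p'.last < z := by
    refine lt_of_le_not_ge (fun g hg => hle (Ideal.mem_sup_left hg)) fun h => ?_
    have : X ∈ (F 𝔓).asIdeal := h (hle (Ideal.mem_sup_right (Ideal.mem_span_singleton_self _)))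
    refine (hP 𝔓 𝔓.2).2 _ ((hF1 _ _).1 this) ?_
    rw [show (X : B[X]) = 1 * X by ring, reverse_mul_X, ← C_1, reverse_C]
    exact monic_one
  have := (Order.LTSeries.length_le_krullDim (p'.snoc z hlt)).trans hdim
  have h2 : p.length + 1 ≤ D + 1 := by exact_mod_cast this
  exact_mod_cast Nat.le_of_succ_le_succ h2

end MonicFree

section Splitting

open Matrix Polynomial

lemma rkAt_add_le {R m n : Type*} [CommRing R] [Fintype n] [Fintype m] (p : PrimeSpectrum R)
    (X Y : Matrix m n R) : rkAt p (X + Y) ≤ rkAt p X + rkAt p Y := by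
  have h : (X + Y).map (algebraMap R p.asIdeal.ResidueField) =
      X.map (algebraMap R p.asIdeal.ResidueField) + Y.map (algebraMap R p.asIdeal.ResidueField) := by
    ext; simp
  unfold rkAt
  rw [h, Matrix.rank, Matrix.rank, Matrix.rank, mulVecLin_add]
  exact (Submodule.finrank_mono (LinearMap.range_add_le _ _)).trans
    (Submodule.finrank_add_le_finrank_add_finrank _ _)

lemma rkAt_vecMulVec_le {R m n : Type*} [CommRing R] [Fintype n] [Fintype m] (p : PrimeSpectrum R)
    (u : m → R) (v : n → R) : rkAt p (vecMulVec u v) ≤ 1 := by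
  unfold rkAt
  rw [show (vecMulVec u v).map (algebraMap R p.asIdeal.ResidueField) =
    vecMulVec (algebraMap R p.asIdeal.ResidueField ∘ u) (algebraMap R p.asIdeal.ResidueField ∘ v) by
    ext; simp [vecMulVec]]
  exact Matrix.rank_vecMulVec_le _ _

/-- Serre's splitting theorem relative to an ideal in the Jacobson radical. -/
lemma exists_unimod_of_le_jacobson {B : Type*} [CommRing B] [IsNoetherianRing B] (J : Ideal B)
    (hJ : J ≤ Ring.jacobson B) {D N m : ℕ} (hD : ringKrullDim (B ⧸ J) ≤ D) (hDN : D < N)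
    (e : Matrix (Fin m) (Fin m) B) (he : e * e = e) (hrk : ∀ p, N ≤ rkAt p e) :
    ∃ c, e *ᵥ c = c ∧ Unimod c := by
  rw [ringKrullDim_quotient] at hD
  obtain ⟨c, hc, h⟩ := exists_avoid J (PrimeSpectrum.zeroLocus J) (fun p hp => hp)
    (fun p hp q hq hJq => hJq) hD hDN e he (fun p _ => hrk p) 1 (fun p _ h => p.2.ne_top
      ((Ideal.eq_top_iff_one _).2 h)) 0
  refine ⟨c, hc, ?_⟩
  rw [unimod_iff_span_eq_top]
  by_contra hne
  obtain ⟨𝔐, h𝔐, hle⟩ := Ideal.exists_le_maximal _ hne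
  refine h ⟨𝔐, h𝔐.isPrime⟩ (hJ.trans (Ring.jacobson_le_of_isMaximal 𝔐)) fun j => ?_
  · simpa using hle (Ideal.subset_span ⟨j, rfl⟩)


/-- A prime containing `J`, the entries of `θ` and no monic does not exist under these
hypotheses; so a combination of the entries of `θ` is monic up to `J ^ 2`. -/
lemma exists_monic_add_of_forall_prime {B : Type*} [CommRing B] {m : ℕ} (J : Ideal B)
    (θ : Fin m → B[X])
    (h : ∀ 𝔓 : PrimeSpectrum B[X], J.map C ≤ 𝔓.asIdeal → (∀ g ∈ 𝔓.asIdeal, ¬ g.Monic) →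
      ¬ ∀ i, θ i ∈ 𝔓.asIdeal) :
    ∃ (χ : Fin m → B[X]) (g z : B[X]), χ ⬝ᵥ θ = g + z ∧ g.Monic ∧ z ∈ (J.map C) ^ 2 := by
  let M : Submonoid B[X] :=
    { carrier := {g | g.Monic}, one_mem' := monic_one, mul_mem' := fun ha hb => ha.mul hb }
  have hdis : ¬ Disjoint ((Ideal.span (Set.range θ) ⊔ (J.map C) ^ 2 : Ideal B[X]) : Set B[X]) M := by
    intro hd
    obtain ⟨𝔓, h𝔓, hle, hd⟩ := Ideal.exists_le_prime_disjoint _ M hd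
    refine h ⟨𝔓, h𝔓⟩ ?_ (fun g hg hm => Set.disjoint_left.1 hd hg hm) fun i => ?_
    · exact Ideal.IsPrime.le_of_pow_le (le_sup_right.trans hle)
    · exact hle (Ideal.mem_sup_left (Ideal.subset_span ⟨i, rfl⟩))
  obtain ⟨g, hg, hm⟩ := Set.not_disjoint_iff.1 hdis
  obtain ⟨x, hx, z, hz, rfl⟩ := Submodule.mem_sup.1 hg
  obtain ⟨χ, rfl⟩ := (mem_span_range_iff_dotProduct _ _).1 hx
  exact ⟨χ, _, -z, by ring, hm, neg_mem hz⟩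

/-- Over `B` with `J` in the Jacobson radical, an element `q` of the extended module `im e` whose
order ideal contains `J` and a monic can be moved to a polynomial vector with unimodular leading
coefficient, up to `J ^ 2`. -/
theorem exists_unit_unimod_leadingCoeff {B : Type*} [CommRing B] [IsNoetherianRing B]
    (J : Ideal B) (hJ : J ≤ Ring.jacobson B) {D N m : ℕ} (hD : ringKrullDim (B ⧸ J) ≤ D)
    (hDN : D + 1 < N) (e : Matrix (Fin m) (Fin m) B) (he : e * e = e) (hrk : ∀ p, N ≤ rkAt p e)
    (q : Fin m → B[X]) (hq : e.map C *ᵥ q = q) (f : B[X]) (hf : f.Monic)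
    (hfq : f ∈ Ideal.span (Set.range q)) :
    ∃ (ε : (Matrix (Fin m) (Fin m) B[X])ˣ) (c : Fin m → B) (q' z : Fin m → B[X]) (E : ℕ),
      ε.val * e.map C = e.map C * ε.val ∧ Unimod c ∧ ε.val *ᵥ q = q' + z ∧
      0 < E ∧ (∀ i, (q' i).natDegree ≤ E) ∧ (∀ i, (q' i).coeff E = c i) ∧
      e.map C *ᵥ q' = q' ∧ e.map C *ᵥ z = z ∧ ∀ i, z i ∈ (J.map C) ^ 2 := by
  obtain ⟨c, hc, r, hr⟩ := exists_unimod_of_le_jacobson J hJ hD (by omega) e he hrk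
  set ψ := r ᵥ* e with hψ
  have hψc : ψ ⬝ᵥ c = 1 := by rw [hψ, ← dotProduct_mulVec, hc, hr]
  have hψe : ψ ᵥ* e = ψ := by rw [hψ, vecMul_vecMul, he]
  set e' := e - vecMulVec c ψ with he'
  have h1 : e * e' = e' := by rw [he', mul_sub, he, mul_vecMulVec, hc]
  have h2 : e' * e = e' := by rw [he', sub_mul, he, vecMulVec_mul, hψe]
  have h3 : ψ ᵥ* e' = 0 := by
    rw [he', vecMul_sub, hψe, vecMul_vecMulVec, hψc, one_smul, sub_self]
  have h4 : e' *ᵥ c = 0 := by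
    rw [he', sub_mulVec, hc, vecMulVec_mulVec', hψc, one_smul, sub_self]
  have h5 : e' * e' = e' := by
    nth_rewrite 2 [he']
    rw [mul_sub, h2, mul_vecMulVec, h4, zero_vecMulVec, sub_zero]
  have hrk' : ∀ p, N - 1 ≤ rkAt p e' := by
    intro p
    have := rkAt_add_le p e' (vecMulVec c ψ)
    rw [he', sub_add_cancel, ← he'] at this
    have := rkAt_vecMulVec_le p c ψ
    have := hrk p
    omega
  have hmapV : ∀ (M : Matrix (Fin m) (Fin m) B) v, M.map C *ᵥ (C ∘ v) = C ∘ (M *ᵥ v) := by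
    intro M v; ext1 i; exact (RingHom.map_mulVec C M v i).symm
  have hVmap : ∀ (M : Matrix (Fin m) (Fin m) B) v, (C ∘ v) ᵥ* M.map C = C ∘ (v ᵥ* M) := by
    intro M v; ext1 i; exact (RingHom.map_vecMul C M v i).symm
  set a := (C ∘ ψ) ⬝ᵥ q with ha
  set cX : Fin m → B[X] := C ∘ c with hcX
  set θ := e'.map C *ᵥ q with hθ
  have hqd : q = a • cX + θ := by
    have : e'.map C = e.map C - vecMulVec cX (C ∘ ψ) := by
      ext1 i j; simp [he', vecMulVec, hcX]
    rw [hθ, this, sub_mulVec, hq, vecMulVec_mulVec', ha]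
    abel
  have h5X : e'.map (C : B →+* B[X]) * e'.map C = e'.map C := by rw [← Matrix.map_mul, h5]
  have h1X : e.map (C : B →+* B[X]) * e'.map C = e'.map C := by rw [← Matrix.map_mul, h1]
  have h2X : e'.map (C : B →+* B[X]) * e.map C = e'.map C := by rw [← Matrix.map_mul, h2]
  have hecX : e.map C *ᵥ cX = cX := by rw [hcX, hmapV, hc]
  have h4X : e'.map C *ᵥ cX = 0 := by rw [hcX, hmapV, h4]; ext1 i; simp
  have h3X : (C ∘ ψ : Fin m → B[X]) ᵥ* e'.map C = 0 := by rw [hVmap, h3]; ext1 i; simp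
  have hψX : (C ∘ ψ : Fin m → B[X]) ᵥ* e.map C = C ∘ ψ := by rw [hVmap, hψe]
  have hψcX : (C ∘ ψ : Fin m → B[X]) ⬝ᵥ cX = 1 := by
    rw [hcX, ← RingHom.map_dotProduct, hψc, map_one]
  let P : Set (PrimeSpectrum B[X]) :=
    {𝔓 | (J.map C ≤ 𝔓.asIdeal ∧ ∀ g ∈ 𝔓.asIdeal, ¬ g.Monic) ∧ a ∉ 𝔓.asIdeal}
  obtain ⟨y, hy, hyP⟩ := exists_avoid (J.map C) P (fun 𝔓 h => h.1.1)
    (fun 𝔓 h 𝔔 hle hJ => ⟨⟨hJ, fun g hg => h.1.2 g (hle hg)⟩, fun h' => h.2 (hle h')⟩)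
    (krullDim_monicFree_le J hD P fun 𝔓 h => h.1) (N := N - 1) (by omega) (e'.map C) h5X
    (fun 𝔓 _ => by rw [rkAt_map _ _ _ h5]; exact hrk' _) a (fun 𝔓 h => h.2) θ
  set θ' := θ + a • y with hθ'
  have hy0 : (C ∘ ψ) ⬝ᵥ y = 0 := by rw [← hy, dotProduct_mulVec, h3X, zero_dotProduct]
  have hey : e.map C *ᵥ y = y := by conv_lhs => rw [← hy, mulVec_mulVec, h1X, hy]
  have he'θ' : e'.map C *ᵥ θ' = θ' := by
    rw [hθ', mulVec_add, mulVec_smul, hy, hθ, mulVec_mulVec, h5X]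
  have heθ' : e.map C *ᵥ θ' = θ' := by conv_lhs => rw [← he'θ', mulVec_mulVec, h1X, he'θ']
  obtain ⟨χ, g, z, hχ, hg, hz⟩ := exists_monic_add_of_forall_prime J θ' (by
    intro 𝔓 hJ𝔓 hm hcon
    by_cases ha𝔓 : a ∈ 𝔓.asIdeal
    · refine hm f ?_ hf
      refine (Ideal.span_le.2 ?_) hfq
      rintro _ ⟨i, rfl⟩
      have : q i = (cX i - y i) * a + θ' i := by
        rw [hqd, hθ']; simp only [Pi.add_apply, Pi.smul_apply, smul_eq_mul]; ring
      rw [this]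
      exact add_mem (Ideal.mul_mem_left _ _ ha𝔓) (hcon i)
    · exact hyP 𝔓 ⟨⟨hJ𝔓, hm⟩, ha𝔓⟩ hcon)
  set χ' := χ ᵥ* e'.map C with hχ'
  have hχ'θ : χ' ⬝ᵥ θ' = g + z := by rw [hχ', ← dotProduct_mulVec, he'θ', hχ]
  have hχ'c : χ' ⬝ᵥ cX = 0 := by rw [hχ', ← dotProduct_mulVec, h4X, dotProduct_zero]
  have hχ'e : χ' ᵥ* e.map C = χ' := by rw [hχ', vecMul_vecMul, h2X]
  set w := a • cX + θ' with hw
  have hew : e.map C *ᵥ w = w := by rw [hw, mulVec_add, mulVec_smul, hecX, heθ']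
  set S := Finset.univ.sup fun i => (w i).natDegree with hS
  set M := S + 1 with hM
  refine ⟨transvectionUnit ((X ^ M : B[X]) • cX) χ' (by rw [dotProduct_smul, hχ'c, smul_zero]) *
    transvectionUnit y (C ∘ ψ) hy0, c, w + ((X ^ M : B[X]) * g) • cX, ((X ^ M : B[X]) * z) • cX,
    M + g.natDegree, ?_, ⟨r, hr⟩, ?_, by omega, ?_, ?_, ?_, ?_, ?_⟩
  · have k1 : (1 + vecMulVec ((X ^ M : B[X]) • cX) χ') * e.map C =
        e.map C * (1 + vecMulVec ((X ^ M : B[X]) • cX) χ') := by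
      rw [add_mul, mul_add, one_mul, mul_one, vecMulVec_mul, hχ'e, mul_vecMulVec, mulVec_smul, hecX]
    have k2 : (1 + vecMulVec y (C ∘ ψ)) * e.map C = e.map C * (1 + vecMulVec y (C ∘ ψ)) := by
      rw [add_mul, mul_add, one_mul, mul_one, vecMulVec_mul, hψX, mul_vecMulVec, hey]
    change (1 + vecMulVec ((X ^ M : B[X]) • cX) χ') * (1 + vecMulVec y (C ∘ ψ)) * _ =
      _ * ((1 + vecMulVec ((X ^ M : B[X]) • cX) χ') * (1 + vecMulVec y (C ∘ ψ)))
    rw [mul_assoc, k2, ← mul_assoc, k1, mul_assoc]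
  · change ((1 + vecMulVec ((X ^ M : B[X]) • cX) χ') * (1 + vecMulVec y (C ∘ ψ))) *ᵥ q = _
    have : (1 + vecMulVec y (C ∘ ψ)) *ᵥ q = w := by
      rw [add_mulVec, one_mulVec, vecMulVec_mulVec', ← ha, hqd, hw, hθ', add_assoc]
    rw [← mulVec_mulVec, this, add_mulVec, one_mulVec, vecMulVec_mulVec', hw, dotProduct_add,
      dotProduct_smul, hχ'c, smul_zero, zero_add, hχ'θ, smul_smul]
    module
  · intro i
    have hi : (w + ((X ^ M : B[X]) * g) • cX) i = w i + X ^ M * g * C (c i) := rfl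
    rw [hi]
    refine natDegree_add_le_of_degree_le ?_ ?_
    · exact (Finset.le_sup (f := fun i => (w i).natDegree) (Finset.mem_univ i)).trans (by omega)
    · refine (natDegree_mul_C_le _ _).trans (natDegree_mul_le.trans ?_)
      gcongr
      exact natDegree_X_pow_le _
  · intro i
    have k : (w i).coeff (M + g.natDegree) = 0 := by
      refine coeff_eq_zero_of_natDegree_lt ?_
      have := Finset.le_sup (f := fun i => (w i).natDegree) (Finset.mem_univ i)
      simp only [← hS] at this
      omega
    simp only [Pi.add_apply, Pi.smul_apply, smul_eq_mul, hcX, Function.comp_apply, coeff_add, k,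
      coeff_mul_C, zero_add]
    rw [add_comm, coeff_X_pow_mul, hg.coeff_natDegree, one_mul]
  · rw [mulVec_add, mulVec_smul, hew, hecX]
  · rw [mulVec_smul, hecX]
  · intro i
    exact Ideal.mul_mem_right _ _ (Ideal.mul_mem_left _ _ hz)

end Splitting

section Norm

open Matrix Polynomial

/-- If `I` is contained in `O + I²` for an ideal `O` of `S[X]` containing a monic, then an element
of `1 + I ⊆ S` multiplies `I` into `O`. -/
lemma exists_mul_mem_of_le_sup_sq {S : Type*} [CommRing S] (I : Ideal S) (hI : I.FG)
    (O : Ideal S[X]) {f : S[X]} (hf : f.Monic) (hfO : f ∈ O)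
    (hle : I.map C ≤ O ⊔ (I.map C) ^ 2) :
    ∃ u, u - 1 ∈ I ∧ ∀ a ∈ I, C (u * a) ∈ O := by
  obtain ⟨r, hr, hrO⟩ := Submodule.exists_sub_one_mem_and_smul_le_of_fg_of_le_sup
    (hI.map (C : S →+* S[X])) le_rfl (by rw [smul_eq_mul, ← pow_two]; exact hle)
  have hrO : ∀ a ∈ I, r * C a ∈ O := fun a ha =>
    hrO (Submodule.smul_mem_pointwise_smul _ r _ (Ideal.mem_map_of_mem C ha))
  have hfin : Module.Finite S (S[X] ⧸ O) := by
    have := hf.finite_quotient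
    refine Module.Finite.of_surjective
      (Ideal.Quotient.factorₐ S ((Ideal.span_singleton_le_iff_mem O).2 hfO)).toLinearMap
      (Ideal.Quotient.factor_surjective ((Ideal.span_singleton_le_iff_mem O).2 hfO))
  set t := r - 1 with ht
  obtain ⟨p, hp, -, hpI, hp0⟩ :=
    LinearMap.exists_monic_and_natDegree_eq_and_coeff_mem_pow_and_aeval_eq_zero
      S (LinearMap.mulLeft S (Ideal.Quotient.mk O t)) I (by
        rintro _ ⟨x, rfl⟩
        obtain ⟨x, rfl⟩ := Ideal.Quotient.mk_surjective x
        rw [LinearMap.mulLeft_apply, ← map_mul, Ideal.smul_top_eq_map,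
          Submodule.restrictScalars_mem]
        have := Ideal.mem_map_of_mem (Ideal.Quotient.mk O) (Ideal.mul_mem_right x _ hr)
        rw [Ideal.map_map] at this
        exact this)
  have hpO : aeval t p ∈ O := by
    have h1 := congrArg (fun g : Module.End S (S[X] ⧸ O) => g 1) hp0
    have h2 : aeval (LinearMap.mulLeft S (Ideal.Quotient.mk O t)) p =
        LinearMap.mulLeft S (Ideal.Quotient.mk O (aeval t p)) := by
      have := aeval_algHom_apply ((Algebra.lmul S (S[X] ⧸ O)).comp (Ideal.Quotient.mkₐ S O)) t p
      exact this
    rw [h2] at h1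
    rw [← Ideal.Quotient.eq_zero_iff_mem]
    simpa using h1
  obtain ⟨g, hg⟩ := X_sub_C_dvd_sub_C_eval (a := (-1 : S)) (p := p)
  refine ⟨(-1) ^ p.natDegree * p.eval (-1), ?_, fun a ha => ?_⟩
  · rw [← Ideal.Quotient.eq_zero_iff_mem, map_sub, map_mul, map_one, sub_eq_zero, eval_eq_sum_range,
      Finset.sum_range_succ, hp.coeff_natDegree, map_add, map_sum, Finset.sum_eq_zero]
    · rw [zero_add, one_mul, ← map_mul, ← mul_pow]; simp
    · intro k hk
      rw [Ideal.Quotient.eq_zero_iff_mem]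
      exact Ideal.mul_mem_right _ _ (Ideal.pow_le_self
        (Nat.sub_pos_of_lt (Finset.mem_range.1 hk)).ne' (hpI k))
  · have h1 : C (p.eval (-1)) = aeval t p - r * aeval t g := by
      have := congrArg (aeval t) hg
      rw [map_sub, map_mul, map_sub, aeval_C, aeval_X, aeval_C] at this
      simp only [algebraMap_eq] at this
      have h1 : (C (-1 : S) : S[X]) = -1 := by simp
      rw [ht, h1] at this
      rw [ht]
      linear_combination -this
    rw [C_mul, C_mul, h1]
    have h2 : C ((-1) ^ p.natDegree) * (aeval t p - r * aeval t g) * C a =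
      (C ((-1) ^ p.natDegree) * C a) * aeval t p - (C ((-1) ^ p.natDegree) * aeval t g) * (r * C a) := by ring
    rw [h2]
    exact sub_mem (Ideal.mul_mem_left _ _ hpO) (Ideal.mul_mem_left _ _ (hrO a ha))

/-- The shifted polynomial vector `q'(X + W) + z(X)` joining `q' + z` to the leading coefficient
of `q'`. -/
lemma exists_polynomial_join {B : Type*} [CommRing B] (J : Ideal B) (hJ : J.FG) {m E : ℕ}
    (e : Matrix (Fin m) (Fin m) B)
    (c : Fin m → B) (q' z : Fin m → B[X]) (hc : Unimod c) (hE0 : 0 < E)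
    (hE : ∀ i, (q' i).natDegree ≤ E)
    (hEc : ∀ i, (q' i).coeff E = c i) (hq' : e.map C *ᵥ q' = q') (hz : e.map C *ᵥ z = z)
    (hzJ : ∀ i, z i ∈ (J.map C) ^ 2) (hJq : J.map C ≤ Ideal.span (Set.range (q' + z))) :
    ∃ p : Fin m → B[X][X], (e.map C).map C *ᵥ p = p ∧ (∀ i, (p i).natDegree ≤ E) ∧
      (∀ i, (p i).coeff 0 = (q' + z) i) ∧ (∀ i, (p i).coeff E = C (c i)) ∧
      ∃ u, u - 1 ∈ J.map (C : B →+* B[X]) ∧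
        ∀ a ∈ J.map C, C (u * a) ∈ Ideal.span (Set.range p) := by
  let τ : B[X] →+* B[X][X] := (taylorAlgHom (X : B[X])).toRingHom.comp (mapRingHom C)
  have hτ : ∀ g, τ g = taylor X (g.map C) := fun g => rfl
  have hτC : τ.comp C = (C : B[X] →+* B[X][X]).comp C := by
    ext1 b; simp [hτ]
  have hτd : ∀ g : B[X], (τ g).natDegree ≤ g.natDegree := by
    intro g; rw [hτ, natDegree_taylor]; exact natDegree_map_le
  have hτ0 : ∀ g : B[X], (τ g).coeff 0 = g := by
    intro g; rw [hτ, taylor_coeff_zero, eval_map]; exact eval₂_C_X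
  have hτE : ∀ g : B[X], g.natDegree ≤ E → (τ g).coeff E = C (g.coeff E) := by
    intro g hg
    have hd : (g.map (C : B →+* B[X])).natDegree = g.natDegree :=
      natDegree_map_eq_of_injective C_injective g
    rcases hg.lt_or_eq with hlt | rfl
    · rw [coeff_eq_zero_of_natDegree_lt hlt, C_0,
        coeff_eq_zero_of_natDegree_lt ((hτd g).trans_lt hlt)]
    · rw [hτ, ← hd, coeff_taylor_natDegree, leadingCoeff, hd, coeff_map]
  have heτ : ∀ v : Fin m → B[X], e.map C *ᵥ v = v → (e.map C).map C *ᵥ (τ ∘ v) = τ ∘ v := by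
    intro v hv
    have : (e.map C).map C = (e.map C).map τ := by
      ext1 i j; exact (congrArg (fun f : B →+* B[X][X] => f (e i j)) hτC).symm
    ext1 i
    rw [this, ← RingHom.map_mulVec, hv]; rfl
  have heC : (e.map C).map C *ᵥ (C ∘ z) = C ∘ z := by
    ext1 i
    rw [← RingHom.map_mulVec, hz]; rfl
  set p : Fin m → B[X][X] := τ ∘ q' + C ∘ z with hp
  have hpE : ∀ i, (p i).natDegree ≤ E := fun i =>
    natDegree_add_le_of_degree_le ((hτd _).trans (hE i)) ((natDegree_C _).le.trans (Nat.zero_le _))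
  have hpc : ∀ i, (p i).coeff E = C (c i) := by
    intro i
    have : (p i).coeff E = (τ (q' i)).coeff E + (C (z i)).coeff E := coeff_add _ _ _
    rw [this, hτE _ (hE i), hEc, coeff_C_of_ne_zero hE0.ne', add_zero]
  refine ⟨p, ?_, hpE, ?_, hpc, ?_⟩
  · rw [hp, mulVec_add, heτ q' hq', heC]
  · intro i
    have : (p i).coeff 0 = (τ (q' i)).coeff 0 + (C (z i)).coeff 0 := coeff_add _ _ _
    rw [this, hτ0, coeff_C_zero]; rfl
  · obtain ⟨r, hr⟩ := hc
    refine exists_mul_mem_of_le_sup_sq _ (hJ.map _) _ (f := (C ∘ C ∘ r) ⬝ᵥ p) ?_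
      ((mem_span_range_iff_dotProduct _ _).2 ⟨_, rfl⟩) ?_
    · refine monic_of_natDegree_le_of_coeff_eq_one E ?_ ?_
      · exact natDegree_sum_le_of_forall_le _ _ fun i _ =>
          (natDegree_C_mul_le _ _).trans (hpE i)
      · rw [dotProduct, finsetSum_coeff]
        simp only [Function.comp_apply, coeff_C_mul, hpc, ← C_mul]
        rw [← map_sum, ← C_1, ← hr]; rfl
    · rw [Ideal.map_map, Ideal.map_le_iff_le_comap]
      intro a ha
      rw [Ideal.mem_comap, ← hτC]
      obtain ⟨ρ, hρ⟩ := (mem_span_range_iff_dotProduct _ _).1 (hJq (Ideal.mem_map_of_mem C ha))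
      rw [RingHom.comp_apply, ← hρ, RingHom.map_dotProduct]
      have hz1 : ∀ i, τ (z i) ∈ (Ideal.map (τ.comp C) J) ^ 2 := by
        intro i
        have := Ideal.mem_map_of_mem τ (hzJ i)
        rwa [Ideal.map_pow, Ideal.map_map] at this
      have hz2 : ∀ i, C (z i) ∈ (Ideal.map (τ.comp C) J) ^ 2 := by
        intro i
        have := Ideal.mem_map_of_mem C (hzJ i)
        rwa [Ideal.map_pow, Ideal.map_map, ← hτC] at this
      refine sum_mem fun i _ => Ideal.mul_mem_left _ _ ?_
      have : (τ ∘ (q' + z)) i = p i + (τ (z i) - C (z i)) := by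
        rw [hp]; simp only [Function.comp_apply, Pi.add_apply, map_add]; ring
      rw [this]
      exact add_mem (Ideal.mem_sup_left (Ideal.subset_span ⟨i, rfl⟩))
        (Ideal.mem_sup_right (sub_mem (hz1 i) (hz2 i)))

end Norm

section ClearDenominators

open Matrix Polynomial

lemma exists_lift_of_finite {R R' ι : Type*} [CommRing R] [CommRing R'] [Algebra R R'] [Finite ι]
    (M : Submonoid R) [IsLocalization M R'] (f : ι → R') :
    ∃ s ∈ M, ∃ g : ι → R, ∀ i, algebraMap R R' (g i) = algebraMap R R' s * f i := by
  obtain ⟨s, hs⟩ := IsLocalization.exist_integer_multiples_of_finite M f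
  choose g hg using hs
  exact ⟨s, s.2, g, fun i => by rw [hg, Algebra.smul_def]⟩

lemma exists_mul_eq_of_finite {R ι : Type*} (R' : Type*) [CommRing R] [CommRing R'] [Algebra R R']
    [Finite ι] (M : Submonoid R) [IsLocalization M R'] (f g : ι → R)
    (h : ∀ i, algebraMap R R' (f i) = algebraMap R R' (g i)) :
    ∃ s ∈ M, ∀ i, s * f i = s * g i := by
  classical
  cases nonempty_fintype ι
  have h1 : ∀ i, ∃ s : M, s * f i = s * g i := fun i => (IsLocalization.eq_iff_exists M R').1 (h i)
  choose s hs using h1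
  refine ⟨∏ i, (s i : R), prod_mem fun i _ => (s i).2, fun i => ?_⟩
  rw [← Finset.prod_erase_mul _ _ (Finset.mem_univ i), mul_assoc, hs, mul_assoc]

attribute [local instance] Polynomial.algebra Polynomial.isLocalization

/-- Clearing denominators in `exists_unimod_of_polynomial`. -/
theorem exists_unimod_of_isLocalization {R R' : Type*} [CommRing R] [CommRing R'] [Algebra R R']
    (M : Submonoid R) [IsLocalization M R'] (𝔧 : Ideal R) (hfg : 𝔧.FG) (hM : ∀ s ∈ M, s - 1 ∈ 𝔧)
    {m E : ℕ} (e : Matrix (Fin m) (Fin m) R) (he : e * e = e) (hrk : ∀ p, 2 ≤ rkAt p e)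
    (q : Fin m → R) (hq : e *ᵥ q = q) (hjq : 𝔧 ≤ Ideal.span (Set.range q))
    (y' : Fin m → R'[X]) (hy' : (e.map (algebraMap R R')).map C *ᵥ y' = y')
    (hE : ∀ i, (y' i).natDegree ≤ E) (h0 : ∀ i, (y' i).coeff 0 = algebraMap R R' (q i))
    (hc : Unimod fun i => (y' i).coeff E) (u' : R') (hu' : u' - 1 ∈ 𝔧.map (algebraMap R R'))
    (huO : ∀ a ∈ 𝔧.map (algebraMap R R'), C (u' * a) ∈ Ideal.span (Set.range y')) :
    ∃ v, e *ᵥ v = v ∧ Unimod v := by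
  have hmap : ∀ p : R[X], algebraMap R[X] R'[X] p = p.map (algebraMap R R') := fun p => rfl
  have hmapC : ∀ a : R, (C a).map (algebraMap R R') = C (algebraMap R R' a) := fun a => map_C _
  -- lift the polynomial vector
  obtain ⟨s₁, hs₁, g, hg⟩ := exists_lift_of_finite M
    fun ik : Fin m × Fin (E + 1) => (y' ik.1).coeff ik.2
  obtain ⟨y₁, hy₁, hy₁E⟩ : ∃ y₁ : Fin m → R[X],
      (∀ i, (y₁ i).map (algebraMap R R') = C (algebraMap R R' s₁) * y' i) ∧
      ∀ i, (y₁ i).natDegree ≤ E := by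
    refine ⟨fun i => ∑ k : Fin (E + 1), monomial k (g (i, k)), fun i => ?_, fun i => ?_⟩
    · rw [Polynomial.map_sum]
      simp only [map_monomial, hg, ← C_mul_monomial]
      rw [← Finset.mul_sum, Fin.sum_univ_eq_sum_range (fun k => monomial k ((y' i).coeff k)),
        ← as_sum_range' _ _ (Nat.lt_succ_of_le (hE i))]
    · exact natDegree_sum_le_of_forall_le _ _ fun k _ =>
        (natDegree_monomial_le _).trans (Nat.le_of_lt_succ k.2)
  obtain ⟨_, ⟨s₂, hs₂, rfl⟩, h₂⟩ := exists_mul_eq_of_finite R'[X] (M.map C) (e.map C *ᵥ y₁) y₁ (by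
    intro i
    have hy₁' : algebraMap R[X] R'[X] ∘ y₁ = C (algebraMap R R' s₁) • y' := funext hy₁
    have heC : (e.map C).map (algebraMap R[X] R'[X]) = (e.map (algebraMap R R')).map C := by
      ext1 i j; exact hmapC _
    rw [RingHom.map_mulVec, hy₁', heC, mulVec_smul, hy', ← hy₁']; rfl)
  obtain ⟨s₃, hs₃, h₃⟩ := exists_mul_eq_of_finite R' M (fun i => (y₁ i).coeff 0)
    (fun i => s₁ * q i) (by
      intro i
      rw [← coeff_map, hy₁, coeff_C_mul, h0, map_mul])
  set u := s₁ * (s₂ * s₃) with hu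
  have huM : u ∈ M := mul_mem hs₁ (mul_mem hs₂ hs₃)
  set y : Fin m → R[X] := C (s₃ * s₂) • y₁ with hy
  have hyE : ∀ i, (y i).natDegree ≤ E := fun i => (natDegree_C_mul_le _ _).trans (hy₁E i)
  have hymap : ∀ i, (y i).map (algebraMap R R') = C (algebraMap R R' u) * y' i := by
    intro i
    have : y i = C (s₃ * s₂) * y₁ i := rfl
    rw [this, Polynomial.map_mul, hy₁, hmapC, ← mul_assoc, ← C_mul, ← map_mul, hu]
    congr 3; ring
  have hey : e.map C *ᵥ y = y := by
    rw [hy, mulVec_smul, C_mul, mul_smul, mul_smul]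
    congr 1
    exact funext h₂
  have hy0 : ∀ i, (y i).coeff 0 = u * q i := by
    intro i
    have : y i = C (s₃ * s₂) * y₁ i := rfl
    rw [this, coeff_C_mul, mul_comm s₃, mul_assoc, h₃, hu]; ring
  -- lift the functional
  obtain ⟨ψ', hψ'⟩ := hc
  obtain ⟨s₄, hs₄, ψ₁, hψ₁⟩ := exists_lift_of_finite M ψ'
  obtain ⟨s₅, hs₅, h₅⟩ := exists_mul_eq_of_finite (ι := Unit) R' M
    (fun _ => ψ₁ ⬝ᵥ fun i => (y i).coeff E) (fun _ => s₄ * u) (by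
      rintro ⟨⟩
      have h1 : algebraMap R R' ∘ ψ₁ = algebraMap R R' s₄ • ψ' := funext hψ₁
      have h2 : (algebraMap R R' ∘ fun i => (y i).coeff E) =
          algebraMap R R' u • fun i => (y' i).coeff E := by
        ext1 i
        rw [Function.comp_apply, ← coeff_map, hymap, coeff_C_mul]; rfl
      rw [RingHom.map_dotProduct, h1, h2, smul_dotProduct, dotProduct_smul, hψ', smul_eq_mul,
        smul_eq_mul, mul_one, ← map_mul])
  -- lift the multiplier
  obtain ⟨⟨⟨x, hx⟩, ⟨s₆, hs₆⟩⟩, h₆⟩ := (IsLocalization.mem_map_algebraMap_iff M R').1 hu'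
  replace h₆ : (u' - 1) * algebraMap R R' s₆ = algebraMap R R' x := h₆
  set w := s₆ + x with hw
  obtain ⟨G, hG⟩ := hfg
  have h7 : ∀ a : G, ∃ ρ, ρ ⬝ᵥ y' = C (u' * algebraMap R R' a) := fun a =>
    (mem_span_range_iff_dotProduct _ _).1 (huO _ (Ideal.mem_map_of_mem _
      (hG ▸ Ideal.subset_span a.2)))
  choose ρ hρ using h7
  obtain ⟨_, ⟨s₇, hs₇, rfl⟩, ρ₁, hρ₁⟩ := exists_lift_of_finite (M.map C)
    fun ai : G × Fin m => ρ ai.1 ai.2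
  obtain ⟨_, ⟨s₈, hs₈, rfl⟩, h₈⟩ := exists_mul_eq_of_finite R'[X] (M.map C)
    (fun a : G => C s₆ * ((fun i => ρ₁ (a, i)) ⬝ᵥ y)) (fun a => C (s₇ * u * w * a)) (by
      intro a
      have h1 : (algebraMap R[X] R'[X] ∘ fun i => ρ₁ (a, i)) =
        C (algebraMap R R' s₇) • ρ a := by
        ext1 i
        exact (hρ₁ (a, i)).trans (by rw [hmap]; exact congrArg (· * ρ a i) (hmapC s₇))
      have h2 : algebraMap R[X] R'[X] ∘ y = C (algebraMap R R' u) • y' := funext hymap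
      rw [map_mul, RingHom.map_dotProduct, h1, h2, smul_dotProduct, dotProduct_smul, hρ, hmap, hmap,
        hmapC, hmapC, smul_eq_mul, smul_eq_mul, ← C_mul, ← C_mul, ← C_mul]
      congr 1
      simp only [map_mul, hw, map_add]
      linear_combination algebraMap R R' s₇ * algebraMap R R' u * algebraMap R R' a * h₆)
  set u₄ := s₈ * (s₇ * u * w) with hu₄
  have hu₄O : ∀ a ∈ 𝔧, C (u₄ * a) ∈ Ideal.span (Set.range y) := by
    have hle : 𝔧 ≤ Ideal.comap (C : R →+* R[X]) (Submodule.comap (LinearMap.mulLeft R[X] (C u₄))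
        (Ideal.span (Set.range y)) : Ideal R[X]) := by
      rw [← hG, Ideal.span_le]
      intro a ha
      change C u₄ * C a ∈ Ideal.span (Set.range y)
      rw [hu₄, ← C_mul, mul_assoc, C_mul, ← h₈ ⟨a, ha⟩]
      exact Ideal.mul_mem_left _ _ (Ideal.mul_mem_left _ _
        ((mem_span_range_iff_dotProduct _ _).2 ⟨_, rfl⟩))
    intro a ha
    rw [C_mul]
    exact hle ha
  have hone : ∀ s, s - 1 ∈ 𝔧 ↔ Ideal.Quotient.mk 𝔧 s = 1 := by
    intro s
    rw [← Ideal.Quotient.eq_zero_iff_mem, map_sub, map_one, sub_eq_zero]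
  have hM1 : ∀ s ∈ M, Ideal.Quotient.mk 𝔧 s = 1 := fun s hs => (hone s).1 (hM s hs)
  have hw1 : Ideal.Quotient.mk 𝔧 w = 1 := by
    rw [hw, map_add, hM1 _ hs₆, Ideal.Quotient.eq_zero_iff_mem.2 hx, add_zero]
  have hj : u * (s₅ * (s₄ * u)) * u₄ - 1 ∈ 𝔧 := by
    rw [hone]
    simp only [hu₄, map_mul, hM1 _ huM, hM1 _ hs₅, hM1 _ hs₄, hM1 _ hs₇, hM1 _ hs₈, hw1, mul_one]
  refine exists_unimod_of_polynomial (E := E) (k := 1) e he hrk u (s₅ * (s₄ * u)) u₄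
    (u * (s₅ * (s₄ * u)) * u₄ - 1) (by ring) q hq (hjq hj) y hey hyE hy0 (s₅ • ψ₁) ?_ ?_
  · rw [smul_dotProduct]; exact h₅ ()
  · rw [pow_one]; exact hu₄O _ hj

end ClearDenominators

section LocalizedAtOneAdd

open Matrix Polynomial

lemma Unimod.units_mulVec {R : Type*} [CommRing R] {m : ℕ} {v : Fin m → R} (hv : Unimod v)
    (δ : (Matrix (Fin m) (Fin m) R)ˣ) : Unimod (δ.val *ᵥ v) := by
  obtain ⟨r, hr⟩ := hv
  refine ⟨r ᵥ* δ⁻¹.val, ?_⟩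
  rw [← dotProduct_mulVec, mulVec_mulVec, Units.inv_mul, one_mulVec, hr]

lemma span_range_mulVec_le {R : Type*} [CommRing R] {m k : ℕ} (δ : Matrix (Fin m) (Fin k) R)
    (v : Fin k → R) : Ideal.span (Set.range (δ *ᵥ v)) ≤ Ideal.span (Set.range v) := by
  rw [Ideal.span_le]
  rintro _ ⟨i, rfl⟩
  exact (mem_span_range_iff_dotProduct _ _).2 ⟨_, rfl⟩

lemma span_range_units_mulVec {R : Type*} [CommRing R] {m : ℕ}
    (δ : (Matrix (Fin m) (Fin m) R)ˣ) (v : Fin m → R) :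
    Ideal.span (Set.range (δ.val *ᵥ v)) = Ideal.span (Set.range v) := by
  refine le_antisymm (span_range_mulVec_le _ _) ?_
  conv_lhs => rw [show v = δ⁻¹.val *ᵥ (δ.val *ᵥ v) by rw [mulVec_mulVec, Units.inv_mul, one_mulVec]]
  exact span_range_mulVec_le _ _

/-- The multiplicative set `1 + J`. -/
def Ideal.oneAdd {A : Type*} [CommRing A] (J : Ideal A) : Submonoid A where
  carrier := {s | s - 1 ∈ J}
  one_mem' := by simp
  mul_mem' {a b} ha hb := by
    have : a * b - 1 = a * (b - 1) + (a - 1) := by ring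
    change a * b - 1 ∈ J
    rw [this]; exact J.add_mem (J.mul_mem_left _ hb) ha

lemma Ideal.map_le_jacobson_oneAdd {A : Type*} [CommRing A] (J : Ideal A) (B : Type*) [CommRing B]
    [Algebra A B] [IsLocalization J.oneAdd B] : J.map (algebraMap A B) ≤ Ring.jacobson B := by
  rw [Ring.jacobson_eq_sInf_isMaximal, le_sInf_iff]
  intro 𝔪 h𝔪
  have : 𝔪.IsMaximal := h𝔪
  by_contra hlt
  rw [Ideal.map_le_iff_le_comap] at hlt
  have h1 : (𝔪 ⊔ J.map (algebraMap A B)) = ⊤ := by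
    refine this.1.2 _ (lt_of_le_of_ne le_sup_left fun h => hlt ?_)
    rw [← Ideal.map_le_iff_le_comap, h]; exact le_sup_right
  obtain ⟨x, hx, y, hy, hxy⟩ := Submodule.mem_sup.1 ((Ideal.eq_top_iff_one _).1 h1)
  obtain ⟨⟨⟨j, hj⟩, ⟨s, hs⟩⟩, h2⟩ := (IsLocalization.mem_map_algebraMap_iff J.oneAdd B).1 hy
  replace h2 : y * algebraMap A B s = algebraMap A B j := h2
  have h3 : s - j ∈ J.oneAdd := by
    change s - j - 1 ∈ J
    rw [show s - j - 1 = s - 1 - j by ring]; exact J.sub_mem hs hj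
  refine this.ne_top (Ideal.eq_top_of_isUnit_mem _ (?_ : algebraMap A B (s - j) ∈ 𝔪)
    (IsLocalization.map_units B ⟨_, h3⟩))
  have h4 : algebraMap A B (s - j) = x * algebraMap A B s := by
    rw [map_sub, ← h2]; linear_combination -(algebraMap A B s) * hxy
  rw [h4]; exact Ideal.mul_mem_right _ _ hx

lemma ringKrullDim_quotient_map_oneAdd_le {A : Type*} [CommRing A] (J : Ideal A) (B : Type*)
    [CommRing B] [Algebra A B] [IsLocalization J.oneAdd B] :
    ringKrullDim (B ⧸ J.map (algebraMap A B)) ≤ ringKrullDim (A ⧸ J) := by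
  refine ringKrullDim_le_of_surjective
    (Ideal.quotientMap (J.map (algebraMap A B)) (algebraMap A B) Ideal.le_comap_map) ?_
  intro b
  obtain ⟨b, rfl⟩ := Ideal.Quotient.mk_surjective b
  obtain ⟨⟨a, ⟨s, hs⟩⟩, h⟩ := IsLocalization.surj J.oneAdd b
  refine ⟨Ideal.Quotient.mk _ a, ?_⟩
  rw [Ideal.quotientMap_mk, Ideal.Quotient.eq]
  have h' : b * algebraMap A B s = algebraMap A B a := h
  rw [show algebraMap A B a - b = b * algebraMap A B (s - 1) by
    rw [← h', map_sub, map_one]; ring]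
  exact Ideal.mul_mem_left _ _ (Ideal.mem_map_of_mem _ hs)

attribute [local instance] Polynomial.algebra Polynomial.isLocalization

theorem exists_unimod_of_extended {A B : Type*} [CommRing A] [IsNoetherianRing A] [CommRing B]
    [Algebra A B] {m D N : ℕ} (e : Matrix (Fin m) (Fin m) A[X]) (he : e * e = e)
    (hrk : ∀ p, N ≤ rkAt p e) (hDN : D + 1 < N) (q : Fin m → A[X]) (hq : e *ᵥ q = q)
    (f : A[X]) (hf : f.Monic) (hfq : f ∈ Ideal.span (Set.range q))
    (J : Ideal A) (hJ : J = (Ideal.span (Set.range q)).comap C) (hD : ringKrullDim (A ⧸ J) ≤ D)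
    [IsLocalization J.oneAdd B] (γ : (Matrix (Fin m) (Fin m) B[X])ˣ)
    (hγ : γ.val * ((e.map (evalRingHom 0)).map (algebraMap A B)).map C =
      e.map (mapRingHom (algebraMap A B)) * γ.val) :
    ∃ v, e *ᵥ v = v ∧ Unimod v := by
  have hBN : IsNoetherianRing B := IsLocalization.isNoetherianRing J.oneAdd B inferInstance
  set e0 := (e.map (evalRingHom 0)).map (algebraMap A B) with he0
  have hz : (e.map (evalRingHom (0 : A))) * (e.map (evalRingHom 0)) = e.map (evalRingHom 0) := by
    rw [← Matrix.map_mul, he]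
  have he0i : e0 * e0 = e0 := by rw [he0, ← Matrix.map_mul, hz]
  have hrk0 : ∀ p, N ≤ rkAt p e0 := fun p => by
    rw [he0, rkAt_map _ _ _ hz, rkAt_map _ _ _ he]; exact hrk _
  set φ : A[X] →+* B[X] := mapRingHom (algebraMap A B) with hφ
  have hγ' : γ⁻¹.val * e.map φ = e0.map C * γ⁻¹.val := by
    calc γ⁻¹.val * e.map φ = γ⁻¹.val * (e.map φ * γ.val) * γ⁻¹.val := by
          rw [Matrix.mul_assoc, Matrix.mul_assoc, Units.mul_inv, mul_one]
      _ = e0.map C * γ⁻¹.val := by rw [← hγ, ← Matrix.mul_assoc γ⁻¹.val, Units.inv_mul, one_mul]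
  have hqφ : e.map φ *ᵥ (φ ∘ q) = φ ∘ q := by
    funext i
    rw [← RingHom.map_mulVec, hq]; rfl
  have hspan : Ideal.span (Set.range (φ ∘ q)) = (Ideal.span (Set.range q)).map φ := by
    rw [Ideal.map_span, Set.range_comp]
  set q0 := γ⁻¹.val *ᵥ (φ ∘ q) with hq0
  have hq0e : e0.map C *ᵥ q0 = q0 := by
    rw [hq0, mulVec_mulVec, ← hγ', ← mulVec_mulVec, hqφ]
  have hq0s : Ideal.span (Set.range q0) = (Ideal.span (Set.range q)).map φ := by
    rw [hq0, span_range_units_mulVec, hspan]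
  obtain ⟨ε, c, q', z, E, hεe, hc, hεq, hE0, hE, hEc, hq', hz', hzJ⟩ :=
    exists_unit_unimod_leadingCoeff (J.map (algebraMap A B)) (J.map_le_jacobson_oneAdd B)
      ((ringKrullDim_quotient_map_oneAdd_le J B).trans hD) hDN e0 he0i hrk0 q0 hq0e
      (φ f) (hf.map _) (by rw [hq0s]; exact Ideal.mem_map_of_mem _ hfq)
  have hJle : J.map C ≤ Ideal.span (Set.range q) := by
    rw [Ideal.map_le_iff_le_comap, hJ]
  have hJB : (J.map (algebraMap A B)).map C = (J.map C).map φ := by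
    rw [Ideal.map_map, Ideal.map_map]; congr 1; ext1 a; simp [hφ]
  have hJfg : (J.map (algebraMap A B)).FG := IsNoetherian.noetherian _
  obtain ⟨p, hpe, hpE, hp0, hpc, u, hu, huO⟩ := exists_polynomial_join (J.map (algebraMap A B)) hJfg
    e0 c q' z hc hE0 hE hEc hq' hz' hzJ (by
      rw [← hεq, span_range_units_mulVec, hq0s, hJB]; exact Ideal.map_mono hJle)
  have hε' : ε⁻¹.val * e0.map C = e0.map C * ε⁻¹.val := by
    calc ε⁻¹.val * e0.map C = ε⁻¹.val * (e0.map C * ε.val) * ε⁻¹.val := by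
          rw [Matrix.mul_assoc, Matrix.mul_assoc, Units.mul_inv, mul_one]
      _ = e0.map C * ε⁻¹.val := by rw [← hεe, ← Matrix.mul_assoc ε⁻¹.val, Units.inv_mul, one_mul]
  set δ := γ * ε⁻¹ with hδ
  have hδe : δ.val * e0.map C = e.map φ * δ.val := by
    rw [hδ, Units.val_mul, Matrix.mul_assoc, hε', ← Matrix.mul_assoc, hγ, Matrix.mul_assoc]
  have hδq : δ.val *ᵥ (q' + z) = φ ∘ q := by
    rw [← hεq, hδ, Units.val_mul, mulVec_mulVec, Matrix.mul_assoc, Units.inv_mul, mul_one, hq0,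
      mulVec_mulVec, Units.mul_inv, one_mulVec]
  have hcoeff : ∀ k i, (((δ.val.map C) *ᵥ p) i).coeff k = (δ.val *ᵥ fun j => (p j).coeff k) i := by
    intro k i
    simp [mulVec, dotProduct, finsetSum_coeff]
  let δC : (Matrix (Fin m) (Fin m) B[X][X])ˣ := Units.map (RingHom.mapMatrix (m := Fin m) (C : B[X] →+* B[X][X])).toMonoidHom δ
  have hspanp : Ideal.span (Set.range ((δ.val.map C) *ᵥ p)) = Ideal.span (Set.range p) :=
    span_range_units_mulVec δC p
  refine exists_unimod_of_isLocalization (R' := B[X]) (J.oneAdd.map C) (J.map C)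
    (IsNoetherian.noetherian _) ?_ (E := E) e he (fun p => (by omega : 2 ≤ N).trans (hrk p)) q hq
    hJle ((δ.val.map C) *ᵥ p) ?_ ?_ ?_ ?_ u ?_ ?_
  · rintro _ ⟨s, hs, rfl⟩
    rw [← C_1, ← C_sub]; exact Ideal.mem_map_of_mem _ hs
  · change (e.map φ).map C *ᵥ _ = _
    rw [mulVec_mulVec, ← Matrix.map_mul, ← hδe, Matrix.map_mul, ← mulVec_mulVec, hpe]
  · intro i
    exact natDegree_sum_le_of_forall_le Finset.univ (fun k => C (δ.val i k) * p k) fun k _ =>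
      (natDegree_C_mul_le _ _).trans (hpE k)
  · intro i
    rw [hcoeff]
    simp only [hp0]
    exact congrFun hδq i
  · have h1 : (fun i => (((δ.val.map C) *ᵥ p) i).coeff E) = δ.val *ᵥ fun i => C (c i) := by
      funext i
      rw [hcoeff]; simp only [hpc]
    rw [h1]
    refine Unimod.units_mulVec ?_ δ
    obtain ⟨r, hr⟩ := hc
    exact ⟨C ∘ r, by rw [← C_1, ← hr, RingHom.map_dotProduct]; rfl⟩
  · change u - 1 ∈ (J.map C).map φ
    rwa [← hJB]
  · intro a ha
    rw [hspanp]
    exact huO a (by rw [hJB]; exact ha)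

end LocalizedAtOneAdd

section LocallyFree

open Matrix Polynomial

/-- Idempotents with isomorphic images become conjugate after stabilization. -/
lemma exists_conj_fromBlocks {R m r : Type*} [CommRing R] [Fintype m] [DecidableEq m] [Fintype r]
    [DecidableEq r] {X X' : Matrix m r R} {Y Y' : Matrix r m R} (h : Y * X = 1)
    (h' : Y' * X' = 1) :
    ∃ γ : (Matrix (m ⊕ m) (m ⊕ m) R)ˣ,
      γ.val * fromBlocks (X' * Y') 0 0 0 = fromBlocks (X * Y) 0 0 0 * γ.val := by
  have a1 : X * Y' * (X' * Y') = X * Y' := by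
    rw [Matrix.mul_assoc, ← Matrix.mul_assoc Y', h', Matrix.one_mul]
  have a2 : X * Y' * (X' * Y) = X * Y := by
    rw [Matrix.mul_assoc, ← Matrix.mul_assoc Y', h', Matrix.one_mul]
  have a3 : X' * Y * (X * Y) = X' * Y := by
    rw [Matrix.mul_assoc, ← Matrix.mul_assoc Y, h, Matrix.one_mul]
  have a4 : X' * Y * (X * Y') = X' * Y' := by
    rw [Matrix.mul_assoc, ← Matrix.mul_assoc Y, h, Matrix.one_mul]
  have a5 : X * Y * (X * Y) = X * Y := by
    rw [Matrix.mul_assoc, ← Matrix.mul_assoc Y, h, Matrix.one_mul]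
  have a6 : X' * Y' * (X' * Y') = X' * Y' := by
    rw [Matrix.mul_assoc, ← Matrix.mul_assoc Y', h', Matrix.one_mul]
  have a7 : X * Y * (X * Y') = X * Y' := by
    rw [Matrix.mul_assoc, ← Matrix.mul_assoc Y, h, Matrix.one_mul]
  have a8 : X' * Y' * (X' * Y) = X' * Y := by
    rw [Matrix.mul_assoc, ← Matrix.mul_assoc Y', h', Matrix.one_mul]
  refine ⟨⟨fromBlocks (X * Y') (1 - X * Y) (1 - X' * Y') (X' * Y),
    fromBlocks (X' * Y) (1 - X' * Y') (1 - X * Y) (X * Y'), ?_, ?_⟩, ?_⟩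
  · rw [fromBlocks_multiply, ← fromBlocks_one]
    simp only [mul_sub, sub_mul, one_mul, mul_one, a1, a2, a3, a4, a5, a6, a7, a8]
    congr 1 <;> abel
  · rw [fromBlocks_multiply, ← fromBlocks_one]
    simp only [mul_sub, sub_mul, one_mul, mul_one, a1, a2, a3, a4, a5, a6, a7, a8]
    congr 1 <;> abel
  · simp only [fromBlocks_multiply, mul_sub, sub_mul, one_mul, mul_one, a1, a5, a6, a7, mul_zero,
      zero_mul, add_zero, sub_self]

/-- The image of the idempotent `e` is free after base change along `g`. -/
def FreeOver {R S : Type*} [CommRing R] [CommRing S] {m : ℕ} (e : Matrix (Fin m) (Fin m) R)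
    (g : R →+* S) : Prop :=
  ∃ (r : ℕ) (X : Matrix (Fin m) (Fin r) S) (Y : Matrix (Fin r) (Fin m) S),
    X * Y = e.map g ∧ Y * X = 1

lemma FreeOver.comp {R S T : Type*} [CommRing R] [CommRing S] [CommRing T] {m : ℕ}
    {e : Matrix (Fin m) (Fin m) R} {g : R →+* S} (h : FreeOver e g) (g' : S →+* T) :
    FreeOver e (g'.comp g) := by
  obtain ⟨r, X, Y, h1, h2⟩ := h
  refine ⟨r, X.map g', Y.map g', ?_, ?_⟩
  · rw [← Matrix.map_mul, h1, Matrix.map_map]; rfl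
  · rw [← Matrix.map_mul, h2, Matrix.map_one _ (map_zero _) (map_one _)]

lemma FreeOver.map_iff {R S T : Type*} [CommRing R] [CommRing S] [CommRing T] {m : ℕ}
    {e : Matrix (Fin m) (Fin m) R} {g : R →+* S} {g' : S →+* T} :
    FreeOver (e.map g) g' ↔ FreeOver e (g'.comp g) := by
  unfold FreeOver
  rw [Matrix.map_map]; rfl

lemma exists_conj_of_forall_maximal {G : Type*} [CommRing G] {m : ℕ}
    (e : Matrix (Fin m) (Fin m) G[X])
    (h : ∀ (𝔪 : Ideal G) [𝔪.IsMaximal],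
      FreeOver e (mapRingHom (algebraMap G (Localization.AtPrime 𝔪)))) :
    ∃ γ : (Matrix (Fin m ⊕ Fin m) (Fin m ⊕ Fin m) G[X])ˣ,
      γ.val * (fromBlocks (e.map (evalZeroHom G)) 0 0 0) = fromBlocks e 0 0 0 * γ.val := by
  have hmap : ∀ {S T : Type _} [CommRing S] [CommRing T] (g : S →+* T)
      (x : Matrix (Fin m) (Fin m) S), (fromBlocks x 0 0 0 : Matrix (Fin m ⊕ Fin m) (Fin m ⊕ Fin m) S).map
        g = fromBlocks (x.map g) 0 0 0 := by
    intro S T _ _ g x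
    rw [fromBlocks_map, Matrix.map_zero _ (map_zero g)]
  obtain ⟨γ, hγ, -⟩ := exists_pairRel_of_forall_maximal
    ((fromBlocks e 0 0 0, 0) : Matrix (Fin m ⊕ Fin m) (Fin m ⊕ Fin m) G[X] × (Fin m ⊕ Fin m → G[X]))
    (by
      intro 𝔪 h𝔪
      obtain ⟨r, X, Y, h1, h2⟩ := h 𝔪
      set g := mapRingHom (algebraMap G (Localization.AtPrime 𝔪)) with hg
      set z := evalZeroHom (Localization.AtPrime 𝔪) with hz
      obtain ⟨γ, hγ⟩ := exists_conj_fromBlocks (X := X) (Y := Y) (X' := X.map z) (Y' := Y.map z) h2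
        (by rw [← Matrix.map_mul, h2, Matrix.map_one _ (map_zero _) (map_one _)])
      have hzg : z.comp g = g.comp (evalZeroHom G) := by
        apply Polynomial.ringHom_ext
        · intro a; simp [hz, hg, evalZeroHom]
        · simp [hz, hg, evalZeroHom]
      refine ⟨γ, ?_, ?_⟩
      · rw [← Matrix.map_mul, h1, Matrix.map_map, ← RingHom.coe_comp, hzg] at hγ
        simp only [mapPair]
        rw [hmap, hmap, hmap, Matrix.map_map, ← RingHom.coe_comp]
        exact hγ
      · funext i
        simp [mapPair, mulVec, dotProduct])
  refine ⟨γ, ?_⟩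
  simp only [mapPair, hmap] at hγ
  exact hγ

end LocallyFree

section Integral

open Polynomial

lemma ringKrullDim_le_of_isIntegral {R S : Type*} [CommRing R] [CommRing S] [Algebra R S]
    [Algebra.IsIntegral R S] (h : Function.Injective (algebraMap R S)) :
    ringKrullDim R ≤ ringKrullDim S := by
  have hgu : Algebra.HasGoingUp R S := ⟨fun {q} _ P _ hlt => by
    obtain ⟨Q, hQ, hQp, hc⟩ := Ideal.exists_ideal_over_prime_of_isIntegral q P hlt.le
    exact ⟨Q, hQ, hQp, ⟨hc.symm⟩⟩⟩
  unfold ringKrullDim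
  refine iSup_le fun l => ?_
  obtain ⟨P, -, hP, hc⟩ := Ideal.exists_ideal_over_prime_of_isIntegral l.head.asIdeal (⊥ : Ideal S)
    (by rw [← RingHom.ker_eq_comap_bot, (RingHom.injective_iff_ker_eq_bot _).1 h]; exact bot_le)
  have : P.LiesOver l.head.asIdeal := ⟨hc.symm⟩
  obtain ⟨L, hL, -⟩ := Ideal.exists_ltSeries_of_hasGoingUp l P
  rw [← hL]
  exact le_iSup (fun l : LTSeries (PrimeSpectrum S) => (l.length : WithBot ℕ∞)) L

variable {A : Type*} [CommRing A]

lemma isIntegral_quotient_of_monic_mem {I : Ideal A[X]} {f : A[X]} (hf : f.Monic) (hfI : f ∈ I) :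
    Algebra.IsIntegral A (A[X] ⧸ I) := by
  have h1 : Module.Finite A (A[X] ⧸ Ideal.span {f}) := hf.finite_quotient
  have h2 : Module.Finite A (A[X] ⧸ I) :=
    Module.Finite.of_surjective
      (Ideal.Quotient.factorₐ A ((Ideal.span_singleton_le_iff_mem _).2 hfI)).toLinearMap
      (Ideal.Quotient.factor_surjective ((Ideal.span_singleton_le_iff_mem _).2 hfI))
  exact Algebra.IsIntegral.of_finite _ _

lemma ringKrullDim_quotient_comap_C_le {I : Ideal A[X]} {f : A[X]} (hf : f.Monic) (hfI : f ∈ I) :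
    ringKrullDim (A ⧸ I.comap C) ≤ ringKrullDim (A[X] ⧸ I) := by
  have := isIntegral_quotient_of_monic_mem hf hfI
  algebraize [Ideal.quotientMap I (C : A →+* A[X]) le_rfl]
  have : IsScalarTower A (A ⧸ I.comap C) (A[X] ⧸ I) := IsScalarTower.of_algebraMap_eq fun a => rfl
  have : Algebra.IsIntegral (A ⧸ I.comap C) (A[X] ⧸ I) := Algebra.IsIntegral.tower_top A
  exact ringKrullDim_le_of_isIntegral (Ideal.quotientMap_injective (I := I) (f := C))

lemma sup_comap_C_eq_top {I : Ideal A[X]} {f : A[X]} (hf : f.Monic) (hfI : f ∈ I) {K : Ideal A}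
    (hK : K.map C ⊔ I = ⊤) : K ⊔ I.comap C = ⊤ := by
  by_contra hne
  obtain ⟨𝔪, h𝔪, hle⟩ := Ideal.exists_le_maximal _ hne
  have := isIntegral_quotient_of_monic_mem hf hfI
  obtain ⟨Q, -, hQ, hc⟩ := Ideal.exists_ideal_over_prime_of_isIntegral 𝔪 (⊥ : Ideal (A[X] ⧸ I)) (by
    intro a ha
    exact hle (Ideal.mem_sup_right (Ideal.Quotient.eq_zero_iff_mem (I := I).1 ha)))
  refine hQ.comap (Ideal.Quotient.mk I) |>.ne_top (top_le_iff.1 ?_)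
  rw [← hK]
  refine sup_le ?_ ?_
  · rw [Ideal.map_le_iff_le_comap, Ideal.comap_comap]
    have h1 : Q.comap (algebraMap A (A[X] ⧸ I)) = Q.comap ((Ideal.Quotient.mk I).comp C) := rfl
    rw [← h1, hc]
    exact le_sup_left.trans hle
  · intro x hx
    rw [Ideal.mem_comap, Ideal.Quotient.eq_zero_iff_mem.2 hx]; exact Q.zero_mem

end Integral

section Stabilize

open Matrix Polynomial

/-- The idempotent `e ⊕ 0`. -/
def stabilize {R : Type*} [CommRing R] {m : ℕ} (e : Matrix (Fin m) (Fin m) R) :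
    Matrix (Fin (m + m)) (Fin (m + m)) R :=
  (fromBlocks e 0 0 0).submatrix finSumFinEquiv.symm finSumFinEquiv.symm

variable {R S : Type*} [CommRing R] [CommRing S] {m : ℕ} (e : Matrix (Fin m) (Fin m) R)

lemma stabilize_mul_self (he : e * e = e) : stabilize e * stabilize e = stabilize e := by
  unfold stabilize
  rw [submatrix_mul_equiv, fromBlocks_multiply]
  simp [he]

lemma stabilize_map (g : R →+* S) : (stabilize e).map g = stabilize (e.map g) := by
  unfold stabilize
  rw [← submatrix_map, fromBlocks_map, Matrix.map_zero _ (map_zero g)]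

lemma le_rkAt_stabilize (p : PrimeSpectrum R) : rkAt p e ≤ rkAt p (stabilize e) := by
  have h1 := rkAt_le_of_submatrix p (stabilize e) (Fin.castAdd m)
  have h2 := rkAt_le_of_submatrix p ((stabilize e).submatrix (Fin.castAdd m) id)ᵀ (Fin.castAdd m)
  rw [rkAt_transpose] at h2
  have h3 : ((stabilize e).submatrix (Fin.castAdd m) id)ᵀ.submatrix (Fin.castAdd m) id = eᵀ := by
    ext i j
    simp [stabilize]
  rw [h3, rkAt_transpose] at h2
  exact h2.trans h1

lemma stabilize_mulVec_append_zero {v : Fin m → R} (hv : e *ᵥ v = v) :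
    stabilize e *ᵥ Fin.append v 0 = Fin.append v 0 := by
  have h1 : (Fin.append v 0 : Fin (m + m) → R) = Sum.elim v 0 ∘ finSumFinEquiv.symm := by
    funext i
    refine Fin.addCases (fun i => ?_) (fun i => ?_) i
    · simp
    · rw [Fin.append_right, Function.comp_apply, finSumFinEquiv_symm_apply_natAdd]; rfl
  unfold stabilize
  rw [h1, submatrix_mulVec_equiv, fromBlocks_mulVec]
  congr 1
  simp [hv, Function.comp_assoc]

lemma exists_unimod_of_stabilize
    (h : ∃ v, stabilize e *ᵥ v = v ∧ Unimod v) : ∃ v, e *ᵥ v = v ∧ Unimod v := by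
  obtain ⟨v, hv, r, hr⟩ := h
  unfold stabilize at hv
  set w := v ∘ finSumFinEquiv with hw
  have hv' : v = w ∘ finSumFinEquiv.symm := by rw [hw]; funext i; simp
  rw [hv', submatrix_mulVec_equiv, fromBlocks_mulVec] at hv
  have hv2 : ∀ i, _ := fun i => congrFun hv (finSumFinEquiv i)
  simp only [Function.comp_apply, Equiv.symm_apply_apply, Function.comp_assoc] at hv2
  have hl : ∀ i, (e *ᵥ (w ∘ Sum.inl)) i = w (Sum.inl i) := fun i => by
    simpa [Function.comp_def] using hv2 (Sum.inl i)
  have hr0 : ∀ i, w (Sum.inr i) = 0 := fun i => by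
    simpa [Function.comp_def] using (hv2 (Sum.inr i)).symm
  refine ⟨w ∘ Sum.inl, funext hl, r ∘ finSumFinEquiv ∘ Sum.inl, ?_⟩
  rw [← hr, hv']
  unfold dotProduct
  rw [← finSumFinEquiv.sum_comp, Fintype.sum_sum_type]
  simp only [Function.comp_apply, Equiv.symm_apply_apply, hr0, mul_zero, Finset.sum_const_zero,
    add_zero]

end Stabilize

section Descent

open Matrix Polynomial

theorem exists_unimod_of_freeOver {A : Type*} [CommRing A] [IsNoetherianRing A] {m D N : ℕ}
    (e : Matrix (Fin m) (Fin m) A[X]) (he : e * e = e) (hrk : ∀ p, N ≤ rkAt p e) (hDN : D + 1 < N)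
    (q : Fin m → A[X]) (hq : e *ᵥ q = q) (f : A[X]) (hf : f.Monic)
    (hfq : f ∈ Ideal.span (Set.range q)) (hdim : ringKrullDim (A[X] ⧸ Ideal.span (Set.range q)) ≤ D)
    (K : Ideal A) (hKq : K.map C ⊔ Ideal.span (Set.range q) = ⊤)
    (hK : ∀ (𝔭 : Ideal A) [𝔭.IsPrime], ¬ K ≤ 𝔭 →
      FreeOver e (mapRingHom (algebraMap A (Localization.AtPrime 𝔭)))) :
    ∃ v, e *ᵥ v = v ∧ Unimod v := by
  set J := (Ideal.span (Set.range q)).comap C with hJ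
  let B := Localization J.oneAdd
  have hspan : Ideal.span (Set.range (Fin.append q (0 : Fin m → A[X]))) =
      Ideal.span (Set.range q) := by
    refine le_antisymm (Ideal.span_le.2 ?_) (Ideal.span_le.2 ?_)
    · rintro _ ⟨i, rfl⟩
      refine Fin.addCases (fun i => ?_) (fun i => ?_) i
      · rw [Fin.append_left]; exact Ideal.subset_span ⟨i, rfl⟩
      · rw [Fin.append_right]; exact Ideal.zero_mem _
    · rintro _ ⟨i, rfl⟩
      exact Ideal.subset_span ⟨Fin.castAdd m i, Fin.append_left _ _ i⟩
  obtain ⟨γ, hγ⟩ := exists_conj_of_forall_maximal (e.map (mapRingHom (algebraMap A B))) (by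
    intro 𝔪 h𝔪
    rw [FreeOver.map_iff]
    have h1 : ¬ K ≤ 𝔪.comap (algebraMap A B) := by
      intro hle
      have h2 : J ≤ 𝔪.comap (algebraMap A B) := by
        rw [← Ideal.map_le_iff_le_comap]
        exact (J.map_le_jacobson_oneAdd B).trans (Ring.jacobson_le_of_isMaximal 𝔪)
      refine (h𝔪.isPrime.comap (algebraMap A B)).ne_top (top_le_iff.1 ?_)
      rw [← sup_comap_C_eq_top hf hfq hKq]
      exact sup_le hle h2
    have h3 := (hK _ h1).comp (T := (Localization.AtPrime 𝔪)[X]) (mapRingHom (Localization.localRingHom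
      (𝔪.comap (algebraMap A B)) 𝔪 (algebraMap A B) rfl))
    rw [mapRingHom_comp] at h3 ⊢
    convert h3 using 2
    ext1 a
    exact (Localization.localRingHom_to_map (𝔪.comap (algebraMap A B)) 𝔪 (algebraMap A B) rfl a).symm)
  apply exists_unimod_of_stabilize
  let γ' : (Matrix (Fin (m + m)) (Fin (m + m)) B[X])ˣ :=
    Units.map (reindexAlgEquiv B[X] B[X] finSumFinEquiv).toMonoidHom γ
  refine exists_unimod_of_extended (B := B) (stabilize e) (stabilize_mul_self e he)
    (fun p => (hrk p).trans (le_rkAt_stabilize e p)) hDN (Fin.append q 0)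
    (stabilize_mulVec_append_zero e hq) f hf (hspan ▸ hfq) J (by rw [hspan])
    ((ringKrullDim_quotient_comap_C_le hf hfq).trans hdim) γ' ?_
  have hev : (((e.map (evalRingHom 0)).map (algebraMap A B)).map C) =
      (e.map (mapRingHom (algebraMap A B))).map (evalZeroHom B) := by
    ext1 i j
    simp only [Matrix.map_apply, evalZeroHom, RingHom.comp_apply, coe_evalRingHom, coe_mapRingHom]
    rw [← map_zero (algebraMap A B), eval_map_algebraMap, aeval_algebraMap_apply]
    simp
  have h4 := congrArg (reindexAlgEquiv B[X] B[X] (finSumFinEquiv (m := m) (n := m))) hγ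
  rw [map_mul, map_mul] at h4
  rw [stabilize_map, stabilize_map, stabilize_map, stabilize_map, hev]
  exact h4

end Descent

section FiniteFreeResolution

universe u

/-- `M` has a finite free resolution of length at most `k`, up to a stably free last syzygy. -/
def FFR (S : Type u) [CommRing S] : ℕ → ∀ (M : Type u) [AddCommGroup M] [Module S M], Prop
  | 0, M, _, _ => ∃ a b : ℕ, Nonempty ((M × (Fin a → S)) ≃ₗ[S] (Fin b → S))
  | k + 1, M, _, _ => ∃ (a : ℕ) (π : (Fin a → S) →ₗ[S] M), Function.Surjective π ∧
      FFR S k (LinearMap.ker π)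

variable {S : Type u} [CommRing S] {k : ℕ} {M N M' M'' : Type u} [AddCommGroup M] [Module S M]
  [AddCommGroup N] [Module S N] [AddCommGroup M'] [Module S M'] [AddCommGroup M''] [Module S M'']

/-- `S ^ a × S ^ b = S ^ (a + b)`. -/
noncomputable def prodFinEquiv (S : Type u) [CommRing S] (a b : ℕ) :
    ((Fin a → S) × (Fin b → S)) ≃ₗ[S] (Fin (a + b) → S) :=
  (LinearEquiv.sumArrowLequivProdArrow (Fin a) (Fin b) S S).symm ≪≫ₗ
    LinearEquiv.funCongrLeft S S finSumFinEquiv.symm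

lemma FFR.of_equiv (e : M ≃ₗ[S] N) (h : FFR S k M) : FFR S k N := by
  cases k with
  | zero =>
    obtain ⟨a, b, ⟨f⟩⟩ := h
    exact ⟨a, b, ⟨(e.symm.prodCongr (LinearEquiv.refl S _)) ≪≫ₗ f⟩⟩
  | succ k =>
    obtain ⟨a, π, hπ, h⟩ := h
    refine ⟨a, e.toLinearMap ∘ₗ π, e.surjective.comp hπ, ?_⟩
    rwa [LinearEquiv.ker_comp]

lemma FFR.of_surjective {F : Type u} [AddCommGroup F] [Module S F] {a : ℕ}
    (e : F ≃ₗ[S] (Fin a → S)) (π : F →ₗ[S] M) (hπ : Function.Surjective π)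
    (h : FFR S k (LinearMap.ker π)) : FFR S (k + 1) M := by
  refine ⟨a, π ∘ₗ e.symm.toLinearMap, hπ.comp e.symm.surjective, h.of_equiv ?_⟩
  rw [LinearMap.ker_comp]
  exact (LinearEquiv.ofSubmodule' e.symm (LinearMap.ker π)).symm

/-- A split surjection decomposes its source. -/
noncomputable def splitEquiv (f : M →ₗ[S] N) (g : N →ₗ[S] M) (h : f ∘ₗ g = LinearMap.id) :
    M ≃ₗ[S] LinearMap.ker f × N :=
  have h' : ∀ x, f (g x) = x := fun x => LinearMap.congr_fun h x
  LinearEquiv.ofLinearMap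
    (((LinearMap.id - g ∘ₗ f).codRestrict (LinearMap.ker f) fun x => by simp [h']).prod f)
    ((LinearMap.ker f).subtype.coprod g)
    (by
      refine LinearMap.prod_ext (LinearMap.ext fun x => ?_) (LinearMap.ext fun x => ?_)
      · have : f x = 0 := x.2
        refine Prod.ext (Subtype.ext ?_) ?_ <;> simp [this]
      · refine Prod.ext (Subtype.ext ?_) ?_ <;> simp [h'])
    (by ext x; simp)

/-- A surjection onto a projective module splits. -/
lemma nonempty_equiv_ker_prod [Module.Projective S N] (f : M →ₗ[S] N)
    (hf : Function.Surjective f) : Nonempty (M ≃ₗ[S] LinearMap.ker f × N) := by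
  obtain ⟨g, hg⟩ := Module.projective_lifting_property f LinearMap.id hf
  exact ⟨splitEquiv f g hg⟩

lemma FFR.projective (h : FFR S 0 M) : Module.Projective S M := by
  obtain ⟨a, b, ⟨e⟩⟩ := h
  exact Module.Projective.of_split (e.toLinearMap ∘ₗ LinearMap.inl S M (Fin a → S))
    (LinearMap.fst S M (Fin a → S) ∘ₗ e.symm.toLinearMap) (by ext; simp)

lemma ffr_zero_of_equiv {a : ℕ} (e : M ≃ₗ[S] (Fin a → S)) : FFR S 0 M :=
  ⟨0, a, ⟨LinearEquiv.prodUnique ≪≫ₗ e⟩⟩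

lemma FFR.zero_prod (hM : FFR S 0 M) (hN : FFR S 0 N) : FFR S 0 (M × N) := by
  obtain ⟨a, b, ⟨e⟩⟩ := hM
  obtain ⟨c, d, ⟨f⟩⟩ := hN
  exact ⟨a + c, b + d, ⟨((LinearEquiv.refl S _).prodCongr (prodFinEquiv S a c).symm) ≪≫ₗ
    LinearEquiv.prodProdProdComm S _ _ _ _ ≪≫ₗ (e.prodCongr f) ≪≫ₗ prodFinEquiv S b d⟩⟩

lemma FFR.succ : ∀ {k : ℕ} {M : Type u} [AddCommGroup M] [Module S M], FFR S k M →
    FFR S (k + 1) M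
  | 0, M, _, _, ⟨a, b, ⟨e⟩⟩ => by
    refine ⟨b, LinearMap.fst S M (Fin a → S) ∘ₗ e.symm.toLinearMap,
      Prod.fst_surjective.comp e.symm.surjective, ffr_zero_of_equiv (a := a) ?_⟩
    rw [LinearMap.ker_comp]
    refine (LinearEquiv.ofSubmodule' e.symm _) ≪≫ₗ ?_
    rw [LinearMap.ker_fst]
    exact (LinearEquiv.ofInjective (LinearMap.inr S M (Fin a → S)) LinearMap.inr_injective).symm
  | _ + 1, _, _, _, ⟨a, π, hπ, h⟩ => ⟨a, π, hπ, h.succ⟩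

lemma FFR.mono {k l : ℕ} (hkl : k ≤ l) (h : FFR S k M) : FFR S l M := by
  induction hkl with
  | refl => exact h
  | step _ ih => exact ih.succ

/-- Extensions of modules with finite free resolutions. -/
lemma FFR.of_ker : ∀ {k : ℕ} {M N : Type u} [AddCommGroup M] [Module S M] [AddCommGroup N]
    [Module S N] (g : M →ₗ[S] N), Function.Surjective g → FFR S k (LinearMap.ker g) →
    FFR S k N → FFR S k M
  | 0, M, N, _, _, _, _, g, hg, h', h'' => by
    have := h''.projective
    obtain ⟨e⟩ := nonempty_equiv_ker_prod g hg
    exact (h'.zero_prod h'').of_equiv e.symm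
  | k + 1, M, N, _, _, _, _, g, hg, ⟨a, π', hπ', h'⟩, ⟨b, π'', hπ'', h''⟩ => by
    obtain ⟨σ, hσ⟩ := Module.projective_lifting_property g π'' hg
    have hσ' : ∀ y, g (σ y) = π'' y := fun y => LinearMap.congr_fun hσ y
    set Φ : (Fin a → S) × (Fin b → S) →ₗ[S] M :=
      ((LinearMap.ker g).subtype ∘ₗ π').coprod σ with hΦ
    have hΦ' : ∀ x y, Φ (x, y) = (π' x : M) + σ y := fun x y => by simp [hΦ]
    have hgΦ : ∀ z, g (Φ z) = π'' z.2 := by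
      rintro ⟨x, y⟩
      rw [hΦ', map_add, hσ', LinearMap.mem_ker.1 (π' x).2, zero_add]
    refine FFR.of_surjective (prodFinEquiv S a b) Φ ?_ ?_
    · intro m
      obtain ⟨y, hy⟩ := hπ'' (g m)
      obtain ⟨x, hx⟩ := hπ' ⟨m - σ y, by simp [hσ', hy]⟩
      exact ⟨(x, y), by rw [hΦ', hx]; simp⟩
    · let p : LinearMap.ker Φ →ₗ[S] LinearMap.ker π'' :=
        (LinearMap.snd S (Fin a → S) (Fin b → S)).restrict fun z hz => by
          rw [LinearMap.mem_ker] at hz ⊢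
          change π'' z.2 = 0
          rw [← hgΦ, hz, map_zero]
      have hp : ∀ z, (p z : Fin b → S) = z.1.2 := fun z => rfl
      refine FFR.of_ker p ?_ ?_ h''
      · rintro ⟨y, hy⟩
        obtain ⟨x, hx⟩ := hπ' ⟨-σ y, by simp [hσ', LinearMap.mem_ker.1 hy]⟩
        exact ⟨⟨(x, y), by rw [LinearMap.mem_ker, hΦ', hx]; simp⟩, rfl⟩
      · have hi : ∀ x : LinearMap.ker π', Φ (x.1, 0) = 0 := fun x => by
          rw [hΦ', LinearMap.mem_ker.1 x.2]; simp
        let i : LinearMap.ker π' →ₗ[S] LinearMap.ker p :=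
          ((LinearMap.inl S (Fin a → S) (Fin b → S) ∘ₗ (LinearMap.ker π').subtype).codRestrict
            (LinearMap.ker Φ) fun x => LinearMap.mem_ker.2 (hi x)).codRestrict
            (LinearMap.ker p) fun x => by
              rw [LinearMap.mem_ker, Subtype.ext_iff, hp]; rfl
        refine h'.of_equiv (LinearEquiv.ofBijective i ⟨?_, ?_⟩)
        · intro x y hxy
          exact Subtype.ext (congrArg (fun z => z.1.1.1) hxy)
        · rintro ⟨⟨⟨x, y⟩, hz⟩, hz'⟩
          have hy : y = 0 := by
            rw [LinearMap.mem_ker, Subtype.ext_iff, hp] at hz'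
            exact hz'
          subst hy
          rw [LinearMap.mem_ker, hΦ', map_zero, add_zero] at hz
          exact ⟨⟨x, LinearMap.mem_ker.2 (Subtype.ext hz)⟩, rfl⟩

/-- Cokernels of modules with finite free resolutions. -/
lemma FFR.of_surjective_of_ker (g : M →ₗ[S] N) (hg : Function.Surjective g)
    (h' : FFR S k (LinearMap.ker g)) (h : FFR S k M) : FFR S (k + 1) N := by
  obtain ⟨a, π, hπ, hK⟩ := h.succ
  refine ⟨a, g ∘ₗ π, hg.comp hπ, ?_⟩
  let p : LinearMap.ker (g ∘ₗ π) →ₗ[S] LinearMap.ker g := π.restrict fun x hx => hx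
  have hp : ∀ z, (p z : M) = π z := fun z => rfl
  refine FFR.of_ker p ?_ ?_ h'
  · rintro ⟨y, hy⟩
    obtain ⟨x, rfl⟩ := hπ y
    exact ⟨⟨x, hy⟩, rfl⟩
  · let i : LinearMap.ker π →ₗ[S] LinearMap.ker p :=
      ((LinearMap.ker π).subtype.codRestrict (LinearMap.ker (g ∘ₗ π)) fun x => by simp).codRestrict
        (LinearMap.ker p) fun x => by
          rw [LinearMap.mem_ker, Subtype.ext_iff, hp]; exact x.2
    refine hK.of_equiv (LinearEquiv.ofBijective i ⟨?_, ?_⟩)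
    · intro x y hxy
      exact Subtype.ext (congrArg (fun z => z.1.1) hxy)
    · rintro ⟨⟨x, hx⟩, hz⟩
      rw [LinearMap.mem_ker, Subtype.ext_iff, hp] at hz
      exact ⟨⟨x, hz⟩, rfl⟩

/-- A projective module with a finite free resolution is stably free. -/
lemma FFR.stablyFree : ∀ {k : ℕ} {M : Type u} [AddCommGroup M] [Module S M]
    [Module.Projective S M], FFR S k M → FFR S 0 M
  | 0, _, _, _, _, h => h
  | k + 1, M, _, _, _, ⟨a, π, hπ, h⟩ => by
    obtain ⟨e⟩ := nonempty_equiv_ker_prod π hπ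
    have : Module.Projective S (LinearMap.ker π) :=
      Module.Projective.of_split (e.symm.toLinearMap ∘ₗ LinearMap.inl S _ M)
        (LinearMap.fst S _ M ∘ₗ e.toLinearMap) (by ext; simp)
    obtain ⟨c, b, ⟨f⟩⟩ := h.stablyFree
    exact ⟨b, a + c, ⟨((LinearEquiv.refl S M).prodCongr f.symm) ≪≫ₗ
      (LinearEquiv.prodAssoc S _ _ _).symm ≪≫ₗ
      (((LinearEquiv.prodComm S _ _) ≪≫ₗ e.symm).prodCongr (LinearEquiv.refl S _)) ≪≫ₗ
      prodFinEquiv S a c⟩⟩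

end FiniteFreeResolution

section RegularLocal

open Pointwise

universe u

/-- Lifting a cover along reduction modulo a regular element in the Jacobson radical. -/
lemma exists_lift_cover {R : Type u} [CommRing R] {x : R}
    (hx : x ∈ (⊥ : Ideal R).jacobson) {M N : Type u} [AddCommGroup M] [Module R M]
    [Module.Finite R M] [AddCommGroup N] [Module (R ⧸ Ideal.span {x}) N]
    (hreg : ∀ m : M, x • m = 0 → m = 0)
    (ρ : M →ₛₗ[Ideal.Quotient.mk (Ideal.span {x})] N) (hρ : Function.Surjective ρ)
    (hker : ∀ m, ρ m = 0 → ∃ m', m = x • m') {a : ℕ}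
    (π' : (Fin a → R ⧸ Ideal.span {x}) →ₗ[R ⧸ Ideal.span {x}] N)
    (hπ' : Function.Surjective π') :
    ∃ π : (Fin a → R) →ₗ[R] M, Function.Surjective π ∧
      ∃ κ : LinearMap.ker π →ₛₗ[Ideal.Quotient.mk (Ideal.span {x})] LinearMap.ker π',
        Function.Surjective κ ∧ ∀ c, κ c = 0 → ∃ c', c = x • c' := by
  choose m hm using fun i => hρ (π' (Pi.single i 1))
  let π : (Fin a → R) →ₗ[R] M := Fintype.linearCombination R m
  let q : (Fin a → R) →ₛₗ[Ideal.Quotient.mk (Ideal.span {x})] (Fin a → R ⧸ Ideal.span {x}) :=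
    { toFun := fun c i => Ideal.Quotient.mk _ (c i)
      map_add' := fun c d => by ext; simp
      map_smul' := fun r c => by ext; simp }
  have hq : Function.Surjective q := fun s =>
    ⟨fun i => (Ideal.Quotient.mk_surjective (s i)).choose,
      funext fun i => (Ideal.Quotient.mk_surjective (s i)).choose_spec⟩
  have hπq : ∀ c, ρ (π c) = π' (q c) := by
    intro c
    have h1 : π c = ∑ i, c i • m i := Fintype.linearCombination_apply R m c
    have h2 : q c = ∑ i, (Ideal.Quotient.mk (Ideal.span {x}) (c i)) • Pi.single i 1 := by
      ext i
      simp [q, Finset.sum_apply, Pi.single_apply]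
    rw [h1, h2, map_sum, map_sum]
    exact Finset.sum_congr rfl fun i _ => by rw [map_smulₛₗ, map_smul, hm]
  have hq0 : ∀ c, q c = 0 → ∃ c', c = x • c' := by
    intro c hc
    have : ∀ i, ∃ t, c i = x * t := fun i => by
      have := congrFun hc i
      exact Ideal.mem_span_singleton.1 (Ideal.Quotient.eq_zero_iff_mem.1 this)
    choose t ht using this
    exact ⟨t, funext fun i => ht i⟩
  have hxρ : ∀ y, ρ (x • y) = 0 := fun y => by
    rw [map_smulₛₗ, Ideal.Quotient.eq_zero_iff_mem.2 (Ideal.mem_span_singleton_self x), zero_smul]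
  have hsurj : Function.Surjective π := by
    rw [← LinearMap.range_eq_top]
    refine top_le_iff.1 (Submodule.le_of_le_smul_of_le_jacobson_bot (I := Ideal.span {x})
      Module.Finite.fg_top (by simpa using hx) ?_)
    intro y _
    obtain ⟨s, hs⟩ := hπ' (ρ y)
    obtain ⟨c, rfl⟩ := hq s
    obtain ⟨y', hy'⟩ := hker (y - π c) (by rw [map_sub, hπq, hs, sub_self])
    rw [← sub_add_cancel y (π c), hy']
    refine add_mem (Submodule.mem_sup_right ?_)
      (Submodule.mem_sup_left (LinearMap.mem_range_self π c))
    exact Submodule.smul_mem_smul (Ideal.mem_span_singleton_self x) trivial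
  have hK : ∀ c : LinearMap.ker π, q c ∈ LinearMap.ker π' := fun c => by
    rw [LinearMap.mem_ker, ← hπq, LinearMap.mem_ker.1 c.2, map_zero]
  refine ⟨π, hsurj,
    { toFun := fun c => ⟨q c, hK c⟩
      map_add' := fun c d => Subtype.ext (map_add q c.1 d.1)
      map_smul' := fun r c => Subtype.ext (map_smulₛₗ q r c.1) }, ?_, ?_⟩
  · rintro ⟨s, hs⟩
    obtain ⟨c, rfl⟩ := hq s
    obtain ⟨y, hy⟩ := hker (π c) (by rw [hπq]; exact hs)
    obtain ⟨c', rfl⟩ := hsurj y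
    refine ⟨⟨c - x • c', by rw [LinearMap.mem_ker, map_sub, map_smul, hy, sub_self]⟩,
      Subtype.ext ?_⟩
    change q (c - x • c') = q c
    have : q (x • c') = 0 := by
      rw [map_smulₛₗ, Ideal.Quotient.eq_zero_iff_mem.2 (Ideal.mem_span_singleton_self x),
        zero_smul]
    rw [map_sub, this, sub_zero]
  · rintro ⟨c, hc⟩ hc0
    obtain ⟨c', rfl⟩ := hq0 c (congrArg Subtype.val hc0)
    exact ⟨⟨c', hreg _ (by rw [← map_smul]; exact hc)⟩, rfl⟩

/-- Finite free resolutions lift along reduction modulo a regular element. -/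
lemma FFR.of_quotient {R : Type u} [CommRing R] [IsLocalRing R] [IsNoetherianRing R] {x : R}
    (hx : x ∈ IsLocalRing.maximalIdeal R) (hx0 : ∀ r : R, x * r = 0 → r = 0) :
    ∀ {k : ℕ} {M N : Type u} [AddCommGroup M]
    [Module R M] [Module.Finite R M] [AddCommGroup N] [Module (R ⧸ Ideal.span {x}) N]
    (_ : ∀ m : M, x • m = 0 → m = 0)
    (ρ : M →ₛₗ[Ideal.Quotient.mk (Ideal.span {x})] N) (_ : Function.Surjective ρ)
    (_ : ∀ m, ρ m = 0 → ∃ m', m = x • m') (_ : FFR (R ⧸ Ideal.span {x}) k N), FFR R k M := by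
  have hx' : x ∈ (⊥ : Ideal R).jacobson := IsLocalRing.maximalIdeal_le_jacobson _ hx
  intro k
  induction k with
  | zero =>
    intro M N _ _ _ _ _ hreg ρ hρ hker h
    have : Nontrivial (R ⧸ Ideal.span {x}) := Ideal.Quotient.nontrivial_iff.2 fun h => by
      rw [Ideal.span_singleton_eq_top] at h
      exact (IsLocalRing.mem_maximalIdeal x).1 hx h
    have : IsLocalRing (R ⧸ Ideal.span {x}) :=
      .of_surjective' (Ideal.Quotient.mk _) Ideal.Quotient.mk_surjective
    have := h.projective
    have : Module.Finite (R ⧸ Ideal.span {x}) N := by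
      classical
      obtain ⟨s, hs⟩ := ‹Module.Finite R M›.fg_top
      refine ⟨⟨s.image ρ, ?_⟩⟩
      rw [Finset.coe_image, ← Submodule.map_span, hs, Submodule.map_top]
      exact LinearMap.range_eq_top.2 hρ
    have : Module.Free (R ⧸ Ideal.span {x}) N := Module.free_of_flat_of_isLocalRing
    let e := (Module.finBasis (R ⧸ Ideal.span {x}) N).equivFun.symm
    obtain ⟨π, hπ, κ, -, hκ⟩ := exists_lift_cover hx' hreg ρ hρ hker e.toLinearMap e.surjective
    have hbot : LinearMap.ker π = ⊥ := by
      have hz : ∀ z : LinearMap.ker e.toLinearMap, z = 0 := fun z =>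
        Subtype.ext (e.injective (z.2.trans (map_zero e).symm))
      refine Submodule.eq_bot_of_le_smul_of_le_jacobson_bot (Ideal.span {x}) _
        (IsNoetherian.noetherian _) ?_ (by simpa using hx')
      intro c hc
      obtain ⟨c', hc'⟩ := hκ ⟨c, hc⟩ (hz _)
      rw [show c = x • (c' : Fin _ → R) from congrArg Subtype.val hc']
      exact Submodule.smul_mem_smul (Ideal.mem_span_singleton_self x) c'.2
    exact ffr_zero_of_equiv (LinearEquiv.ofBijective π ⟨LinearMap.ker_eq_bot.1 hbot, hπ⟩).symm
  | succ k ih =>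
    rintro M N _ _ _ _ _ hreg ρ hρ hker ⟨a, π', hπ', h⟩
    obtain ⟨π, hπ, κ, hκs, hκ⟩ := exists_lift_cover hx' hreg ρ hρ hker π' hπ'
    exact ⟨a, π, hπ, ih (fun c hc => by
      exact Subtype.ext (funext fun i => hx0 _ (congrFun (congrArg Subtype.val hc) i))) κ hκs hκ h⟩

lemma ringKrullDim_le_of_span_eq_maximalIdeal {R : Type u} [CommRing R] [IsLocalRing R]
    [IsNoetherianRing R] {r : ℕ} (f : Fin r → R)
    (hf : Ideal.span (Set.range f) = IsLocalRing.maximalIdeal R) : ringKrullDim R ≤ r := by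
  refine (ringKrullDim_le_spanFinrank_maximalIdeal R).trans ?_
  rw [← hf]
  have h1 := Submodule.spanFinrank_span_le_ncard_of_finite (R := R) (Set.finite_range f)
  have h2 : (Set.range f).ncard ≤ r := by
    rw [← Set.image_univ]
    refine (Set.ncard_image_le Set.finite_univ).trans ?_
    simp [Set.ncard_univ]
  exact_mod_cast h1.trans h2

lemma exists_isPrime_le_ringKrullDim_quotient {R : Type u} [CommRing R] {r : ℕ}
    (h : (r : WithBot ℕ∞) ≤ ringKrullDim R) :
    ∃ Q : Ideal R, Q.IsPrime ∧ (r : WithBot ℕ∞) ≤ ringKrullDim (R ⧸ Q) := by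
  obtain ⟨l, hl⟩ := Order.le_krullDim_iff.1 h
  refine ⟨l.head.asIdeal, l.head.2, ?_⟩
  rw [ringKrullDim_quotient]
  refine Order.le_krullDim_iff.2 ⟨LTSeries.mk l.length
    (fun i => ⟨l i, fun x hx => l.head_le i hx⟩) fun i j hij => l.strictMono hij, hl⟩

/-- A regular local ring is a domain, and its finite modules have finite free resolutions. -/
lemma isDomain_and_exists_ffr_of_span_eq_maximalIdeal (r : ℕ) : ∀ (R : Type u) [CommRing R] [IsLocalRing R]
    [IsNoetherianRing R] (f : Fin r → R),
    Ideal.span (Set.range f) = IsLocalRing.maximalIdeal R → (r : WithBot ℕ∞) ≤ ringKrullDim R →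
    IsDomain R ∧ ∀ (M : Type u) [AddCommGroup M] [Module R M] [Module.Finite R M],
      ∃ k, FFR R k M := by
  induction r with
  | zero =>
    intro R _ _ _ f hf _
    have hF : IsField R := by
      rw [IsLocalRing.isField_iff_maximalIdeal_eq, ← hf]
      simp
    refine ⟨hF.isDomain, fun M _ _ _ => ⟨0, ?_⟩⟩
    let := hF.toField
    exact ffr_zero_of_equiv (Module.finBasis R M).equivFun
  | succ r ih =>
    intro R _ _ _ f hf hdim
    set x := f 0 with hx
    have hxm : x ∈ IsLocalRing.maximalIdeal R := hf ▸ Ideal.subset_span ⟨0, rfl⟩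
    have : Nontrivial (R ⧸ Ideal.span {x}) := Ideal.Quotient.nontrivial_iff.2 fun h => by
      rw [Ideal.span_singleton_eq_top] at h
      exact (IsLocalRing.mem_maximalIdeal x).1 hxm h
    have : IsLocalRing (R ⧸ Ideal.span {x}) :=
      .of_surjective' (Ideal.Quotient.mk _) Ideal.Quotient.mk_surjective
    let f' : Fin r → R ⧸ Ideal.span {x} := fun i => Ideal.Quotient.mk _ (f i.succ)
    have hf' : Ideal.span (Set.range f') = IsLocalRing.maximalIdeal (R ⧸ Ideal.span {x}) := by
      have h1 : (IsLocalRing.maximalIdeal R).map (Ideal.Quotient.mk (Ideal.span {x})) =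
          IsLocalRing.maximalIdeal (R ⧸ Ideal.span {x}) := by
        have := IsLocalHom.of_surjective (Ideal.Quotient.mk (Ideal.span {x}))
          Ideal.Quotient.mk_surjective
        refine le_antisymm (Ideal.map_le_iff_le_comap.2 fun y hy => ?_) fun z hz => ?_
        · rw [Ideal.mem_comap]
          exact map_nonunit (Ideal.Quotient.mk (Ideal.span {x})) y hy
        · obtain ⟨y, rfl⟩ := Ideal.Quotient.mk_surjective z
          exact Ideal.mem_map_of_mem _ fun hy => hz (hy.map _)
      rw [← h1, ← hf, Ideal.map_span, ← Set.range_comp]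
      refine le_antisymm (Ideal.span_mono ?_) (Ideal.span_le.2 ?_)
      · rintro _ ⟨i, rfl⟩
        exact ⟨i.succ, rfl⟩
      · rintro _ ⟨i, rfl⟩
        refine Fin.cases ?_ (fun i => Ideal.subset_span ⟨i, rfl⟩) i
        rw [Function.comp_apply, Ideal.Quotient.eq_zero_iff_mem.2 (Ideal.mem_span_singleton_self _)]
        exact zero_mem _
    have hdim' : (r : WithBot ℕ∞) ≤ ringKrullDim (R ⧸ Ideal.span {x}) := by
      have := ringKrullDim_le_ringKrullDim_quotient_add_card {x}
        (by simpa [IsLocalRing.ringJacobson_eq_maximalIdeal] using hxm)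
      rw [Finset.coe_singleton, Finset.card_singleton] at this
      have h2 := hdim.trans this
      rw [Nat.cast_succ, Nat.cast_one] at h2
      exact ENat.WithBot.add_le_add_one_right_iff.1 h2
    obtain ⟨hdom, hffr⟩ := ih (R ⧸ Ideal.span {x}) f' hf' hdim'
    have hdim'' := ringKrullDim_le_of_span_eq_maximalIdeal f' hf'
    have hlt : ¬ ((r + 1 : ℕ) : WithBot ℕ∞) ≤ r := by
      rw [not_le]
      exact_mod_cast Nat.lt_succ_self r
    obtain ⟨Q, hQ, hdQ⟩ := exists_isPrime_le_ringKrullDim_quotient hdim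
    have hxQ : x ∉ Q := fun hxQ => hlt <| hdQ.trans <| (ringKrullDim_le_of_surjective
      (Ideal.Quotient.factor ((Ideal.span_singleton_le_iff_mem _).2 hxQ))
      (Ideal.Quotient.factor_surjective _)).trans hdim''
    have hQx : Q ≤ Ideal.span {x} := by
      intro y hy
      by_contra hyx
      have : IsLocalRing (R ⧸ Q) :=
        .of_surjective' (Ideal.Quotient.mk _) Ideal.Quotient.mk_surjective
      have := IsLocalHom.of_surjective (Ideal.Quotient.mk Q) Ideal.Quotient.mk_surjective
      have hxm' : Ideal.Quotient.mk Q x ∈ IsLocalRing.maximalIdeal (R ⧸ Q) :=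
        map_nonunit (Ideal.Quotient.mk Q) x hxm
      have h1 := ringKrullDim_le_ringKrullDim_quotient_add_card {Ideal.Quotient.mk Q x}
        (by simpa [IsLocalRing.ringJacobson_eq_maximalIdeal] using hxm')
      rw [Finset.coe_singleton, Finset.card_singleton, Nat.cast_one] at h1
      let φ : R ⧸ Ideal.span {x} →+* (R ⧸ Q) ⧸ Ideal.span {Ideal.Quotient.mk Q x} :=
        Ideal.Quotient.lift _ ((Ideal.Quotient.mk _).comp (Ideal.Quotient.mk Q)) fun z hz => by
          obtain ⟨t, rfl⟩ := Ideal.mem_span_singleton.1 hz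
          rw [RingHom.comp_apply, map_mul]
          exact Ideal.Quotient.eq_zero_iff_mem.2
            (Ideal.mul_mem_right _ _ (Ideal.mem_span_singleton_self _))
      have hφ : Function.Surjective φ := Ideal.Quotient.lift_surjective_of_surjective _ _
        (Ideal.Quotient.mk_surjective.comp Ideal.Quotient.mk_surjective)
      have h2 := ringKrullDim_succ_le_of_surjective φ hφ (r := Ideal.Quotient.mk _ y)
        (mem_nonZeroDivisors_of_ne_zero fun h => hyx (Ideal.Quotient.eq_zero_iff_mem.1 h)) (by
          rw [Ideal.Quotient.lift_mk, RingHom.comp_apply, Ideal.Quotient.eq_zero_iff_mem.2 hy,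
            map_zero])
      exact hlt (hdQ.trans (h1.trans (h2.trans hdim'')))
    have hQ0 : Q = ⊥ := by
      refine Submodule.eq_bot_of_le_smul_of_le_jacobson_bot (Ideal.span {x}) _
        (IsNoetherian.noetherian _) ?_
        (by simpa using IsLocalRing.maximalIdeal_le_jacobson _ hxm)
      intro y hy
      obtain ⟨t, rfl⟩ := Ideal.mem_span_singleton.1 (hQx hy)
      exact Ideal.mul_mem_mul (Ideal.mem_span_singleton_self x)
        ((hQ.mem_or_mem hy).resolve_left hxQ)
    subst hQ0
    have hR : IsDomain R := IsDomain.of_bot_isPrime R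
    have hx0 : x ≠ 0 := fun h => hxQ (h ▸ zero_mem _)
    refine ⟨hR, fun M _ _ _ => ?_⟩
    obtain ⟨a, π, hπ⟩ := Module.Finite.exists_fin' R M
    have hN : Module.Finite (R ⧸ Ideal.span {x}) (QuotSMulTop x (LinearMap.ker π)) :=
      Module.Finite.of_restrictScalars_finite R _ _
    obtain ⟨k, hk⟩ := hffr (QuotSMulTop x (LinearMap.ker π))
    refine ⟨k + 1, a, π, hπ, FFR.of_quotient hxm
      (fun r hr => (mul_eq_zero.1 hr).resolve_left hx0) ?_
      { toFun := Submodule.Quotient.mk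
        map_add' := fun _ _ => rfl
        map_smul' := fun _ _ => rfl } (Submodule.Quotient.mk_surjective _) ?_ hk⟩
    · intro c hc
      refine Subtype.ext (funext fun i => ?_)
      have := congrFun (congrArg Subtype.val hc) i
      exact (mul_eq_zero.1 this).resolve_left hx0
    · intro m hm
      obtain ⟨m', -, h⟩ := (Submodule.Quotient.mk_eq_zero _).1 hm
      exact ⟨m', h.symm⟩

end RegularLocal

section PolynomialSyzygies

universe u

open TensorProduct Polynomial

lemma FFR.baseChange {R S : Type u} [CommRing R] [CommRing S] [Algebra R S] [Module.Flat R S] :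
    ∀ {k : ℕ} {M : Type u} [AddCommGroup M] [Module R M], FFR R k M → FFR S k (S ⊗[R] M)
  | 0, M, _, _, ⟨a, b, ⟨e⟩⟩ =>
    ⟨a, b, ⟨((LinearEquiv.refl S _).prodCongr (TensorProduct.piScalarRight R S S (Fin a)).symm) ≪≫ₗ
      (TensorProduct.prodRight R S S M (Fin a → R)).symm ≪≫ₗ e.baseChange R S _ _ ≪≫ₗ
      TensorProduct.piScalarRight R S S (Fin b)⟩⟩
  | _ + 1, _, _, _, ⟨a, π, hπ, h⟩ =>
    FFR.of_surjective (TensorProduct.piScalarRight R S S (Fin a))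
      (AlgebraTensorModule.lTensor S S π) (LinearMap.lTensor_surjective S hπ)
      (h.baseChange.of_equiv (LinearMap.tensorKerEquiv S S π))

lemma FFR.of_exact {S : Type u} [CommRing S] {k : ℕ} {M N P : Type u} [AddCommGroup M]
    [Module S M] [AddCommGroup N] [Module S N] [AddCommGroup P] [Module S P] (f : M →ₗ[S] N)
    (g : N →ₗ[S] P) (hf : Function.Injective f) (hg : Function.Surjective g)
    (hfg : Function.Exact f g) (hM : FFR S k M) (hP : FFR S k P) : FFR S k N := by
  refine FFR.of_ker g hg ?_ hP
  rw [LinearMap.exact_iff.1 hfg]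
  exact hM.of_equiv (LinearEquiv.ofInjective f hf)

/-- Pseudo-division by an element of minimal degree. -/
lemma exists_pow_mul_mem {R : Type u} [CommRing R] (𝔞 : Ideal R) (P : Ideal R[X])
    (h𝔞 : P.comap C = 𝔞) (f : R[X]) (hf : f ∈ P)
    (hmin : ∀ g ∈ P, g.natDegree < f.natDegree → g ∈ 𝔞.map C) :
    ∀ (N : ℕ) (g : R[X]), g ∈ P → g.natDegree ≤ N →
      ∃ j, C (f.leadingCoeff ^ j) * g ∈ 𝔞.map C ⊔ Ideal.span {f} := by
  intro N
  induction N with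
  | zero =>
    intro g hg hN
    refine ⟨0, ?_⟩
    rw [pow_zero, map_one, one_mul]
    rw [Nat.le_zero, natDegree_eq_zero] at hN
    obtain ⟨c, rfl⟩ := hN
    exact Ideal.mem_sup_left (Ideal.mem_map_of_mem C (h𝔞 ▸ hg))
  | succ N ih =>
    intro g hg hN
    rcases lt_or_ge g.natDegree f.natDegree with hlt | hge
    · exact ⟨0, by simpa using Ideal.mem_sup_left (hmin g hg hlt)⟩
    rcases Nat.lt_or_ge g.natDegree (N + 1) with hlt | hge'
    · exact ih g hg (Nat.lt_succ_iff.1 hlt)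
    set t : R[X] := C g.leadingCoeff * X ^ (g.natDegree - f.natDegree) with ht
    have hg' : C f.leadingCoeff * g - t * f ∈ P :=
      P.sub_mem (P.mul_mem_left _ hg) (P.mul_mem_left _ hf)
    have hdeg : (C f.leadingCoeff * g - t * f).natDegree ≤ N := by
      rw [natDegree_le_iff_coeff_eq_zero]
      intro i hi
      have h1 : (t * f).coeff i = g.leadingCoeff *
          (if g.natDegree - f.natDegree ≤ i then f.coeff (i - (g.natDegree - f.natDegree)) else 0) := by
        rw [ht, mul_assoc, coeff_C_mul, coeff_X_pow_mul']
      rw [coeff_sub, coeff_C_mul, h1]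
      rcases eq_or_lt_of_le (Nat.succ_le_of_lt hi) with h | h
      · have hi' : i = g.natDegree := by omega
        subst hi'
        rw [if_pos (Nat.sub_le _ _), Nat.sub_sub_self hge, coeff_natDegree, coeff_natDegree,
          mul_comm, sub_self]
      · rw [if_pos (by omega), coeff_eq_zero_of_natDegree_lt (p := g) (by omega),
          coeff_eq_zero_of_natDegree_lt (p := f) (by omega), mul_zero, mul_zero, sub_zero]
    obtain ⟨j, hj⟩ := ih _ hg' hdeg
    refine ⟨j + 1, ?_⟩
    have : C (f.leadingCoeff ^ (j + 1)) * g =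
        C (f.leadingCoeff ^ j) * (C f.leadingCoeff * g - t * f) +
          C (f.leadingCoeff ^ j) * t * f := by
      rw [pow_succ, C_mul]; ring
    rw [this]
    exact add_mem hj (Ideal.mem_sup_right
      (Ideal.mul_mem_left _ _ (Ideal.mem_span_singleton_self f)))

/-- The cyclic case of `exists_ffr_polynomial`. -/
lemma exists_ffr_quotient_prime {R : Type u} [CommRing R] [IsNoetherianRing R]
    (hR : ∀ (M : Type u) [AddCommGroup M] [Module R M] [Module.Finite R M], ∃ k, FFR R k M)
    (𝔞 : Ideal R)
    (ih : ∀ 𝔟 > 𝔞, ∀ (M : Type u) [AddCommGroup M] [Module R[X] M] [Module.Finite R[X] M],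
      (∀ a ∈ 𝔟, ∀ m : M, C a • m = 0) → ∃ k, FFR R[X] k M)
    (P : Ideal R[X]) [P.IsPrime] (hP : P.comap C = 𝔞) : ∃ k, FFR R[X] k (R[X] ⧸ P) := by
  have h𝔞 : 𝔞.IsPrime := hP ▸ Ideal.comap_isPrime C P
  have hle : 𝔞.map C ≤ P := hP ▸ Ideal.map_comap_le
  obtain ⟨k, hk⟩ := hR (R ⧸ 𝔞)
  have h1 : FFR R[X] k (R[X] ⧸ 𝔞.map C) := (hk.baseChange (S := R[X])).of_equiv
    (Algebra.TensorProduct.quotIdealMapEquivTensorQuot R[X] 𝔞).toLinearEquiv.symm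
  rcases eq_or_lt_of_le hle with heq | hlt
  · exact ⟨k, h1.of_equiv (Submodule.quotEquivOfEq _ _ heq)⟩
  have hne : ∃ d, ∃ f ∈ P, f ∉ 𝔞.map C ∧ f.natDegree = d := by
    obtain ⟨f, hf, hf'⟩ := SetLike.exists_of_lt hlt
    exact ⟨_, f, hf, hf', rfl⟩
  classical
  obtain ⟨f, hf, hf', hfd⟩ := Nat.find_spec hne
  have hmin : ∀ g ∈ P, g.natDegree < f.natDegree → g ∈ 𝔞.map C := by
    intro g hg hlt
    by_contra hg'
    exact Nat.find_min hne (hfd ▸ hlt) ⟨g, hg, hg', rfl⟩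
  have hlc : f.leadingCoeff ∉ 𝔞 := by
    intro hlc
    have hC : C f.leadingCoeff * X ^ f.natDegree ∈ 𝔞.map C :=
      Ideal.mul_mem_right _ _ (Ideal.mem_map_of_mem C hlc)
    have hel : f.eraseLead ∈ P := by
      rw [← self_sub_C_mul_X_pow]
      exact P.sub_mem hf (hle hC)
    apply hf'
    rw [← f.eraseLead_add_C_mul_X_pow]
    refine add_mem ?_ hC
    rcases Nat.eq_zero_or_pos f.natDegree with h0 | h0
    · have : f.eraseLead = 0 := by
        rw [eq_C_of_natDegree_eq_zero h0, eraseLead_C]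
      rw [this]
      exact zero_mem _
    · exact hmin _ hel (lt_of_le_of_lt f.eraseLead_natDegree_le (by omega))
  set J := 𝔞.map C ⊔ Ideal.span {f} with hJ
  have hJP : J ≤ P := sup_le hle ((Ideal.span_singleton_le_iff_mem _).2 hf)
  have h2 : FFR R[X] (k + 1) (R[X] ⧸ J) := by
    refine FFR.of_surjective_of_ker (Submodule.factor (le_sup_left : 𝔞.map C ≤ J))
      (Submodule.factor_surjective _) ?_ h1
    have hprime : (𝔞.map C).IsPrime := Ideal.isPrime_map_C_of_isPrime
    let i : (R[X] ⧸ 𝔞.map C) →ₗ[R[X]]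
        LinearMap.ker (Submodule.factor (le_sup_left : 𝔞.map C ≤ J)) :=
      (LinearMap.lsmul R[X] (R[X] ⧸ 𝔞.map C) f).codRestrict _ fun z => by
        obtain ⟨g, rfl⟩ := Submodule.Quotient.mk_surjective _ z
        rw [LinearMap.mem_ker, LinearMap.lsmul_apply, ← Submodule.Quotient.mk_smul]
        exact (Submodule.Quotient.mk_eq_zero _).2 (Ideal.mem_sup_right
          (Ideal.mul_mem_right _ _ (Ideal.mem_span_singleton_self f)))
    refine h1.of_equiv (LinearEquiv.ofBijective i ⟨?_, ?_⟩)
    · rw [injective_iff_map_eq_zero]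
      intro z hz
      obtain ⟨g, rfl⟩ := Submodule.Quotient.mk_surjective _ z
      have := congrArg Subtype.val hz
      have : f * g ∈ 𝔞.map C := (Submodule.Quotient.mk_eq_zero _).1 this
      exact (Submodule.Quotient.mk_eq_zero _).2 ((hprime.mem_or_mem this).resolve_left hf')
    · rintro ⟨z, hz⟩
      obtain ⟨g, rfl⟩ := Submodule.Quotient.mk_surjective _ z
      have : g ∈ J := (Submodule.Quotient.mk_eq_zero _).1 hz
      obtain ⟨u, hu, v, hv, rfl⟩ := Submodule.mem_sup.1 this
      obtain ⟨w, rfl⟩ := Ideal.mem_span_singleton.1 hv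
      refine ⟨Submodule.Quotient.mk w, Subtype.ext ?_⟩
      refine (Submodule.Quotient.eq _).2 ?_
      change f * w - (u + f * w) ∈ _
      rw [sub_add_cancel_right]
      exact neg_mem hu
  have hK : ∃ K, ∀ g ∈ P, C (f.leadingCoeff ^ K) * g ∈ J := by
    obtain ⟨s, hs⟩ := IsNoetherian.noetherian P
    have : ∀ g : R[X], ∃ j, g ∈ P → C (f.leadingCoeff ^ j) * g ∈ J := fun g => by
      by_cases hg : g ∈ P
      · obtain ⟨j, hj⟩ := exists_pow_mul_mem 𝔞 P hP f hf hmin _ g hg le_rfl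
        exact ⟨j, fun _ => hj⟩
      · exact ⟨0, fun h => absurd h hg⟩
    choose j hj using this
    refine ⟨s.sup j, fun g hg => ?_⟩
    rw [← hs] at hg
    induction hg using Submodule.span_induction with
    | mem g hg =>
      have hgP : g ∈ P := hs ▸ Ideal.subset_span hg
      obtain ⟨t, ht⟩ := Nat.exists_eq_add_of_le (Finset.le_sup (f := j) hg)
      rw [ht, add_comm, pow_add, C_mul, mul_assoc]
      exact J.mul_mem_left _ (hj g hgP)
    | zero => simp
    | add g h _ _ hg hh => rw [mul_add]; exact add_mem hg hh
    | smul c g _ hg => rw [smul_eq_mul, mul_left_comm]; exact J.mul_mem_left _ hg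
  obtain ⟨K, hK⟩ := hK
  obtain ⟨l, hl⟩ : ∃ l, FFR R[X] l (LinearMap.ker (Submodule.factor hJP)) := by
    refine ih (𝔞 ⊔ Ideal.span {f.leadingCoeff ^ K}) ?_ _ ?_
    · refine left_lt_sup.2 fun h => hlc (h𝔞.mem_of_pow_mem K ?_)
      exact (Ideal.span_singleton_le_iff_mem _).1 h
    · rintro a ha ⟨z, hz⟩
      refine Subtype.ext ?_
      obtain ⟨g, rfl⟩ := Submodule.Quotient.mk_surjective _ z
      have hg : g ∈ P := (Submodule.Quotient.mk_eq_zero _).1 hz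
      refine (Submodule.Quotient.mk_eq_zero J (x := C a * g)).2 ?_
      obtain ⟨u, hu, v, hv, rfl⟩ := Submodule.mem_sup.1 ha
      obtain ⟨w, rfl⟩ := Ideal.mem_span_singleton.1 hv
      rw [C_add, add_mul, mul_comm _ w, C_mul, mul_assoc]
      exact add_mem (J.mul_mem_right _ (Ideal.mem_sup_left (Ideal.mem_map_of_mem C hu)))
        (J.mul_mem_left _ (hK g hg))
  exact ⟨max l (k + 1) + 1, FFR.of_surjective_of_ker (Submodule.factor hJP)
    (Submodule.factor_surjective _) (hl.mono (le_max_left _ _)) (h2.mono (le_max_right _ _))⟩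

/-- Finite free resolutions over `R` give finite free resolutions over `R[X]`. -/
lemma exists_ffr_polynomial {R : Type u} [CommRing R] [IsNoetherianRing R]
    (hR : ∀ (M : Type u) [AddCommGroup M] [Module R M] [Module.Finite R M], ∃ k, FFR R k M)
    (M : Type u) [AddCommGroup M] [Module R[X] M] [hM : Module.Finite R[X] M] :
    ∃ k, FFR R[X] k M := by
  suffices H : ∀ (𝔞 : Ideal R) (M : Type u) [AddCommGroup M] [Module R[X] M]
      [Module.Finite R[X] M], (∀ a ∈ 𝔞, ∀ m : M, C a • m = 0) → ∃ k, FFR R[X] k M from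
    H ⊥ M fun a ha m => by rw [Ideal.mem_bot.1 ha, C_0, zero_smul]
  intro 𝔞
  induction 𝔞 using WellFoundedGT.induction with
  | ind 𝔞 ih =>
  intro M _ _ hM
  induction hM using IsNoetherianRing.induction_on_isQuotientEquivQuotientPrime with
  | subsingleton N =>
    intro _
    exact ⟨0, ffr_zero_of_equiv (a := 0) (LinearEquiv.ofSubsingleton _ _)⟩
  | quotient N P e =>
    intro hN
    have hle : 𝔞 ≤ P.1.comap C := by
      intro a ha
      obtain ⟨y, hy⟩ := e.surjective (Submodule.Quotient.mk 1)
      have := congrArg e (hN a ha y)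
      rw [map_smul, hy, map_zero, ← Submodule.Quotient.mk_smul, smul_eq_mul, mul_one] at this
      exact (Submodule.Quotient.mk_eq_zero P.1).1 this
    rcases eq_or_lt_of_le hle with h | h
    · have := P.2
      obtain ⟨k, hk⟩ := exists_ffr_quotient_prime hR 𝔞 (fun 𝔟 h𝔟 => ih 𝔟 h𝔟) P.1 h.symm
      exact ⟨k, hk.of_equiv e.symm⟩
    · refine ih _ h N fun a ha m => e.injective ?_
      obtain ⟨g, hg⟩ := Submodule.Quotient.mk_surjective _ (e m)
      rw [map_smul, map_zero, ← hg, ← Submodule.Quotient.mk_smul]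
      exact (Submodule.Quotient.mk_eq_zero _).2 (Ideal.mul_mem_right _ _ ha)
  | exact N₁ N₂ N₃ f g hf hg hfg h₁ h₃ =>
    intro hN
    obtain ⟨k, hk⟩ := h₁ fun a ha m => hf (by rw [map_smul, hN a ha, map_zero])
    obtain ⟨l, hl⟩ := h₃ fun a ha m => by
      obtain ⟨y, rfl⟩ := hg m
      rw [← map_smul, hN a ha, map_zero]
    exact ⟨max k l, FFR.of_exact f g hf hg hfg (hk.mono (le_max_left _ _))
      (hl.mono (le_max_right _ _))⟩

end PolynomialSyzygies

section Cancellation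

open Matrix

lemma rkAt_one {R : Type*} [CommRing R] {m : ℕ} (p : PrimeSpectrum R) :
    rkAt p (1 : Matrix (Fin m) (Fin m) R) = m := by
  rw [rkAt, Matrix.map_one _ (map_zero _) (map_one _), Matrix.rank_one, Fintype.card_fin]

/-- A unimodular column longer than the dimension plus one is completable. -/
lemma Unimod.glEquiv_single {S : Type*} [CommRing S] [IsNoetherianRing S] {D N : ℕ}
    (hD : ringKrullDim S ≤ D) (hN : D < N) (y : Fin (N + 1) → S) (hy : Unimod y) :
    GLEquiv y (Pi.single 0 1) := by
  obtain ⟨t, -, ht⟩ := exists_avoid (m := N) (N := N) (D := D) (⊥ : Ideal S)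
    {p : PrimeSpectrum S | y 0 ∉ p.asIdeal} (fun _ _ => bot_le)
    (fun p hp q hqp _ h => hp (hqp h))
    ((Order.krullDim_le_of_strictMono Subtype.val fun _ _ h => h).trans hD) hN 1 (one_mul 1)
    (fun p _ => (rkAt_one p).ge) (y 0) (fun p hp => hp) (Fin.tail y)
  have h1 := GLEquiv.add_smul y (Fin.cons 0 t) 0 rfl
  set z := y + y 0 • (Fin.cons 0 t : Fin (N + 1) → S) with hz
  have hz0 : z 0 = y 0 := by simp [hz]
  have hz1 : Fin.tail z = Fin.tail y + y 0 • t := by ext i; simp [hz, Fin.tail]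
  have hzu := h1.unimod hy
  have htop : Ideal.span (Set.range (Fin.tail z)) = ⊤ := by
    by_contra hne
    obtain ⟨M, hM, hle⟩ := Ideal.exists_le_maximal _ hne
    have hmem : ∀ j, (Fin.tail y + y 0 • t) j ∈ M := fun j =>
      hz1 ▸ hle (Ideal.subset_span ⟨j, rfl⟩)
    have hy0 : y 0 ∈ M := by
      by_contra h
      exact ht ⟨M, hM.isPrime⟩ h hmem
    refine hM.ne_top ((Ideal.eq_top_iff_one _).2 ?_)
    obtain ⟨r, hr⟩ := hzu
    rw [← hr]
    refine M.sum_mem fun i _ => M.mul_mem_left _ ?_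
    refine Fin.cases ?_ (fun j => ?_) i
    · rwa [hz0]
    · have := hmem j
      rwa [← hz1] at this
  obtain ⟨r, hr⟩ := (unimod_iff_span_eq_top _).2 htop
  set v : Fin (N + 1) → S := Fin.cons 0 ((1 - z 0) • r) with hv
  have h2 : GLEquiv z (z + (v ⬝ᵥ z) • Pi.single 0 1) := by
    refine ⟨transvectionUnit (Pi.single 0 1) v (by simp [hv]), ?_⟩
    change (1 + vecMulVec _ _) *ᵥ z = _
    rw [add_mulVec, one_mulVec, vecMulVec_mulVec']
  refine h1.trans (h2.trans (GLEquiv.of_eq_one _ 0 ?_))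
  have : v ⬝ᵥ z = 1 - z 0 := by
    have : v ⬝ᵥ z = ((1 - z 0) • r) ⬝ᵥ Fin.tail z := by
      simp [dotProduct, Fin.sum_univ_succ, hv, Fin.tail]
    rw [this, smul_dotProduct, hr, smul_eq_mul, mul_one]
  simp [this]

variable {S : Type*} [CommRing S] [IsNoetherianRing S] {D : ℕ}

lemma nonempty_equiv_of_prod_equiv (hD : ringKrullDim S ≤ D) {N : ℕ} (hN : D < N)
    {Q : Type*} [AddCommGroup Q] [Module S Q] (e : (Q × S) ≃ₗ[S] (Fin (N + 1) → S)) :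
    Nonempty (Q ≃ₗ[S] (Fin N → S)) := by
  have hu : Unimod (e (0, 1)) := by
    refine ⟨fun i => (e.symm (Pi.single i 1)).2, ?_⟩
    have := LinearMap.pi_apply_eq_sum_univ (LinearMap.snd S Q S ∘ₗ e.symm.toLinearMap) (e (0, 1))
    simp only [LinearMap.comp_apply, LinearEquiv.coe_coe, LinearEquiv.symm_apply_apply,
      LinearMap.snd_apply] at this
    refine Eq.trans ?_ this.symm
    rw [dotProduct]
    refine Finset.sum_congr rfl fun i _ => ?_
    have hs : (Pi.single i 1 : Fin (N + 1) → S) = fun j => if i = j then 1 else 0 := by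
      funext j
      simp [Pi.single_apply, eq_comm]
    rw [smul_eq_mul, mul_comm, hs]
  obtain ⟨γ, hγ⟩ := hu.glEquiv_single hD hN
  let g : (Q × S) ≃ₗ[S] (Fin (N + 1) → S) := e ≪≫ₗ
    LinearEquiv.ofLinearMap (Matrix.mulVecLin γ.1) (Matrix.mulVecLin (γ⁻¹).1)
      (by rw [← Matrix.mulVecLin_mul, Units.mul_inv, Matrix.mulVecLin_one])
      (by rw [← Matrix.mulVecLin_mul, Units.inv_mul, Matrix.mulVecLin_one])
  have hg : ∀ c, g (0, c) = c • Pi.single 0 1 := by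
    intro c
    have : ((0, c) : Q × S) = c • (0, 1) := by simp
    rw [this, map_smul]
    exact congrArg _ hγ
  have hadd : ∀ q c, g (q, c) = g (q, 0) + c • Pi.single 0 1 := fun q c => by
    rw [← hg, ← map_add]; simp
  let f : Q →ₗ[S] (Fin N → S) :=
    { toFun := fun q => Fin.tail (g (q, 0))
      map_add' := fun q q' => by
        have : ((q + q', 0) : Q × S) = (q, 0) + (q', 0) := by simp
        rw [this, map_add]; rfl
      map_smul' := fun c q => by
        have : ((c • q, 0) : Q × S) = c • (q, 0) := by simp
        rw [this, map_smul]; rfl }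
  refine ⟨LinearEquiv.ofBijective f ⟨?_, ?_⟩⟩
  · rw [injective_iff_map_eq_zero]
    intro q hq
    have : g (q, 0) = g (0, g (q, 0) 0) := by
      rw [hg]
      ext i
      refine Fin.cases ?_ (fun j => ?_) i
      · simp
      · have hj : g (q, 0) j.succ = 0 := congrFun hq j
        simp [hj]
    exact congrArg Prod.fst (g.injective this)
  · intro z
    obtain ⟨⟨q, c⟩, hqc⟩ := g.surjective (Fin.cons 0 z)
    refine ⟨q, ?_⟩
    rw [hadd] at hqc
    ext j
    have := congrFun hqc j.succ
    change g (q, 0) j.succ = z j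
    simpa using this

/-- Stably free modules of rank larger than the dimension are free. -/
lemma free_of_prod_equiv (hD : ringKrullDim S ≤ D) {P : Type*} [AddCommGroup P] [Module S P]
    (a : ℕ) : ∀ b, a + D + 1 ≤ b → ((P × (Fin a → S)) ≃ₗ[S] (Fin b → S)) → Module.Free S P := by
  induction a with
  | zero => exact fun b _ e => Module.Free.of_equiv (LinearEquiv.prodUnique.symm ≪≫ₗ e).symm
  | succ a ih =>
    intro b hb e
    obtain ⟨b, rfl⟩ : ∃ b', b = b' + 1 := ⟨b - 1, by omega⟩
    have e' : ((P × (Fin a → S)) × S) ≃ₗ[S] (Fin (b + 1) → S) :=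
      LinearEquiv.prodAssoc S P _ _ ≪≫ₗ ((LinearEquiv.refl S P).prodCongr
        (((LinearEquiv.refl S _).prodCongr (LinearEquiv.funUnique (Fin 1) S S).symm) ≪≫ₗ
          prodFinEquiv S a 1)) ≪≫ₗ e
    obtain ⟨e''⟩ := nonempty_equiv_of_prod_equiv hD (by omega : D < b) e'
    exact ih b (by omega) e''

end Cancellation

section RankAtStalk

open Matrix TensorProduct

lemma rankAtStalk_eq_rkAt {R P : Type*} [CommRing R] [AddCommGroup P] [Module R P]
    [Module.Finite R P] [Module.Projective R P] {m : ℕ} (π : (Fin m → R) →ₗ[R] P)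
    (ι : P →ₗ[R] (Fin m → R)) (h : π ∘ₗ ι = LinearMap.id) (p : PrimeSpectrum R) :
    Module.rankAtStalk P p = rkAt p (LinearMap.toMatrix' (ι ∘ₗ π)) := by
  let κ := p.asIdeal.ResidueField
  let b := Pi.basisFun R (Fin m)
  have h1 : LinearMap.toMatrix (Algebra.TensorProduct.basis κ b) (Algebra.TensorProduct.basis κ b) ((ι ∘ₗ π).baseChange κ) =
      (LinearMap.toMatrix' (ι ∘ₗ π)).map (algebraMap R κ) := by
    rw [LinearMap.toMatrix_baseChange, LinearMap.toMatrix_eq_toMatrix']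
  have h2 : π.baseChange κ ∘ₗ ι.baseChange κ = LinearMap.id := by
    rw [← LinearMap.baseChange_comp, h, LinearMap.baseChange_id]
  have hinj : Function.Injective (ι.baseChange κ) :=
    Function.LeftInverse.injective (g := π.baseChange κ) fun x => LinearMap.congr_fun h2 x
  have hsurj : Function.Surjective (π.baseChange κ) :=
    Function.RightInverse.surjective (g := ι.baseChange κ) fun x => LinearMap.congr_fun h2 x
  rw [Module.rankAtStalk_eq, rkAt, ← h1,
    Matrix.rank_eq_finrank_range_toLin _ (Algebra.TensorProduct.basis κ b) (Algebra.TensorProduct.basis κ b), Matrix.toLin_toMatrix,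
    LinearMap.baseChange_comp, LinearMap.range_comp, LinearMap.range_eq_top.2 hsurj,
    Submodule.map_top, LinearMap.finrank_range_of_inj hinj]

lemma rankAtStalk_range {R : Type*} [CommRing R] {m : ℕ} (e : Matrix (Fin m) (Fin m) R)
    (he : e * e = e) (p : PrimeSpectrum R) :
    Module.rankAtStalk (LinearMap.range e.mulVecLin) p = rkAt p e := by
  have := projective_range e he
  have : Module.Finite R (LinearMap.range e.mulVecLin) := Module.Finite.range _
  rw [rankAtStalk_eq_rkAt e.mulVecLin.rangeRestrict (Submodule.subtype _)]
  · exact congrArg _ (LinearMap.toMatrix'_toLin' e)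
  · ext1 ⟨_, v, rfl⟩
    ext1
    simp [he]

/-- A projective module with a finite free resolution and of rank larger than the dimension is
free. -/
lemma exists_factor_of_ffr {S : Type*} [CommRing S] [IsNoetherianRing S] [Nontrivial S]
    {D m k : ℕ} (hD : ringKrullDim S ≤ D) (e : Matrix (Fin m) (Fin m) S) (he : e * e = e)
    (hrk : ∀ p, D < rkAt p e) (h : FFR S k (LinearMap.range e.mulVecLin)) :
    ∃ (r : ℕ) (X : Matrix (Fin m) (Fin r) S) (Y : Matrix (Fin r) (Fin m) S),
      X * Y = e ∧ Y * X = 1 := by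
  have := projective_range e he
  have : Module.Finite S (LinearMap.range e.mulVecLin) := Module.Finite.range _
  obtain ⟨a, b, ⟨g⟩⟩ := h.stablyFree
  obtain ⟨p⟩ := (inferInstance : Nonempty (PrimeSpectrum S))
  have hr := congrFun (Module.rankAtStalk_eq_of_equiv g) p
  rw [Module.rankAtStalk_prod, Module.rankAtStalk_eq_finrank_of_free (M := Fin b → S), Pi.add_apply,
    Module.rankAtStalk_eq_finrank_of_free (M := Fin a → S), rankAtStalk_range e he] at hr
  have hr' := hrk p
  simp at hr
  have := free_of_prod_equiv hD a b (by omega) g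
  exact exists_factor_of_free e he

end RankAtStalk

section FreeLocus

open Matrix Polynomial

lemma RegularAt.freeOver {A : Type*} [CommRing A] [IsNoetherianRing A] {p : PrimeSpectrum A}
    (hp : RegularAt A p) {D m : ℕ} (hD : ringKrullDim (Localization.AtPrime p.asIdeal) + 1 ≤ D)
    (e : Matrix (Fin m) (Fin m) A[X]) (he : e * e = e) (hrk : ∀ p, D < rkAt p e) :
    FreeOver e (mapRingHom (algebraMap A (Localization.AtPrime p.asIdeal))) := by
  obtain ⟨s, hs, hcard⟩ := hp
  have : IsNoetherianRing (Localization.AtPrime p.asIdeal) :=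
    IsLocalization.isNoetherianRing p.asIdeal.primeCompl _ inferInstance
  have hf : Set.range (fun i : Fin s.card => (s.equivFin.symm i : Localization.AtPrime p.asIdeal)) =
      s := by
    ext x
    constructor
    · rintro ⟨i, rfl⟩
      exact (s.equivFin.symm i).2
    · exact fun hx => ⟨s.equivFin ⟨x, hx⟩, by simp⟩
  have hR := (isDomain_and_exists_ffr_of_span_eq_maximalIdeal s.card (Localization.AtPrime p.asIdeal)
    (fun i => (s.equivFin.symm i : Localization.AtPrime p.asIdeal)) (hf ▸ hs) hcard.le).2
  set g := mapRingHom (algebraMap A (Localization.AtPrime p.asIdeal)) with hg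
  have heg : e.map g * e.map g = e.map g := by rw [← Matrix.map_mul, he]
  have : Module.Finite (Localization.AtPrime p.asIdeal)[X]
    (LinearMap.range (e.map g).mulVecLin) := Module.Finite.range _
  obtain ⟨k, hk⟩ := exists_ffr_polynomial hR (LinearMap.range (e.map g).mulVecLin)
  refine exists_factor_of_ffr (D := D) ?_ _ heg (fun q => ?_) hk
  · rwa [Polynomial.ringKrullDim_of_isNoetherianRing]
  · rw [rkAt_map g q e he]
    exact hrk _

attribute [local instance] Polynomial.algebra Polynomial.isLocalization

/-- The free locus of `e` over `Spec A` is open. -/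
lemma exists_ideal_freeOver_iff {A : Type*} [CommRing A] {m : ℕ}
    (e : Matrix (Fin m) (Fin m) A[X]) :
    ∃ K : Ideal A, ∀ (𝔭 : Ideal A) [𝔭.IsPrime], ¬ K ≤ 𝔭 ↔
      FreeOver e (mapRingHom (algebraMap A (Localization.AtPrime 𝔭))) := by
  refine ⟨Ideal.span {a | ∃ (r : ℕ) (X : Matrix (Fin m) (Fin r) A[X])
    (Y : Matrix (Fin r) (Fin m) A[X]), X * Y = C a • e ∧ Y * X = C a • 1}, fun 𝔭 _ => ?_⟩
  constructor
  · intro h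
    rw [Ideal.span_le, Set.not_subset] at h
    obtain ⟨a, ⟨r, X, Y, h1, h2⟩, ha⟩ := h
    obtain ⟨u, hu⟩ := IsLocalization.map_units (Localization.AtPrime 𝔭) (⟨a, ha⟩ : 𝔭.primeCompl)
    set g := mapRingHom (algebraMap A (Localization.AtPrime 𝔭)) with hg
    have hga : C (↑u⁻¹ : Localization.AtPrime 𝔭) * g (C a) = 1 := by
      rw [hg, coe_mapRingHom, map_C, ← C_mul]
      change C (_ * algebraMap A _ ((⟨a, ha⟩ : 𝔭.primeCompl) : A)) = 1
      rw [← hu, Units.inv_mul, C_1]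
    have hsm : ∀ {p q : ℕ} (Z : Matrix (Fin p) (Fin q) A[X]), (C a • Z).map g =
        g (C a) • Z.map g := fun Z => by ext1 i j; simp
    refine ⟨r, X.map g, C (↑u⁻¹ : Localization.AtPrime 𝔭) • Y.map g, ?_, ?_⟩
    · rw [Matrix.mul_smul, ← Matrix.map_mul, h1, hsm, smul_smul, hga, one_smul]
    · rw [Matrix.smul_mul, ← Matrix.map_mul, h2, hsm, smul_smul, hga, one_smul,
        Matrix.map_one _ (map_zero _) (map_one _)]
  · rintro ⟨r, X, Y, h1, h2⟩ hle
    let M := 𝔭.primeCompl.map (C : A →+* A[X])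
    let L := Localization.AtPrime 𝔭
    obtain ⟨s₁, hs₁, X₁, hX₁⟩ := exists_lift_of_finite M (R' := L[X])
      fun ij : Fin m × Fin r => X ij.1 ij.2
    obtain ⟨s₂, hs₂, Y₁, hY₁⟩ := exists_lift_of_finite M (R' := L[X])
      fun ij : Fin r × Fin m => Y ij.1 ij.2
    let X₂ : Matrix (Fin m) (Fin r) A[X] := Matrix.of fun i j => X₁ (i, j)
    let Y₂ : Matrix (Fin r) (Fin m) A[X] := Matrix.of fun i j => Y₁ (i, j)
    have hX₂ : X₂.map (algebraMap A[X] L[X]) = algebraMap A[X] L[X] s₁ • X := by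
      ext1 i j; exact hX₁ (i, j)
    have hY₂ : Y₂.map (algebraMap A[X] L[X]) = algebraMap A[X] L[X] s₂ • Y := by
      ext1 i j; exact hY₁ (i, j)
    obtain ⟨s₃, hs₃, h₃⟩ := exists_mul_eq_of_finite L[X] M
      (fun ij : Fin m × Fin m => (X₂ * Y₂) ij.1 ij.2) (fun ij => ((s₁ * s₂) • e) ij.1 ij.2) (by
        rintro ⟨i, j⟩
        have : (X₂ * Y₂).map (algebraMap A[X] L[X]) =
            ((s₁ * s₂) • e).map (algebraMap A[X] L[X]) := by
          rw [Matrix.map_mul, hX₂, hY₂, Matrix.smul_mul, Matrix.mul_smul, h1]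
          ext1 i j
          simp [mul_assoc]; rfl
        exact congrFun (congrFun this i) j)
    obtain ⟨s₄, hs₄, h₄⟩ := exists_mul_eq_of_finite L[X] M
      (fun ij : Fin r × Fin r => (Y₂ * X₂) ij.1 ij.2)
      (fun ij => ((s₁ * s₂) • (1 : Matrix (Fin r) (Fin r) A[X])) ij.1 ij.2) (by
        rintro ⟨i, j⟩
        have : (Y₂ * X₂).map (algebraMap A[X] L[X]) =
            ((s₁ * s₂) • (1 : Matrix (Fin r) (Fin r) A[X])).map (algebraMap A[X] L[X]) := by
          rw [Matrix.map_mul, hX₂, hY₂, Matrix.smul_mul, Matrix.mul_smul, h2]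
          ext1 i j
          rw [smul_smul, Matrix.smul_apply, Matrix.map_apply, Matrix.smul_apply, Matrix.one_apply,
            Matrix.one_apply, smul_eq_mul, smul_eq_mul, map_mul, map_mul, mul_comm (algebraMap _ _ s₂)]
          split_ifs <;> simp
        exact congrFun (congrFun this i) j)
    obtain ⟨a, ha, hac⟩ := mul_mem (mul_mem hs₃ hs₄) (mul_mem hs₁ hs₂)
    refine ha (hle (Ideal.subset_span ⟨r, (s₃ * s₄) • X₂, Y₂, ?_, ?_⟩))
    · rw [show (C : A →+* A[X]) a = _ from hac, Matrix.smul_mul]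
      ext1 i j
      have := h₃ (i, j)
      simp only [Matrix.smul_apply, smul_eq_mul] at this ⊢
      linear_combination s₄ * this
    · rw [show (C : A →+* A[X]) a = _ from hac, Matrix.mul_smul]
      ext1 i j
      have := h₄ (i, j)
      simp only [Matrix.smul_apply, smul_eq_mul] at this ⊢
      linear_combination s₃ * this

end FreeLocus

section MonicCase

open Matrix Polynomial

lemma ringKrullDim_localization_add_length_le {A : Type*} [CommRing A] {d : ℕ} (hdim : ringKrullDim A = d)
    {S : Set (PrimeSpectrum A)} (l : LTSeries S) :
    ringKrullDim (Localization.AtPrime l.head.1.asIdeal) + l.length ≤ d := by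
  have : Nonempty (PrimeSpectrum A) := ⟨l.head.1⟩
  let l' : LTSeries (PrimeSpectrum A) := l.map Subtype.val fun _ _ h => h
  have h1 : (l.length : ℕ∞) ≤ Order.coheight l.head.1 := Order.length_le_coheight_head (p := l')
  have h2 : ((Order.height l.head.1 + Order.coheight l.head.1 : ℕ∞) : WithBot ℕ∞) ≤ d := by
    rw [← hdim, ringKrullDim, Order.krullDim_eq_iSup_height_add_coheight_of_nonempty]
    exact WithBot.coe_le_coe.2 (le_iSup (fun a : PrimeSpectrum A =>
      Order.height a + Order.coheight a) l.head.1)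
  rw [IsLocalization.AtPrime.ringKrullDim_eq_height l.head.1.asIdeal, PrimeSpectrum.height_eq_orderHeight]
  refine le_trans ?_ h2
  change ((Order.height l.head.1 : ℕ∞) : WithBot ℕ∞) + ((l.length : ℕ∞) : WithBot ℕ∞) ≤ _
  rw [← WithBot.coe_add]
  exact WithBot.coe_le_coe.2 (add_le_add_right h1 _)

lemma ringKrullDim_quotient_nonfree_le {A : Type*} [CommRing A] [IsNoetherianRing A] {d n m : ℕ}
    (hdim : ringKrullDim A = d) (hn : d + 3 ≤ 2 * n) (𝒥 : Ideal A)
    (hsing : ∀ p : PrimeSpectrum A, ¬ RegularAt A p ↔ 𝒥 ≤ p.asIdeal)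
    (hht : ∀ m : ℕ, (m : ℤ) = (d : ℤ) - n + 2 → (m : WithBot (WithTop ℕ)) ≤ idealHt 𝒥)
    (e : Matrix (Fin m) (Fin m) A[X]) (he : e * e = e) (hrk : ∀ p, n ≤ rkAt p e) (K : Ideal A)
    (hK : ∀ (𝔭 : Ideal A) [𝔭.IsPrime], FreeOver e (mapRingHom (algebraMap A
      (Localization.AtPrime 𝔭))) → ¬ K ≤ 𝔭) :
    ringKrullDim (A ⧸ K) ≤ (n - 2 : ℕ) := by
  rw [ringKrullDim_quotient, Order.krullDim]
  refine iSup_le fun l => ?_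
  by_contra! hlt
  have hlen : n - 2 < l.length := by exact_mod_cast hlt
  have hle := ringKrullDim_localization_add_length_le hdim l
  set p := l.head.1 with hp
  obtain ⟨c, hc⟩ : ∃ c : ℕ, ringKrullDim (Localization.AtPrime p.asIdeal) = c := by
    have h0 : (0 : WithBot ℕ∞) ≤ l.length := by exact_mod_cast Nat.zero_le _
    have h1 := (le_add_of_nonneg_right h0).trans hle
    have h2 : (0 : WithBot ℕ∞) ≤ ringKrullDim (Localization.AtPrime p.asIdeal) :=
      ringKrullDim_nonneg_of_nontrivial
    generalize ringKrullDim (Localization.AtPrime p.asIdeal) = x at *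
    induction x with
    | bot => simp at h2
    | coe x =>
      have : x ≤ d := by exact_mod_cast h1
      obtain ⟨y, rfl⟩ := ENat.ne_top_iff_exists.1 (ne_top_of_le_ne_top (ENat.natCast_ne_top d) this)
      exact ⟨y, rfl⟩
  rw [hc] at hle
  have hle' : c + l.length ≤ d := by exact_mod_cast hle
  have hreg : RegularAt A p := by
    by_contra hsg
    have h1 := hht (d + 2 - n) (by omega)
    have h2 : idealHt 𝒥 ≤ ringKrullDim (Localization.AtPrime p.asIdeal) :=
      iInf₂_le p ((hsing p).1 hsg)
    have h3 : ((d + 2 - n : ℕ) : WithBot ℕ∞) ≤ (c : ℕ) := (h1.trans h2).trans hc.le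
    have h4 : d + 2 - n ≤ c := by exact_mod_cast h3
    omega
  refine hK p.asIdeal (hreg.freeOver (D := n - 1) ?_ e he fun q => ?_) l.head.2
  · rw [hc]
    exact_mod_cast (by omega : c + 1 ≤ n - 1)
  · have := hrk q
    omega

theorem exists_unimod_of_monic {A : Type*} [CommRing A] [IsNoetherianRing A] {d n m : ℕ}
    (hdim : ringKrullDim A = d) (hn : d + 3 ≤ 2 * n) (𝒥 : Ideal A)
    (hsing : ∀ p : PrimeSpectrum A, ¬ RegularAt A p ↔ 𝒥 ≤ p.asIdeal)
    (hht : ∀ m : ℕ, (m : ℤ) = (d : ℤ) - n + 2 → (m : WithBot (WithTop ℕ)) ≤ idealHt 𝒥)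
    (e : Matrix (Fin (m + 1)) (Fin (m + 1)) A[X]) (he : e * e = e) (hrk : ∀ p, n ≤ rkAt p e)
    (v φ : Fin (m + 1) → A[X]) (hv : e *ᵥ v = v) (hφ : (φ ⬝ᵥ v).Monic) :
    ∃ v, e *ᵥ v = v ∧ Unimod v := by
  obtain ⟨K, hK⟩ := exists_ideal_freeOver_iff e
  have hdK := ringKrullDim_quotient_nonfree_le hdim hn 𝒥 hsing hht e he hrk K
    fun 𝔭 _ h => (hK 𝔭).2 h
  have hdKX : ringKrullDim (A[X] ⧸ K.map (C : A →+* A[X])) ≤ (n - 1 : ℕ) := by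
    rw [← ringKrullDim_eq_of_ringEquiv K.polynomialQuotientEquivQuotientPolynomial,
      Polynomial.ringKrullDim_of_isNoetherianRing]
    refine (add_le_add_left hdK 1).trans ?_
    exact_mod_cast (by omega : n - 2 + 1 ≤ n - 1)
  obtain ⟨q, hq, hφq, hKq, hdq⟩ := exists_monic_inGenPos (D₁ := d + 1) e he hrk (K.map C)
    (by rw [Polynomial.ringKrullDim_of_isNoetherianRing, hdim]; norm_cast) hdKX (by omega) v φ hv hφ
  refine exists_unimod_of_freeOver (D := n - 2) e he hrk (by omega) q hq _ hφq
    ((mem_span_range_iff_dotProduct _ _).2 ⟨φ, rfl⟩) (hdq.trans ?_) K hKq fun 𝔭 _ h => (hK 𝔭).1 h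
  exact_mod_cast (by omega : d + 1 - n ≤ n - 2)

end MonicCase

section Conversion

open Matrix

lemma exists_section_pi_fin (R P : Type*) [CommRing R] [AddCommGroup P] [Module R P]
    [Module.Finite R P] [Module.Projective R P] :
    ∃ (m : ℕ) (π : (Fin (m + 1) → R) →ₗ[R] P) (ι : P →ₗ[R] (Fin (m + 1) → R)),
      π ∘ₗ ι = LinearMap.id := by
  obtain ⟨m, f, hf⟩ := Module.Finite.exists_fin' R P
  let π : (Fin (m + 1) → R) →ₗ[R] P := f ∘ₗ LinearMap.funLeft R R Fin.castSucc
  have hπ : Function.Surjective π := hf.comp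
    (LinearMap.funLeft_surjective_of_injective R R _ (Fin.castSucc_injective m))
  obtain ⟨ι, hι⟩ := Module.projective_lifting_property π LinearMap.id hπ
  exact ⟨m, π, ι, hι⟩

lemma exists_pow_of_hasUnimodular {R P : Type*} [CommRing R] [AddCommGroup P] [Module R P]
    {m : ℕ} (π : (Fin m → R) →ₗ[R] P) (ι : P →ₗ[R] (Fin m → R)) (hπι : π ∘ₗ ι = LinearMap.id)
    (f : R) (h : HasUnimodular (Localization (Submonoid.powers f))
      (LocalizedModule (Submonoid.powers f) P)) :
    ∃ (p : P) (φ : Fin m → R) (N : ℕ), φ ⬝ᵥ ι p = f ^ N := by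
  obtain ⟨x, φ₀, hφ₀⟩ := h
  let R' := Localization (Submonoid.powers f)
  let L : P →ₗ[R] R' := φ₀.restrictScalars R ∘ₗ
    LocalizedModule.mkLinearMap (Submonoid.powers f) P
  obtain ⟨⟨p, s⟩, hps⟩ := IsLocalizedModule.mk'_surjective (Submonoid.powers f)
    (LocalizedModule.mkLinearMap (Submonoid.powers f) P) x
  have hL : L p = algebraMap R R' s := by
    have h1 : LocalizedModule.mkLinearMap (Submonoid.powers f) P p = (s : R) • x := by
      rw [← hps]
      exact (IsLocalizedModule.mk'_cancel' _ p s).symm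
    change φ₀ (LocalizedModule.mkLinearMap (Submonoid.powers f) P p) = _
    rw [h1, ← IsScalarTower.algebraMap_smul R', map_smul, hφ₀, smul_eq_mul, mul_one]
  obtain ⟨t, ht, c, hc⟩ := exists_lift_of_finite (Submonoid.powers f) (R' := R')
    fun j => L (π (Pi.single j 1))
  have hLy : ∀ y, algebraMap R R' (c ⬝ᵥ y) = algebraMap R R' t * L (π y) := fun y => by
    have := LinearMap.pi_apply_eq_sum_univ (L ∘ₗ π) y
    simp only [LinearMap.comp_apply] at this
    rw [this, dotProduct, map_sum, Finset.mul_sum]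
    refine Finset.sum_congr rfl fun j _ => ?_
    have hs : (fun k => if j = k then 1 else 0 : Fin m → R) = Pi.single j 1 := by
      funext k
      simp [Pi.single_apply, eq_comm]
    rw [map_mul, hc, hs, Algebra.smul_def]
    ring
  have hp := hLy (ι p)
  rw [show π (ι p) = p from LinearMap.congr_fun hπι p, hL, ← map_mul] at hp
  obtain ⟨u, hu⟩ := (IsLocalization.eq_iff_exists (Submonoid.powers f) R').1 hp
  obtain ⟨N, hN⟩ := mul_mem u.2 (mul_mem ht s.2)
  exact ⟨p, (u : R) • c, N, by rw [smul_dotProduct, smul_eq_mul, hu]; exact hN.symm⟩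

end Conversion

/-- (Theorem 3.1) Let `A` be Noetherian of dimension `d` containing an infinite field `k`, and
`P` a finitely generated projective `A[T]`-module of rank `n` with `2n ≥ d + 3`.  Assume the
singular locus of `Spec A` is `V(𝒥)` with `ht 𝒥 ≥ d − n + 2`.  If `P_f` has a unimodular
element for some monic `f ∈ A[T]`, then `P` has a unimodular element. -/
theorem stmt9 (k A : Type*) [Field k] [Infinite k] [CommRing A] [IsNoetherianRing A]
    [Algebra k A] (d n : ℕ) (hdim : ringKrullDim A = d) (hn : d + 3 ≤ 2 * n)
    (𝒥 : Ideal A)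
    (hsing : ∀ p : PrimeSpectrum A, ¬ RegularAt A p ↔ 𝒥 ≤ p.asIdeal)
    (hht : ∀ m : ℕ, (m : ℤ) = (d : ℤ) - n + 2 → (m : WithBot (WithTop ℕ)) ≤ idealHt 𝒥)
    (P : Type*) [AddCommGroup P] [Module (Polynomial A) P]
    [Module.Finite (Polynomial A) P] [Module.Projective (Polynomial A) P]
    (hrank : HasRank (Polynomial A) P n)
    (f : Polynomial A) (hf : f.Monic)
    (h : HasUnimodular (Localization (Submonoid.powers f))
      (LocalizedModule (Submonoid.powers f) P)) :
    HasUnimodular (Polynomial A) P := by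
  obtain ⟨m, π, ι, hπι⟩ := exists_section_pi_fin (Polynomial A) P
  have hπι' : ∀ x, π (ι x) = x := fun x => LinearMap.congr_fun hπι x
  set e := LinearMap.toMatrix' (ι ∘ₗ π) with he_def
  have hev : ∀ x, e.mulVec x = ι (π x) := fun x => LinearMap.toMatrix'_mulVec _ x
  have he : e * e = e := by
    rw [he_def, ← LinearMap.toMatrix'_comp]
    refine congrArg _ (LinearMap.ext fun x => ?_)
    simp only [LinearMap.comp_apply, hπι']
  have hrk : ∀ p, n ≤ rkAt p e := fun p => by
    rw [he_def, ← rankAtStalk_eq_rkAt π ι hπι p]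
    exact (Module.finrank_eq_of_rank_eq (hrank p)).ge
  obtain ⟨p, φ, N, hφ⟩ := exists_pow_of_hasUnimodular π ι hπι f h
  obtain ⟨v, hv, r, hr⟩ := exists_unimod_of_monic hdim hn 𝒥 hsing hht e he hrk (ι p) φ
    (by rw [hev, hπι']) (by rw [hφ]; exact hf.pow N)
  refine ⟨π v, dotProductBilin (Polynomial A) (Polynomial A) r ∘ₗ ι, ?_⟩
  change dotProduct r (ι (π v)) = 1
  rw [← hev, hv, hr]
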